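/- arXiv:2301.07063 — 2 statements merged into one kernel-verified Lean document; each statement's English description precedes it below -/
import Mathlib

section
/- Let ε₁, ε₂ ∈ {±1}, k, k' ∈ ℤ_L^d and β, β' ∈ ℝ. Consider quadruples (k₁,k₂,k₃,k₄) ∈ (ℤ_L^d)⁴ with |k_j − k_j⁰| ≤ 1 for each j, satisfying either system (i): ε₁k₁ + ε₂k₂ − k₃ = k, |ε₁|k₁|² + ε₂|k₂|² − |k₃|² − β| ≤ δ^{−1}L^{−2γ}, k₃ − k₄ = k', and ||k₃|² − |k₄|² − β'| ≤ δ^{−1}L^{−2γ} (where ε₁, ε₂, −1 are not all equal); or system (ii): ε₁k₁ + ε₂k₂ + k₃ = k, |ε₁|k₁|² + ε₂|k₂|² + |k₃|² − β| ≤ δ^{−1}L^{−2γ}, −ε₁k₁ − ε₂k₂ − k₄ = k', and |−ε₁|k₁|² − ε₂|k₂|² − |k₄|² − β'| ≤ δ^{−1}L^{−2γ} (where ε₁, ε₂, +1 are not all equal). Let r denote the fixed vector k₃ − k₄ (namely r = k' in case (i) and r = k + k' in case (ii)), and suppose P ∈ [L^{−1},1] ∪ {0} satisfies: r = 0 if P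 = 0; P ≤ |r| ≤ 2P if P < 1; |r| ≥ 1 if P = 1. Then the number 𝔠 of such quadruples satisfies: if γ ≤ 1/2 or P = 0, 𝔠 ≤ C·δ^{−1}·L^{2(d−γ)}·(1 + δL^{2γ}P)^{−1}; if γ > 1/2 and P ≠ 0, 𝔠 ≤ C·δ^{−2}·L^{2(d−γ)}·min((LP)^{−1} + L^{−(2−2γ)}, L^{−10η}); if γ > 4/5 − 10η and P ≠ 0, 𝔠 ≤ C·δ^{−2}·L^{2(d−γ)−(1−γ)−20η}. In all cases 𝔠 ≤ C·δ^{−1}·L^{2(d−γ)}·𝔛^{−1}, where 𝔛 := min((log L)², 1 + δL^{2γ}P). -/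
open scoped RealInnerProductSpace BigOperators

noncomputable section

/-- The rescaled lattice `ℤ_L^d = (L⁻¹ℤ)^d` inside `ℝ^d`. -/
def ZLat (d : ℕ) (L : ℝ) : Set (EuclideanSpace ℝ (Fin d)) :=
  {x | ∀ i, ∃ m : ℤ, x i = (m : ℝ) / L}

/-- Quadruples satisfying system (i). -/
def countSysI (d : ℕ) (L δ γ ε₁ ε₂ β β' : ℝ) (k k' k10 k20 k30 k40 : EuclideanSpace ℝ (Fin d)) :
    ℕ :=
  Set.ncard {q : EuclideanSpace ℝ (Fin d) × EuclideanSpace ℝ (Fin d) ×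
      EuclideanSpace ℝ (Fin d) × EuclideanSpace ℝ (Fin d) |
    q.1 ∈ ZLat d L ∧ q.2.1 ∈ ZLat d L ∧ q.2.2.1 ∈ ZLat d L ∧ q.2.2.2 ∈ ZLat d L ∧
    ‖q.1 - k10‖ ≤ 1 ∧ ‖q.2.1 - k20‖ ≤ 1 ∧ ‖q.2.2.1 - k30‖ ≤ 1 ∧ ‖q.2.2.2 - k40‖ ≤ 1 ∧
    ε₁ • q.1 + ε₂ • q.2.1 - q.2.2.1 = k ∧
    |ε₁ * ‖q.1‖ ^ 2 + ε₂ * ‖q.2.1‖ ^ 2 - ‖q.2.2.1‖ ^ 2 - β| ≤ δ⁻¹ * L ^ (-(2 * γ)) ∧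
    q.2.2.1 - q.2.2.2 = k' ∧
    |‖q.2.2.1‖ ^ 2 - ‖q.2.2.2‖ ^ 2 - β'| ≤ δ⁻¹ * L ^ (-(2 * γ))}

/-- Quadruples satisfying system (ii). -/
def countSysII (d : ℕ) (L δ γ ε₁ ε₂ β β' : ℝ) (k k' k10 k20 k30 k40 : EuclideanSpace ℝ (Fin d)) :
    ℕ :=
  Set.ncard {q : EuclideanSpace ℝ (Fin d) × EuclideanSpace ℝ (Fin d) ×
      EuclideanSpace ℝ (Fin d) × EuclideanSpace ℝ (Fin d) |
    q.1 ∈ ZLat d L ∧ q.2.1 ∈ ZLat d L ∧ q.2.2.1 ∈ ZLat d L ∧ q.2.2.2 ∈ ZLat d L ∧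
    ‖q.1 - k10‖ ≤ 1 ∧ ‖q.2.1 - k20‖ ≤ 1 ∧ ‖q.2.2.1 - k30‖ ≤ 1 ∧ ‖q.2.2.2 - k40‖ ≤ 1 ∧
    ε₁ • q.1 + ε₂ • q.2.1 + q.2.2.1 = k ∧
    |ε₁ * ‖q.1‖ ^ 2 + ε₂ * ‖q.2.1‖ ^ 2 + ‖q.2.2.1‖ ^ 2 - β| ≤ δ⁻¹ * L ^ (-(2 * γ)) ∧
    -(ε₁ • q.1) - ε₂ • q.2.1 - q.2.2.2 = k' ∧
    |-(ε₁ * ‖q.1‖ ^ 2) - ε₂ * ‖q.2.1‖ ^ 2 - ‖q.2.2.2‖ ^ 2 - β'| ≤ δ⁻¹ * L ^ (-(2 * γ))}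

theorem card_le_of_dvd_sub {s : Finset ℤ} {D : ℤ} (hD : D ≠ 0) {n : ℕ}
    (hs : ∀ x ∈ s, ∀ y ∈ s, D ∣ x - y ∧ |x - y| ≤ |D| * n) : s.card ≤ n + 1 := by
  rcases s.eq_empty_or_nonempty with rfl | hne
  · simp
  set x₀ := s.min' hne with hx₀
  have hx₀s : x₀ ∈ s := s.min'_mem hne
  have hD' : 0 < |D| := abs_pos.mpr hD
  have hmap : ∀ x ∈ s, (x - x₀) / |D| ∈ Finset.Icc (0 : ℤ) n := by
    intro x hx
    have h0 : 0 ≤ x - x₀ := sub_nonneg.mpr (s.min'_le x hx)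
    have h1 := (hs x hx x₀ hx₀s).2
    rw [abs_of_nonneg h0] at h1
    rw [Finset.mem_Icc]
    refine ⟨Int.ediv_nonneg h0 hD'.le, ?_⟩
    exact Int.ediv_le_of_le_mul hD' (by linarith)
  have hinj : Set.InjOn (fun x => (x - x₀) / |D|) s := by
    intro x hx y hy hxy
    have h1 : |D| ∣ x - x₀ := (abs_dvd _ _).mpr (hs x hx x₀ hx₀s).1
    have h2 : |D| ∣ y - x₀ := (abs_dvd _ _).mpr (hs y hy x₀ hx₀s).1
    have h3 := Int.ediv_mul_cancel h1
    have h4 := Int.ediv_mul_cancel h2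
    simp only at hxy
    rw [hxy] at h3
    linarith
  calc s.card ≤ (Finset.Icc (0 : ℤ) n).card := Finset.card_le_card_of_injOn _ hmap hinj
    _ = n + 1 := by simp

theorem card_le_of_abs_sub_le {s : Finset ℤ} {n : ℕ}
    (hs : ∀ x ∈ s, ∀ y ∈ s, |x - y| ≤ n) : s.card ≤ n + 1 :=
  card_le_of_dvd_sub one_ne_zero fun x hx y hy => ⟨one_dvd _, by simpa using hs x hx y hy⟩

theorem card_linear_form_le {a z : ℤ} (ha : a ≠ 0) {M : ℕ} {s : Finset (ℤ × ℤ)}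
    (hs : ∀ t ∈ s, |t.1| ≤ |a| ∧ |a * t.2 + t.1 * z| ≤ M) :
    s.card ≤ 10 * M + 5 * Int.gcd a z := by
  set g : ℕ := Int.gcd a z with hg
  have hg0 : 0 < g := Int.gcd_pos_of_ne_zero_left _ ha
  have hga : (g : ℤ) ∣ a := Int.gcd_dvd_left ..
  have hgz : (g : ℤ) ∣ z := Int.gcd_dvd_right ..
  have himg : (s.image fun t => a * t.2 + t.1 * z).card ≤ 2 * M / g + 1 := by
    apply card_le_of_dvd_sub (D := g) (by exact_mod_cast hg0.ne')
    simp only [Finset.mem_image]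
    rintro _ ⟨t, ht, rfl⟩ _ ⟨t', ht', rfl⟩
    have hd : (g : ℤ) ∣ a * t.2 + t.1 * z - (a * t'.2 + t'.1 * z) :=
      dvd_sub (dvd_add (hga.mul_right _) (hgz.mul_left _))
        (dvd_add (hga.mul_right _) (hgz.mul_left _))
    refine ⟨hd, ?_⟩
    obtain ⟨e, he⟩ := hd
    have h1 : |a * t.2 + t.1 * z - (a * t'.2 + t'.1 * z)| ≤ 2 * M := by
      have := abs_sub (a * t.2 + t.1 * z) (a * t'.2 + t'.1 * z)
      linarith [(hs t ht).2, (hs t' ht').2]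
    rw [he, abs_mul] at h1 ⊢
    have hgabs : |(g : ℤ)| = g := abs_of_nonneg (by positivity)
    rw [hgabs] at h1 ⊢
    refine mul_le_mul_of_nonneg_left ?_ (by positivity)
    push_cast
    rw [Int.le_ediv_iff_mul_le (by exact_mod_cast hg0)]
    linarith
  have hfib : ∀ m ∈ s.image (fun t => a * t.2 + t.1 * z),
      (s.filter fun t => a * t.2 + t.1 * z = m).card ≤ 5 * g := by
    intro m _
    obtain ⟨a', ha'⟩ := hga
    obtain ⟨z', hz'⟩ := hgz
    have ha_ne : a' ≠ 0 := by rintro rfl; simp at ha'; exact ha ha'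
    have hcop : IsCoprime a' z' := by
      rw [Int.isCoprime_iff_gcd_eq_one]
      have h1 : Int.gcd (g * a') (g * z') = g * Int.gcd a' z' := by
        rw [Int.gcd_mul_left]; simp
      rw [← ha', ← hz', ← hg] at h1
      have : g * Int.gcd a' z' = g * 1 := by omega
      exact Nat.eq_of_mul_eq_mul_left hg0 this
    have hgZ : (g : ℤ) ≠ 0 := by exact_mod_cast hg0.ne'
    have hinj : Set.InjOn Prod.fst ((s.filter fun t => a * t.2 + t.1 * z = m) : Set (ℤ × ℤ)) := by
      intro t ht t' ht' h
      rw [Finset.mem_coe, Finset.mem_filter] at ht ht'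
      have : a * t.2 = a * t'.2 := by
        have := ht.2.trans ht'.2.symm
        rw [h] at this
        linarith
      exact Prod.ext h (mul_left_cancel₀ ha this)
    rw [← Finset.card_image_of_injOn hinj]
    refine (card_le_of_dvd_sub (D := a') (n := 2 * g) ha_ne ?_).trans (by omega)
    simp only [Finset.mem_image, Finset.mem_filter]
    rintro _ ⟨t, ⟨ht, htm⟩, rfl⟩ _ ⟨t', ⟨ht', htm'⟩, rfl⟩
    constructor
    · refine hcop.dvd_of_dvd_mul_right ⟨t'.2 - t.2, ?_⟩
      have h := htm.trans htm'.symm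
      rw [ha', hz'] at h
      have : (g : ℤ) * ((t.1 - t'.1) * z') = g * (a' * (t'.2 - t.2)) := by linarith
      exact mul_left_cancel₀ hgZ this
    · have h1 := abs_sub t.1 t'.1
      have h2 : |a| = g * |a'| := by rw [ha', abs_mul, abs_of_nonneg (by positivity : (0:ℤ) ≤ g)]
      have := (hs t ht).1
      have := (hs t' ht').1
      push_cast
      linarith
  have := Finset.card_le_mul_card_image s (5 * g) hfib
  calc s.card ≤ 5 * g * (2 * M / g + 1) := this.trans (Nat.mul_le_mul_left _ himg)
    _ = 5 * (g * (2 * M / g)) + 5 * g := by ring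
    _ ≤ 5 * (2 * M) + 5 * g :=
        Nat.add_le_add_right (Nat.mul_le_mul_left 5 (Nat.mul_div_le _ _)) _
    _ = _ := by ring

theorem sum_gcd_le (K : ℕ) :
    ((∑ a ∈ (Finset.Icc (-K : ℤ) K).filter (· ≠ 0), ∑ z ∈ Finset.Icc (-K : ℤ) K,
      Int.gcd a z : ℕ) : ℝ) ≤ 9 * K ^ 2 * (1 + Real.log K) := by
  have hmult : ∀ j ∈ Finset.Icc 1 K,
      (((Finset.Icc (-K : ℤ) K).filter ((j : ℤ) ∣ ·)).card : ℝ) ≤ 3 * K / j := by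
    intro j hj
    rw [Finset.mem_Icc] at hj
    have h : ((Finset.Icc (-K : ℤ) K).filter ((j : ℤ) ∣ ·)).card ≤ 2 * (K / j) + 1 := by
      apply card_le_of_dvd_sub (D := j) (by exact_mod_cast (by omega : j ≠ 0))
      simp only [Finset.mem_filter, Finset.mem_Icc]
      rintro x ⟨⟨hx1, hx2⟩, x', rfl⟩ y ⟨⟨hy1, hy2⟩, y', rfl⟩
      refine ⟨⟨x' - y', by ring⟩, ?_⟩
      have hj0 : (0 : ℤ) < j := by exact_mod_cast hj.1
      rw [← mul_sub, abs_mul]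
      refine mul_le_mul_of_nonneg_left ?_ (abs_nonneg _)
      have e1 : x' ≤ K / j := by rw [Int.le_ediv_iff_mul_le hj0]; linarith
      have e2 : y' ≤ K / j := by rw [Int.le_ediv_iff_mul_le hj0]; linarith
      have e3 : -x' ≤ K / j := by rw [Int.le_ediv_iff_mul_le hj0]; linarith
      have e4 : -y' ≤ K / j := by rw [Int.le_ediv_iff_mul_le hj0]; linarith
      push_cast
      rw [abs_le]; constructor <;> linarith
    have hjpos : (0 : ℝ) < j := by exact_mod_cast hj.1
    have h1 : ((K / j : ℕ) : ℝ) ≤ K / j := Nat.cast_div_le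
    have h2 : (1 : ℝ) ≤ K / j := by
      rw [le_div_iff₀ hjpos]; simpa using (by exact_mod_cast hj.2 : (j : ℝ) ≤ K)
    calc (((Finset.Icc (-K : ℤ) K).filter ((j : ℤ) ∣ ·)).card : ℝ)
        ≤ 2 * ((K / j : ℕ) : ℝ) + 1 := by exact_mod_cast h
      _ ≤ 3 * (K / j) := by linarith
      _ = 3 * K / j := by ring
  have hpt : ∀ a ∈ (Finset.Icc (-K : ℤ) K).filter (· ≠ 0), ∀ z ∈ Finset.Icc (-K : ℤ) K,
      Int.gcd a z ≤ ∑ j ∈ Finset.Icc 1 K, if (j : ℤ) ∣ a ∧ (j : ℤ) ∣ z then j else 0 := by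
    intro a ha z _
    simp only [Finset.mem_filter, Finset.mem_Icc] at ha
    have hpos : 0 < Int.gcd a z := Int.gcd_pos_of_ne_zero_left _ ha.2
    have hle : Int.gcd a z ≤ K := by
      have : Int.gcd a z ≤ a.natAbs := Nat.gcd_le_left _ (Int.natAbs_pos.mpr ha.2)
      omega
    have := Finset.single_le_sum (f := fun j : ℕ => if (j : ℤ) ∣ a ∧ (j : ℤ) ∣ z then j else 0)
      (fun _ _ => Nat.zero_le _) (Finset.mem_Icc.mpr ⟨hpos, hle⟩)
    simpa [Int.gcd_dvd_left, Int.gcd_dvd_right] using this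
  have hnat : (∑ a ∈ (Finset.Icc (-K : ℤ) K).filter (· ≠ 0), ∑ z ∈ Finset.Icc (-K : ℤ) K,
      Int.gcd a z) ≤ ∑ j ∈ Finset.Icc 1 K, j *
        (((Finset.Icc (-K : ℤ) K).filter ((j : ℤ) ∣ ·)).card *
          ((Finset.Icc (-K : ℤ) K).filter ((j : ℤ) ∣ ·)).card) := by
    calc _ ≤ ∑ a ∈ (Finset.Icc (-K : ℤ) K).filter (· ≠ 0), ∑ z ∈ Finset.Icc (-K : ℤ) K,
          ∑ j ∈ Finset.Icc 1 K, (if (j : ℤ) ∣ a ∧ (j : ℤ) ∣ z then j else 0) :=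
          Finset.sum_le_sum fun a ha => Finset.sum_le_sum fun z hz => hpt a ha z hz
      _ ≤ ∑ a ∈ Finset.Icc (-K : ℤ) K, ∑ z ∈ Finset.Icc (-K : ℤ) K,
          ∑ j ∈ Finset.Icc 1 K, (if (j : ℤ) ∣ a ∧ (j : ℤ) ∣ z then j else 0) :=
          Finset.sum_le_sum_of_subset (Finset.filter_subset _ _)
      _ = ∑ j ∈ Finset.Icc 1 K, ∑ t ∈ Finset.Icc (-K : ℤ) K ×ˢ Finset.Icc (-K : ℤ) K,
          (if (j : ℤ) ∣ t.1 ∧ (j : ℤ) ∣ t.2 then j else 0) := by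
          rw [Finset.sum_comm, ← Finset.sum_product', Finset.sum_comm]
          refine Finset.sum_congr rfl fun j _ => ?_
          rw [Finset.sum_product_right, Finset.sum_product]
      _ = _ := by
          refine Finset.sum_congr rfl fun j _ => ?_
          rw [← Finset.sum_filter, Finset.sum_const, ← Finset.card_product,
            ← Finset.filter_product, smul_eq_mul, mul_comm]
  calc _ ≤ ((∑ j ∈ Finset.Icc 1 K, j *
        (((Finset.Icc (-K : ℤ) K).filter ((j : ℤ) ∣ ·)).card *
          ((Finset.Icc (-K : ℤ) K).filter ((j : ℤ) ∣ ·)).card) : ℕ) : ℝ) := by exact_mod_cast hnat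
    _ ≤ ∑ j ∈ Finset.Icc 1 K, 9 * (K : ℝ) ^ 2 * ((j : ℝ)⁻¹) := by
        push_cast
        refine Finset.sum_le_sum fun j hj => ?_
        have hjpos : (0 : ℝ) < j := by exact_mod_cast (Finset.mem_Icc.mp hj).1
        have := hmult j hj
        calc (j : ℝ) * (_ * _) ≤ j * ((3 * K / j) * (3 * K / j)) := by gcongr
          _ = _ := by field_simp; ring
    _ = 9 * (K : ℝ) ^ 2 * (harmonic K : ℝ) := by
        rw [← Finset.mul_sum, harmonic_eq_sum_Icc]; push_cast; rfl
    _ ≤ _ := by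
        gcongr
        exact harmonic_le_one_add_log K

theorem card_bilinear_le {K M : ℕ} (hK : 1 ≤ K) {s : Finset ((ℤ × ℤ) × (ℤ × ℤ))}
    (hs : ∀ t ∈ s, |t.1.1| ≤ K ∧ |t.1.2| ≤ K ∧ |t.2.1| ≤ K ∧ |t.2.2| ≤ K ∧
      |t.1.1 * t.2.1 + t.1.2 * t.2.2| ≤ M) :
    (s.card : ℝ) ≤ 300 * K ^ 2 * (M + 1 + Real.log K) := by
  set G : ℕ := ∑ a ∈ (Finset.Icc (-K : ℤ) K).filter (· ≠ 0), ∑ z ∈ Finset.Icc (-K : ℤ) K,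
      Int.gcd a z with hG
  have key : ∀ u : Finset ((ℤ × ℤ) × (ℤ × ℤ)),
      (∀ t ∈ u, |t.1.1| ≤ K ∧ |t.1.2| ≤ K ∧ |t.2.1| ≤ K ∧ |t.2.2| ≤ K ∧
      |t.1.1 * t.2.1 + t.1.2 * t.2.2| ≤ M) → (∀ t ∈ u, t.1.1 ≠ 0 ∧ |t.1.2| ≤ |t.1.1|) →
      u.card ≤ (2 * K + 1) ^ 2 * (10 * M) + 5 * G := by
    intro u hu hu'
    have hmaps : ∀ t ∈ u, (t.1.1, t.2.2) ∈
        (Finset.Icc (-K : ℤ) K).filter (· ≠ 0) ×ˢ Finset.Icc (-K : ℤ) K := by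
      intro t ht
      obtain ⟨h1, -, -, h4, -⟩ := hu t ht
      simp only [Finset.mem_product, Finset.mem_filter, Finset.mem_Icc]
      exact ⟨⟨abs_le.mp h1, (hu' t ht).1⟩, abs_le.mp h4⟩
    rw [Finset.card_eq_sum_card_fiberwise hmaps]
    calc _ ≤ ∑ p ∈ (Finset.Icc (-K : ℤ) K).filter (· ≠ 0) ×ˢ Finset.Icc (-K : ℤ) K,
          (10 * M + 5 * Int.gcd p.1 p.2) := by
          refine Finset.sum_le_sum fun p hp => ?_
          simp only [Finset.mem_product, Finset.mem_filter, Finset.mem_Icc] at hp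
          have hinj : Set.InjOn (fun t : (ℤ × ℤ) × (ℤ × ℤ) => (t.1.2, t.2.1))
              ((u.filter fun t => (t.1.1, t.2.2) = p) : Set ((ℤ × ℤ) × (ℤ × ℤ))) := by
            rintro ⟨⟨a, b⟩, c, e⟩ ht ⟨⟨a', b'⟩, c', e'⟩ ht' h
            rw [Finset.mem_coe, Finset.mem_filter] at ht ht'
            have h' := ht.2.trans ht'.2.symm
            simp only [Prod.mk.injEq] at h h' ⊢
            tauto
          rw [← Finset.card_image_of_injOn hinj]
          apply card_linear_form_le hp.1.2
          simp only [Finset.mem_image, Finset.mem_filter]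
          rintro _ ⟨t, ⟨ht, rfl⟩, rfl⟩
          exact ⟨(hu' t ht).2, (hu t ht).2.2.2.2⟩
      _ = ((Finset.Icc (-K : ℤ) K).filter (· ≠ 0)).card * (Finset.Icc (-K : ℤ) K).card * (10 * M)
          + 5 * G := by
          rw [Finset.sum_add_distrib, Finset.sum_const, Finset.card_product, smul_eq_mul,
            ← Finset.mul_sum, Finset.sum_product]
      _ ≤ _ := by
          have h1 : (Finset.Icc (-K : ℤ) K).card = 2 * K + 1 := by simp; omega
          have h2 := Finset.card_filter_le (Finset.Icc (-K : ℤ) K) (· ≠ 0)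
          rw [h1] at h2 ⊢
          rw [sq]
          gcongr
  set s₁ := s.filter fun t => t.1.1 ≠ 0 ∧ |t.1.2| ≤ |t.1.1|
  set s₂ := s.filter fun t => t.1.2 ≠ 0 ∧ |t.1.1| ≤ |t.1.2|
  set s₃ := s.filter fun t => t.1.1 = 0 ∧ t.1.2 = 0
  have hcover : s ⊆ s₁ ∪ s₂ ∪ s₃ := by
    intro t ht
    simp only [s₁, s₂, s₃, Finset.mem_union, Finset.mem_filter, ht, true_and]
    by_cases h1 : t.1.1 = 0 <;> by_cases h2 : t.1.2 = 0 <;> simp [h1, h2, le_total]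
  have h₁ : s₁.card ≤ (2 * K + 1) ^ 2 * (10 * M) + 5 * G :=
    key s₁ (fun t ht => hs t (Finset.mem_filter.mp ht).1) fun t ht => (Finset.mem_filter.mp ht).2
  have h₂ : s₂.card ≤ (2 * K + 1) ^ 2 * (10 * M) + 5 * G := by
    have hinj : Function.Injective
        (fun t : (ℤ × ℤ) × (ℤ × ℤ) => (t.1.swap, t.2.swap)) := by
      rintro ⟨⟨a, b⟩, c, e⟩ ⟨⟨a', b'⟩, c', e'⟩ h
      simp only [Prod.swap, Prod.mk.injEq] at h ⊢
      tauto
    rw [← Finset.card_image_of_injective s₂ hinj]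
    apply key
    · simp only [Finset.mem_image]
      rintro _ ⟨t, ht, rfl⟩
      obtain ⟨a1, a2, a3, a4, a5⟩ := hs t (Finset.mem_filter.mp ht).1
      refine ⟨a2, a1, a4, a3, ?_⟩
      simpa [add_comm] using a5
    · simp only [Finset.mem_image]
      rintro _ ⟨t, ht, rfl⟩
      exact (Finset.mem_filter.mp ht).2
  have h₃ : s₃.card ≤ (2 * K + 1) ^ 2 := by
    have hinj : Set.InjOn (fun t : (ℤ × ℤ) × (ℤ × ℤ) => t.2) (s₃ : Set ((ℤ × ℤ) × (ℤ × ℤ))) := by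
      rintro ⟨⟨a, b⟩, c⟩ ht ⟨⟨a', b'⟩, c'⟩ ht' h
      simp only [s₃, Finset.mem_coe, Finset.mem_filter] at ht ht' h
      simp_all
    have hmaps : ∀ t ∈ s₃, t.2 ∈ Finset.Icc (-K : ℤ) K ×ˢ Finset.Icc (-K : ℤ) K := by
      intro t ht
      obtain ⟨a1, a2, a3, a4, a5⟩ := hs t (Finset.mem_filter.mp ht).1
      rw [Finset.mem_product, Finset.mem_Icc, Finset.mem_Icc]
      exact ⟨abs_le.mp a3, abs_le.mp a4⟩
    refine (Finset.card_le_card_of_injOn _ hmaps hinj).trans ?_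
    rw [Finset.card_product]
    have h1 : (Finset.Icc (-K : ℤ) K).card = 2 * K + 1 := by simp; omega
    rw [h1, sq]
  have htot : s.card ≤ 2 * ((2 * K + 1) ^ 2 * (10 * M) + 5 * G) + (2 * K + 1) ^ 2 := by
    have := Finset.card_le_card hcover
    have := Finset.card_union_le (s₁ ∪ s₂) s₃
    have := Finset.card_union_le s₁ s₂
    omega
  have hGr : (G : ℝ) ≤ 9 * K ^ 2 * (1 + Real.log K) := sum_gcd_le K
  have hK' : (1 : ℝ) ≤ K := by exact_mod_cast hK
  have hlog : 0 ≤ Real.log K := Real.log_nonneg hK'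
  have hsq : (2 * (K : ℝ) + 1) ^ 2 ≤ 9 * K ^ 2 := by nlinarith
  have hM : (0 : ℝ) ≤ M := by positivity
  calc (s.card : ℝ) ≤ 2 * ((2 * K + 1) ^ 2 * (10 * M) + 5 * G) + (2 * K + 1) ^ 2 := by
        exact_mod_cast htot
    _ ≤ 2 * (9 * K ^ 2 * (10 * M) + 5 * (9 * K ^ 2 * (1 + Real.log K))) + 9 * K ^ 2 := by gcongr
    _ ≤ _ := by nlinarith [mul_nonneg (sq_nonneg (K : ℝ)) hM, mul_nonneg (sq_nonneg (K : ℝ)) hlog, sq_nonneg (K : ℝ)]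

theorem exists_shear {α G : Type*} [AddGroup G] (s : Finset (α × G)) :
    ∃ s' : Finset (α × G), s'.card = s.card ∧
      ∀ t ∈ s', ∃ y y', (t.1, y) ∈ s ∧ (t.1, y') ∈ s ∧ t.2 = y - y' := by
  classical
  have hbase : ∀ a : α, ∃ y₀ : G, ∀ y, (a, y) ∈ s → (a, y₀) ∈ s := by
    intro a
    by_cases h : ∃ y, (a, y) ∈ s
    · exact ⟨h.choose, fun _ _ => h.choose_spec⟩
    · exact ⟨0, fun y hy => absurd ⟨y, hy⟩ h⟩
  choose f hf using hbase
  refine ⟨s.image fun t => (t.1, t.2 - f t.1), Finset.card_image_of_injective _ ?_, ?_⟩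
  · rintro ⟨a, y⟩ ⟨a', y'⟩ h
    simp only [Prod.mk.injEq] at h
    obtain ⟨rfl, h⟩ := h
    simpa using h
  · simp only [Finset.mem_image]
    rintro _ ⟨t, ht, rfl⟩
    exact ⟨t.2, f t.1, ht, hf t.1 t.2 ht, rfl⟩

theorem card_piFinset_box {d : ℕ} (T : Finset (Fin d)) (c : Fin d → ℤ) (K : ℕ) :
    (Fintype.piFinset fun j => if j ∈ T then ({0} : Finset ℤ) else
      Finset.Icc (c j - K) (c j + K)).card = (2 * K + 1) ^ (d - T.card) := by
  rw [Fintype.card_piFinset]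
  have h : ∀ j, (if j ∈ T then ({0} : Finset ℤ) else Finset.Icc (c j - K) (c j + K)).card =
      if j ∈ T then 1 else 2 * K + 1 := by
    intro j
    split_ifs
    · simp
    · rw [Int.card_Icc]; omega
  simp_rw [h]
  rw [Finset.prod_ite, Finset.prod_const_one, one_mul, Finset.prod_const, Finset.filter_notMem_eq_sdiff,
    ← Finset.compl_eq_univ_sdiff, Finset.card_compl, Fintype.card_fin]

theorem card_pairs_le {d : ℕ} {p q i : Fin d} (hpq : p ≠ q) (hpi : p ≠ i) (hqi : q ≠ i)
    {K M n : ℕ} (hK : 1 ≤ K) {R : Fin d → ℤ}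
    (hn : ∀ m : ℤ, |m| ≤ 2 * K → |R i * m| ≤ 2 * M → |m| ≤ n)
    {s : Finset ((Fin d → ℤ) × (Fin d → ℤ))}
    (hX : ∀ t ∈ s, ∀ t' ∈ s, ∀ j, |t.1 j - t'.1 j| ≤ K)
    (hY : ∀ X Y Y', (X, Y) ∈ s → (X, Y') ∈ s → (∀ j, |Y j - Y' j| ≤ K) ∧
      |∑ j, X j * (Y j - Y' j)| ≤ M ∧ |∑ j, R j * (Y j - Y' j)| ≤ M) :
    (s.card : ℝ) ≤ (n + 1) * ((2 * K + 1) ^ (d - 3) * ((2 * K + 1) ^ (d - 2) *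
      (300 * K ^ 2 * (2 * M + 1 + Real.log K)))) := by
  classical
  have hlogK : 0 ≤ Real.log K := Real.log_nonneg (by exact_mod_cast hK)
  rcases s.eq_empty_or_nonempty with rfl | ⟨⟨X₀, Y₀⟩, h₀⟩
  · simp only [Finset.card_empty, Nat.cast_zero]; positivity
  obtain ⟨s₁, hs₁card, hs₁⟩ := exists_shear s
  have h₁ : ∀ t ∈ s₁, (∀ j, |t.1 j - X₀ j| ≤ K) ∧ (∀ j, |t.2 j| ≤ K) ∧
      |∑ j, t.1 j * t.2 j| ≤ M ∧ |∑ j, R j * t.2 j| ≤ M := by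
    rintro ⟨X, V⟩ ht
    obtain ⟨Y, Y', hY1, hY2, hV⟩ := hs₁ _ ht
    simp only at hY1 hY2 hV
    subst hV
    exact ⟨fun j => hX _ hY1 _ h₀ j, hY _ _ _ hY1 hY2⟩
  have h₁' : ∀ t ∈ s₁, ∀ t' ∈ s₁, ∀ j, |t.1 j - t'.1 j| ≤ K := by
    intro t ht t' ht' j
    obtain ⟨Y, _, hY1, _, _⟩ := hs₁ _ ht
    obtain ⟨Y', _, hY2, _, _⟩ := hs₁ _ ht'
    exact hX _ hY1 _ hY2 j
  let z : Finset (Fin d) → (Fin d → ℤ) → Fin d → ℤ := fun T X j => if j ∈ T then 0 else X j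
  let φ : (Fin d → ℤ) × (Fin d → ℤ) → ((Fin d → ℤ) × (Fin d → ℤ)) × (ℤ × ℤ) :=
    fun t => ((t.2, z {p, q} t.1), (t.1 p, t.1 q))
  have hφ : Function.Injective φ := by
    rintro ⟨X, V⟩ ⟨X', V'⟩ h
    simp only [φ, Prod.mk.injEq] at h
    obtain ⟨⟨hV, hz⟩, hp, hq⟩ := h
    refine Prod.ext (funext fun j => ?_) hV
    have := congrFun hz j
    simp only [z, Finset.mem_insert, Finset.mem_singleton] at this
    by_cases h1 : j = p
    · rw [h1]; exact hp
    by_cases h2 : j = q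
    · rw [h2]; exact hq
    simpa [h1, h2] using this
  obtain ⟨s₂, hs₂card, hs₂⟩ := exists_shear (s₁.image φ)
  rw [Finset.card_image_of_injective _ hφ, hs₁card] at hs₂card
  have h₂ : ∀ t ∈ s₂, (∀ j, |t.1.1 j| ≤ K) ∧ |∑ j, R j * t.1.1 j| ≤ M ∧
      t.1.2 ∈ (Fintype.piFinset fun j => if j ∈ ({p, q} : Finset (Fin d)) then ({0} : Finset ℤ)
        else Finset.Icc (X₀ j - K) (X₀ j + K)) ∧
      |t.2.1| ≤ K ∧ |t.2.2| ≤ K ∧ |t.1.1 p * t.2.1 + t.1.1 q * t.2.2| ≤ (2 * M : ℕ) := by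
    rintro ⟨⟨V, Z⟩, w⟩ ht
    obtain ⟨y, y', hy, hy', hw⟩ := hs₂ _ ht
    simp only [Finset.mem_image, φ, Prod.mk.injEq] at hy hy' hw
    obtain ⟨⟨X, V1⟩, hX1, ⟨hV1, hZ1⟩, hy⟩ := hy
    obtain ⟨⟨X', V2⟩, hX2, ⟨hV2, hZ2⟩, hy'⟩ := hy'
    simp only at hV1 hZ1 hy hV2 hZ2 hy'
    subst hV1 hV2 hy hy' hw
    obtain ⟨a1, a2, a3, a4⟩ := h₁ _ hX1
    obtain ⟨b1, b2, b3, b4⟩ := h₁ _ hX2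
    refine ⟨a2, a4, ?_, h₁' _ hX1 _ hX2 p, h₁' _ hX1 _ hX2 q, ?_⟩
    · rw [Fintype.mem_piFinset]
      intro j
      rw [← hZ1]
      simp only [z]
      split_ifs
      · simp
      · have := abs_le.mp (a1 j)
        simp only at this
        rw [Finset.mem_Icc]
        constructor <;> linarith
    · have hsum : ∑ j, (X j - X' j) * V2 j = (X p - X' p) * V2 p + (X q - X' q) * V2 q := by
        refine Fintype.sum_eq_add p q hpq fun j hj => ?_
        have := congrFun (hZ1.trans hZ2.symm) j
        simp only [z, Finset.mem_insert, Finset.mem_singleton, hj.1, hj.2, or_self, if_false] at this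
        rw [this, sub_self, zero_mul]
      have hsub : ∑ j, (X j - X' j) * V2 j = ∑ j, X j * V2 j - ∑ j, X' j * V2 j := by
        rw [← Finset.sum_sub_distrib]
        exact Finset.sum_congr rfl fun j _ => sub_mul _ _ _
      have habs := abs_sub (∑ j, X j * V2 j) (∑ j, X' j * V2 j)
      simp only at a3 b3
      rw [← hsub, hsum] at habs
      simp only [Prod.fst_sub, Prod.snd_sub]
      push_cast
      rw [mul_comm (V2 p), mul_comm (V2 q)]
      linarith
  let ψ₂ : ((Fin d → ℤ) × (Fin d → ℤ)) × (ℤ × ℤ) → (ℤ × ℤ) × (ℤ × ℤ) :=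
    fun t => ((t.1.1 p, t.1.1 q), t.2)
  let ψ : ((Fin d → ℤ) × (Fin d → ℤ)) × (ℤ × ℤ) →
      (Fin d → ℤ) × ((Fin d → ℤ) × ((ℤ × ℤ) × (ℤ × ℤ))) :=
    fun t => (z {p, q, i} t.1.1, t.1.2, ψ₂ t)
  have hfib : ∀ b ∈ s₂.image ψ, (s₂.filter fun t => ψ t = b).card ≤ n + 1 := by
    intro b _
    have hother : ∀ t t', ψ t = ψ t' → ∀ j, j ≠ i → t.1.1 j = t'.1.1 j := by
      intro t t' h j hj
      simp only [ψ, ψ₂, Prod.mk.injEq] at h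
      by_cases h1 : j = p
      · rw [h1]; exact h.2.2.1.1
      by_cases h2 : j = q
      · rw [h2]; exact h.2.2.1.2
      have := congrFun h.1 j
      simpa [z, h1, h2, hj] using this
    have hinj : Set.InjOn (fun t : ((Fin d → ℤ) × (Fin d → ℤ)) × (ℤ × ℤ) => t.1.1 i)
        ((s₂.filter fun t => ψ t = b) : Set (((Fin d → ℤ) × (Fin d → ℤ)) × (ℤ × ℤ))) := by
      intro t ht t' ht' h
      rw [Finset.mem_coe, Finset.mem_filter] at ht ht'
      have hψ := ht.2.trans ht'.2.symm
      have ho := hother t t' hψ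
      simp only [ψ, ψ₂, Prod.mk.injEq] at hψ
      refine Prod.ext (Prod.ext (funext fun j => ?_) hψ.2.1) hψ.2.2.2
      by_cases hj : j = i
      · rw [hj]; exact h
      · exact ho j hj
    rw [← Finset.card_image_of_injOn hinj]
    apply card_le_of_abs_sub_le
    simp only [Finset.mem_image, Finset.mem_filter]
    rintro _ ⟨t, ⟨ht, htb⟩, rfl⟩ _ ⟨t', ⟨ht', htb'⟩, rfl⟩
    have ho := hother t t' (htb.trans htb'.symm)
    obtain ⟨a1, a2, -⟩ := h₂ t ht
    obtain ⟨b1, b2, -⟩ := h₂ t' ht'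
    apply hn
    · have := abs_sub (t.1.1 i) (t'.1.1 i)
      linarith [a1 i, b1 i]
    · have hsum : ∑ j, R j * (t.1.1 j - t'.1.1 j) = R i * (t.1.1 i - t'.1.1 i) := by
        refine Fintype.sum_eq_single i fun j hj => ?_
        rw [ho j hj, sub_self, mul_zero]
      have hsub : ∑ j, R j * (t.1.1 j - t'.1.1 j) =
          ∑ j, R j * t.1.1 j - ∑ j, R j * t'.1.1 j := by
        rw [← Finset.sum_sub_distrib]
        exact Finset.sum_congr rfl fun j _ => mul_sub _ _ _
      have habs := abs_sub (∑ j, R j * t.1.1 j) (∑ j, R j * t'.1.1 j)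
      rw [← hsub, hsum] at habs
      linarith
  have himg : (s₂.image ψ).card ≤
      (2 * K + 1) ^ (d - 3) * ((2 * K + 1) ^ (d - 2) * (s₂.image ψ₂).card) := by
    have hsub : s₂.image ψ ⊆ (Fintype.piFinset fun j => if j ∈ ({p, q, i} : Finset (Fin d)) then
        ({0} : Finset ℤ) else Finset.Icc ((0 : Fin d → ℤ) j - K) ((0 : Fin d → ℤ) j + K)) ×ˢ
        ((Fintype.piFinset fun j => if j ∈ ({p, q} : Finset (Fin d)) then ({0} : Finset ℤ)
        else Finset.Icc (X₀ j - K) (X₀ j + K)) ×ˢ (s₂.image ψ₂)) := by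
      intro b hb
      obtain ⟨t, ht, rfl⟩ := Finset.mem_image.mp hb
      obtain ⟨a1, a2, a3, -⟩ := h₂ t ht
      rw [Finset.mem_product, Finset.mem_product]
      refine ⟨?_, a3, Finset.mem_image_of_mem _ ht⟩
      rw [Fintype.mem_piFinset]
      intro j
      simp only [ψ, z]
      split_ifs
      · simp
      · have := abs_le.mp (a1 j)
        rw [Finset.mem_Icc]
        simpa using this
    have h3 : ({p, q, i} : Finset (Fin d)).card = 3 := Finset.card_eq_three.mpr
      ⟨p, q, i, hpq, hpi, hqi, rfl⟩
    have h2 : ({p, q} : Finset (Fin d)).card = 2 := Finset.card_pair hpq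
    refine (Finset.card_le_card hsub).trans_eq ?_
    rw [Finset.card_product, Finset.card_product, card_piFinset_box, card_piFinset_box, h2, h3]
  have hQ : ((s₂.image ψ₂).card : ℝ) ≤ 300 * K ^ 2 * (2 * M + 1 + Real.log K) := by
    have := card_bilinear_le (M := 2 * M) hK (s := s₂.image ψ₂) (by
      simp only [Finset.mem_image]
      rintro _ ⟨t, ht, rfl⟩
      obtain ⟨a1, a2, a3, a4, a5, a6⟩ := h₂ t ht
      exact ⟨a1 p, a1 q, a4, a5, a6⟩)
    push_cast at this
    exact this
  have hfin : s.card ≤ (n + 1) *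
      ((2 * K + 1) ^ (d - 3) * ((2 * K + 1) ^ (d - 2) * (s₂.image ψ₂).card)) := by
    rw [← hs₂card]
    exact (Finset.card_le_mul_card_image s₂ _ hfib).trans (Nat.mul_le_mul_left _ himg)
  calc (s.card : ℝ) ≤ (n + 1) *
      ((2 * K + 1) ^ (d - 3) * ((2 * K + 1) ^ (d - 2) * (s₂.image ψ₂).card)) := by
        exact_mod_cast hfin
    _ ≤ _ := by gcongr

theorem floor_mul_of_mem_ZLat {d : ℕ} {L : ℝ} (hL : 0 < L) {x : EuclideanSpace ℝ (Fin d)}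
    (hx : x ∈ ZLat d L) (j : Fin d) : ((⌊L * x j⌋ : ℤ) : ℝ) = L * x j := by
  obtain ⟨m, hm⟩ := hx j
  have : L * x j = m := by rw [hm]; field_simp
  rw [this, Int.floor_intCast]

theorem euclidean_inner_eq_sum {d : ℕ} (x y : EuclideanSpace ℝ (Fin d)) :
    ⟪x, y⟫ = ∑ j, x j * y j := by
  simp only [PiLp.inner_apply, RCLike.inner_apply, conj_trivial]
  exact Finset.sum_congr rfl fun j _ => mul_comm _ _

theorem euclidean_norm_le_of_abs_le {d : ℕ} (x : EuclideanSpace ℝ (Fin d)) {B : ℝ} (hB : 0 ≤ B)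
    (hx : ∀ j, |x j| ≤ B) : ‖x‖ ≤ d * B := by
  refine abs_le_of_sq_le_sq' ?_ (by positivity) |>.2
  rw [EuclideanSpace.norm_sq_eq]
  calc ∑ j, ‖x j‖ ^ 2 ≤ ∑ _j : Fin d, B ^ 2 := by
        refine Finset.sum_le_sum fun j _ => ?_
        exact pow_le_pow_left₀ (norm_nonneg _) (hx j) 2
    _ = d * B ^ 2 := by simp
    _ ≤ (d * B) ^ 2 := by
        rw [mul_pow]
        gcongr
        rcases Nat.eq_zero_or_pos d with rfl | h
        · simp
        · exact le_self_pow₀ (by exact_mod_cast h) two_ne_zero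

theorem ncard_le_of_direction_card {d : ℕ} {p q i : Fin d} (hpq : p ≠ q) (hpi : p ≠ i)
    (hqi : q ≠ i) {L W : ℝ} (hL : 1 ≤ L) {K M n : ℕ} (hK : K = ⌊2 * L⌋₊)
    (hM : M = ⌊2 * (W * L ^ 2)⌋₊)
    {α : Type*} {S : Set α} {u v : α → EuclideanSpace ℝ (Fin d)}
    {u₀ v₀ r : EuclideanSpace ℝ (Fin d)} {c : ℝ} (hr : r ∈ ZLat d L)
    (hu : ∀ t ∈ S, u t ∈ ZLat d L) (hv : ∀ t ∈ S, v t ∈ ZLat d L)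
    (hu₀ : ∀ t ∈ S, ‖u t - u₀‖ ≤ 1) (hv₀ : ∀ t ∈ S, ‖v t - v₀‖ ≤ 1)
    (huv : ∀ t ∈ S, |⟪u t, v t⟫ - c| ≤ W)
    (hrv : ∀ t ∈ S, ∀ t' ∈ S, u t = u t' → |⟪r, v t⟫ - ⟪r, v t'⟫| ≤ 2 * W)
    (hinj : ∀ t ∈ S, ∀ t' ∈ S, u t = u t' → v t = v t' → t = t')
    (hn : ∀ m : ℤ, |m| ≤ 2 * K → |⌊L * r i⌋ * m| ≤ 2 * M → |m| ≤ n) :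
    (S.ncard : ℝ) ≤ (n + 1) * ((2 * K + 1) ^ (d - 3) * ((2 * K + 1) ^ (d - 2) *
      (300 * K ^ 2 * (2 * M + 1 + Real.log K)))) := by
  classical
  have hL0 : 0 < L := by linarith
  have hK1 : 1 ≤ K := by rw [hK]; exact Nat.le_floor (by push_cast; linarith)
  have hlogK : 0 ≤ Real.log K := Real.log_nonneg (by exact_mod_cast hK1)
  rcases S.finite_or_infinite with hfin | hinf
  swap
  · rw [hinf.ncard]; push_cast; positivity
  let Φ : α → (Fin d → ℤ) × (Fin d → ℤ) := fun t => (fun j => ⌊L * u t j⌋, fun j => ⌊L * v t j⌋)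
  have hU : ∀ t ∈ S, ∀ j, (((Φ t).1 j : ℤ) : ℝ) = L * u t j :=
    fun t ht j => floor_mul_of_mem_ZLat hL0 (hu t ht) j
  have hV : ∀ t ∈ S, ∀ j, (((Φ t).2 j : ℤ) : ℝ) = L * v t j :=
    fun t ht j => floor_mul_of_mem_ZLat hL0 (hv t ht) j
  have hΦ : Set.InjOn Φ S := by
    intro t ht t' ht' h
    refine hinj t ht t' ht' ?_ ?_
    · ext j
      have := hU t ht j
      rw [h, hU t' ht' j] at this
      exact (mul_left_cancel₀ hL0.ne' this).symm
    · ext j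
      have := hV t ht j
      rw [h, hV t' ht' j] at this
      exact (mul_left_cancel₀ hL0.ne' this).symm
  have hdiff : ∀ (f : α → EuclideanSpace ℝ (Fin d)) (f₀ : EuclideanSpace ℝ (Fin d)),
      (∀ t ∈ S, ‖f t - f₀‖ ≤ 1) → ∀ t ∈ S, ∀ t' ∈ S, ∀ j, |L * f t j - L * f t' j| ≤ 2 * L := by
    intro f f₀ hf t ht t' ht' j
    have h1 := PiLp.norm_apply_le (f t - f₀) j
    have h2 := PiLp.norm_apply_le (f t' - f₀) j
    simp only [PiLp.sub_apply, Real.norm_eq_abs] at h1 h2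
    have h3 := abs_le.mp (h1.trans (hf t ht))
    have h4 := abs_le.mp (h2.trans (hf t' ht'))
    rw [← mul_sub, abs_mul, abs_of_pos hL0, mul_comm 2]
    refine mul_le_mul_of_nonneg_left ?_ hL0.le
    rw [abs_le]; constructor <;> linarith
  have hbox_int : ∀ (a : ℤ) (B : ℝ), |(a : ℝ)| ≤ B → |a| ≤ (⌊B⌋₊ : ℤ) := by
    intro a B h
    rw [Int.abs_eq_natAbs]
    have : a.natAbs ≤ ⌊B⌋₊ := Nat.le_floor (by rw [Nat.cast_natAbs, Int.cast_abs]; exact h)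
    exact_mod_cast this
  have hform : ∀ (x : EuclideanSpace ℝ (Fin d)) t t', t ∈ S → t' ∈ S → x ∈ ZLat d L →
      |⟪x, v t⟫ - ⟪x, v t'⟫| ≤ 2 * W →
      |∑ j, ⌊L * x j⌋ * ((Φ t).2 j - (Φ t').2 j)| ≤ M := by
    intro x t t' ht ht' hx h
    rw [hM]
    apply hbox_int
    push_cast
    have : ∑ j, ((⌊L * x j⌋ : ℤ) : ℝ) * (((Φ t).2 j : ℤ) - ((Φ t').2 j : ℤ) : ℝ) =
        L ^ 2 * (⟪x, v t⟫ - ⟪x, v t'⟫) := by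
      rw [euclidean_inner_eq_sum, euclidean_inner_eq_sum, ← Finset.sum_sub_distrib,
        Finset.mul_sum]
      refine Finset.sum_congr rfl fun j _ => ?_
      rw [hV t ht, hV t' ht', floor_mul_of_mem_ZLat hL0 hx]
      ring
    rw [this, abs_mul, abs_of_nonneg (sq_nonneg L)]
    nlinarith [sq_nonneg L]
  have hcard : S.ncard = (hfin.toFinset.image Φ).card := by
    rw [Set.ncard_eq_toFinset_card S hfin, Finset.card_image_of_injOn]
    simpa using hΦ
  rw [hcard]
  apply card_pairs_le hpq hpi hqi hK1 (R := fun j => ⌊L * r j⌋) hn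
  · simp only [Finset.mem_image, Set.Finite.mem_toFinset]
    rintro _ ⟨t, ht, rfl⟩ _ ⟨t', ht', rfl⟩ j
    rw [hK]
    apply hbox_int
    push_cast
    rw [hU t ht, hU t' ht']
    exact hdiff u u₀ hu₀ t ht t' ht' j
  · simp only [Finset.mem_image, Set.Finite.mem_toFinset]
    rintro X Y Y' ⟨t, ht, htX⟩ ⟨t', ht', htX'⟩
    obtain ⟨h1, rfl⟩ := Prod.mk.injEq .. ▸ (show ((Φ t).1, (Φ t).2) = (X, Y) from htX)
    obtain ⟨h2, rfl⟩ := Prod.mk.injEq .. ▸ (show ((Φ t').1, (Φ t').2) = (X, Y') from htX')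
    have huu : u t = u t' := by
      ext j
      have := hU t ht j
      rw [h1, ← h2, hU t' ht' j] at this
      exact (mul_left_cancel₀ hL0.ne' this).symm
    refine ⟨fun j => ?_, ?_, ?_⟩
    · rw [hK]
      apply hbox_int
      push_cast
      rw [hV t ht, hV t' ht']
      exact hdiff v v₀ hv₀ t ht t' ht' j
    · rw [← h1]
      refine hform (u t) t t' ht ht' (hu t ht) ?_
      have e1 := abs_le.mp (huv t ht)
      have e2 := abs_le.mp (huu ▸ huv t' ht')
      rw [abs_le]
      constructor <;> linarith
    · exact hform r t t' ht ht' hr (hrv t ht t' ht' huu)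

theorem exists_ncard_bound (d : ℕ) (hd : 3 ≤ d) (γ : ℝ) (hγ' : γ < 1) :
    ∃ C₀ : ℝ, 0 < C₀ ∧ ∀ L δ : ℝ, 2 ≤ L → 0 < δ → δ < 1 →
    ∀ {α : Type} {S : Set α} {u v : α → EuclideanSpace ℝ (Fin d)}
    {u₀ v₀ r : EuclideanSpace ℝ (Fin d)} {c : ℝ}, r ∈ ZLat d L →
    (∀ t ∈ S, u t ∈ ZLat d L) → (∀ t ∈ S, v t ∈ ZLat d L) →
    (∀ t ∈ S, ‖u t - u₀‖ ≤ 1) → (∀ t ∈ S, ‖v t - v₀‖ ≤ 1) →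
    (∀ t ∈ S, |⟪u t, v t⟫ - c| ≤ δ⁻¹ * L ^ (-(2 * γ))) →
    (∀ t ∈ S, ∀ t' ∈ S, u t = u t' → |⟪r, v t⟫ - ⟪r, v t'⟫| ≤ 2 * (δ⁻¹ * L ^ (-(2 * γ)))) →
    (∀ t ∈ S, ∀ t' ∈ S, u t = u t' → v t = v t' → t = t') →
    (S.ncard : ℝ) ≤ C₀ * L ^ (2 * d - 3) * (δ⁻¹ * L ^ (2 - 2 * γ)) * L ∧
    ∀ P : ℝ, 0 < P → P ≤ ‖r‖ → (S.ncard : ℝ) ≤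
      C₀ * L ^ (2 * d - 3) * (δ⁻¹ * L ^ (2 - 2 * γ)) *
        (1 + δ⁻¹ * L ^ (2 - 2 * γ) / (L * P)) := by
  set ε : ℝ := 2 - 2 * γ with hε
  have hε0 : 0 < ε := by rw [hε]; linarith
  set B : ℝ := 5 ^ (d - 3) * (5 ^ (d - 2) * (1200 * (6 + 1 / ε))) with hB
  have hB0 : 0 < B := by positivity
  have hd0 : (3 : ℝ) ≤ d := by exact_mod_cast hd
  refine ⟨5 * d * B, by positivity, ?_⟩
  intro L δ hL hδ hδ1 α S u v u₀ v₀ r c hr hu hv hu₀ hv₀ huv hrv hinj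
  have hL0 : 0 < L := by linarith
  set Q : ℝ := δ⁻¹ * L ^ ε with hQ
  have hLε : 1 ≤ L ^ ε := Real.one_le_rpow (by linarith) hε0.le
  have hδinv : 1 ≤ δ⁻¹ := (one_le_inv₀ hδ).mpr hδ1.le
  have hLQ : L ^ ε ≤ Q := le_mul_of_one_le_left (by positivity) hδinv
  have hQ1 : 1 ≤ Q := hLε.trans hLQ
  have hWQ : δ⁻¹ * L ^ (-(2 * γ)) * L ^ 2 = Q := by
    rw [hQ, mul_assoc, ← Real.rpow_natCast L 2, ← Real.rpow_add hL0, hε]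
    congr 2; push_cast; ring
  set K : ℕ := ⌊2 * L⌋₊ with hK
  set M : ℕ := ⌊2 * (δ⁻¹ * L ^ (-(2 * γ)) * L ^ 2)⌋₊ with hM
  have hK1 : 1 ≤ K := Nat.le_floor (by push_cast; linarith)
  have hKL : (K : ℝ) ≤ 2 * L := Nat.floor_le (by linarith)
  have hMQ : (M : ℝ) ≤ 2 * Q := by rw [hM, hWQ]; exact Nat.floor_le (by linarith)
  have hlog : Real.log K ≤ 1 + Q / ε := by
    calc Real.log K ≤ Real.log (2 * L) :=
          Real.log_le_log (by exact_mod_cast hK1) hKL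
      _ = Real.log 2 + Real.log L := Real.log_mul two_ne_zero hL0.ne'
      _ ≤ 1 + L ^ ε / ε := by
          gcongr
          · linarith [Real.log_two_lt_d9]
          · exact Real.log_le_rpow_div hL0.le hε0
      _ ≤ 1 + Q / ε := by gcongr
  have hlogK : 0 ≤ Real.log K := Real.log_nonneg (by exact_mod_cast hK1)
  have hrest : (2 * (K : ℝ) + 1) ^ (d - 3) * ((2 * K + 1) ^ (d - 2) *
      (300 * K ^ 2 * (2 * M + 1 + Real.log K))) ≤ B * (L ^ (2 * d - 3) * Q) := by
    have h5 : 2 * (K : ℝ) + 1 ≤ 5 * L := by linarith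
    have h6 : 2 * (M : ℝ) + 1 + Real.log K ≤ (6 + 1 / ε) * Q := by
      have : (6 + 1 / ε) * Q = 6 * Q + Q / ε := by ring
      linarith
    calc _ ≤ (5 * L) ^ (d - 3) * ((5 * L) ^ (d - 2) *
          (300 * (2 * L) ^ 2 * ((6 + 1 / ε) * Q))) := by gcongr
      _ = B * ((L ^ (d - 3) * L ^ (d - 2) * L ^ 2) * Q) := by
          rw [hB, mul_pow, mul_pow]; ring
      _ = _ := by
          rw [← pow_add, ← pow_add]
          congr 4; omega
  obtain ⟨i, hi⟩ : ∃ i : Fin d, ∀ j, |r j| ≤ |r i| := by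
    have : Nonempty (Fin d) := ⟨⟨0, by omega⟩⟩
    exact Finite.exists_max fun j => |r j|
  obtain ⟨p, hp, q, hq, hpq⟩ : ∃ p ∈ Finset.univ.erase i, ∃ q ∈ Finset.univ.erase i, p ≠ q := by
    rw [← Finset.one_lt_card, Finset.card_erase_of_mem (Finset.mem_univ _), Finset.card_univ,
      Fintype.card_fin]
    omega
  have hpi := Finset.ne_of_mem_erase hp
  have hqi := Finset.ne_of_mem_erase hq
  have main : ∀ n : ℕ, (∀ m : ℤ, |m| ≤ 2 * K → |⌊L * r i⌋ * m| ≤ 2 * M → |m| ≤ n) →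
      (S.ncard : ℝ) ≤ (n + 1) * (B * (L ^ (2 * d - 3) * Q)) := fun n hn =>
    (ncard_le_of_direction_card hpq hpi hqi (by linarith) hK hM hr hu hv hu₀ hv₀ huv hrv hinj
      hn).trans (mul_le_mul_of_nonneg_left hrest (by positivity))
  constructor
  · calc (S.ncard : ℝ) ≤ ((2 * K : ℕ) + 1) * (B * (L ^ (2 * d - 3) * Q)) :=
          main (2 * K) fun m hm _ => by push_cast; exact hm
      _ ≤ (5 * d * L) * (B * (L ^ (2 * d - 3) * Q)) := by
          gcongr
          push_cast
          nlinarith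
      _ = _ := by ring
  · intro P hP hPr
    have hnorm : P ≤ d * |r i| := hPr.trans (euclidean_norm_le_of_abs_le r (abs_nonneg _) hi)
    calc (S.ncard : ℝ) ≤ ((⌊4 * d * Q / (L * P)⌋₊ : ℕ) + 1) * (B * (L ^ (2 * d - 3) * Q)) := by
          apply main
          intro m _ hm
          have hm' : |L * r i * m| ≤ 4 * Q := by
            have h : ((|⌊L * r i⌋ * m| : ℤ) : ℝ) ≤ ((2 * M : ℤ) : ℝ) := by exact_mod_cast hm
            push_cast at h
            rw [floor_mul_of_mem_ZLat hL0 hr] at h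
            linarith
          rw [Int.abs_eq_natAbs]
          have : m.natAbs ≤ ⌊4 * d * Q / (L * P)⌋₊ := by
            apply Nat.le_floor
            rw [Nat.cast_natAbs, Int.cast_abs, le_div_iff₀ (by positivity)]
            rw [abs_mul, abs_mul, abs_of_pos hL0] at hm'
            calc |(m : ℝ)| * (L * P) ≤ |(m : ℝ)| * (L * (d * |r i|)) := by gcongr
              _ = d * (L * |r i| * |(m : ℝ)|) := by ring
              _ ≤ d * (4 * Q) := by gcongr
              _ = _ := by ring
          exact_mod_cast this
      _ ≤ (5 * d * (1 + Q / (L * P))) * (B * (L ^ (2 * d - 3) * Q)) := by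
          gcongr
          have h1 : ((⌊4 * d * Q / (L * P)⌋₊ : ℕ) : ℝ) ≤ 4 * d * Q / (L * P) :=
            Nat.floor_le (by positivity)
          have h2 : 0 ≤ Q / (L * P) := by positivity
          have h3 : 4 * d * Q / (L * P) = 4 * (d * (Q / (L * P))) := by ring
          have h4 : 0 ≤ d * (Q / (L * P)) := by positivity
          have h5 : 5 * d * (1 + Q / (L * P)) = 5 * d + 5 * (d * (Q / (L * P))) := by ring
          linarith
      _ = _ := by ring

theorem ZLat_sub_mem {d : ℕ} {L : ℝ} {x y : EuclideanSpace ℝ (Fin d)} (hx : x ∈ ZLat d L)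
    (hy : y ∈ ZLat d L) : x - y ∈ ZLat d L := by
  intro j
  obtain ⟨m, hm⟩ := hx j
  obtain ⟨n, hn⟩ := hy j
  exact ⟨m - n, by rw [PiLp.sub_apply, hm, hn]; push_cast; ring⟩

theorem ZLat_neg_mem {d : ℕ} {L : ℝ} {x : EuclideanSpace ℝ (Fin d)} (hx : x ∈ ZLat d L) :
    -x ∈ ZLat d L := by
  intro j
  obtain ⟨m, hm⟩ := hx j
  exact ⟨-m, by rw [PiLp.neg_apply, hm]; push_cast; ring⟩

theorem ZLat_add_mem {d : ℕ} {L : ℝ} {x y : EuclideanSpace ℝ (Fin d)} (hx : x ∈ ZLat d L)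
    (hy : y ∈ ZLat d L) : x + y ∈ ZLat d L := by
  simpa using ZLat_sub_mem hx (ZLat_neg_mem hy)

theorem ZLat_sign_smul_mem {d : ℕ} {L s : ℝ} {x : EuclideanSpace ℝ (Fin d)}
    (hs : s = 1 ∨ s = -1) (hx : x ∈ ZLat d L) : s • x ∈ ZLat d L := by
  rcases hs with rfl | rfl
  · simpa using hx
  · simpa using ZLat_neg_mem hx

theorem abs_inner_sub_le_of_resonance {E : Type*} [NormedAddCommGroup E] [InnerProductSpace ℝ E]
    {a b o k : E} {s β W : ℝ} (hs : s = 1 ∨ s = -1) (hk : s • a + s • b - s • o = k)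
    (hβ : |s * ‖a‖ ^ 2 + s * ‖b‖ ^ 2 - s * ‖o‖ ^ 2 - β| ≤ W) :
    |⟪a - s • k, b - s • k⟫ - (‖k‖ ^ 2 - s * β) / 2| ≤ W := by
  have hss : s * s = 1 := by rcases hs with rfl | rfl <;> norm_num
  have hk' : s • k = a + b - o := by
    rw [← hk, smul_sub, smul_add, smul_smul, smul_smul, smul_smul, hss, one_smul, one_smul,
      one_smul]
  have hn : ‖k‖ ^ 2 = ‖a + b - o‖ ^ 2 := by
    rw [← hk']
    rcases hs with rfl | rfl <;> simp
  have e1 : a - s • k = o - b := by rw [hk']; abel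
  have e2 : b - s • k = o - a := by rw [hk']; abel
  have key : ⟪a - s • k, b - s • k⟫ - (‖k‖ ^ 2 - s * β) / 2 =
      -(s / 2) * (s * ‖a‖ ^ 2 + s * ‖b‖ ^ 2 - s * ‖o‖ ^ 2 - β) := by
    rw [e1, e2, hn]
    have h : -(s / 2) * (s * ‖a‖ ^ 2 + s * ‖b‖ ^ 2 - s * ‖o‖ ^ 2 - β) =
        -(s * s / 2) * (‖a‖ ^ 2 + ‖b‖ ^ 2 - ‖o‖ ^ 2) + s * β / 2 := by ring
    rw [h, hss]
    simp only [← real_inner_self_eq_norm_sq, inner_sub_left, inner_sub_right, inner_add_left,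
      inner_add_right]
    rw [real_inner_comm a o, real_inner_comm b o, real_inner_comm a b]
    ring
  have habs : |-(s / 2)| = 1 / 2 := by rcases hs with rfl | rfl <;> norm_num
  rw [key, abs_mul, habs]
  have := abs_nonneg (s * ‖a‖ ^ 2 + s * ‖b‖ ^ 2 - s * ‖o‖ ^ 2 - β)
  linarith

/-- Quadruples satisfying the first-order and quadratic constraints, with all three signs
left free and the second pair of constraints expressed through the vector `k₃ - k₄ = r`. -/
def signedQuadruples (d : ℕ) (L W e₁ e₂ e₃ β β' : ℝ)
    (k r k10 k20 k30 : EuclideanSpace ℝ (Fin d)) :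
    Set (EuclideanSpace ℝ (Fin d) × EuclideanSpace ℝ (Fin d) ×
      EuclideanSpace ℝ (Fin d) × EuclideanSpace ℝ (Fin d)) :=
  {q | q.1 ∈ ZLat d L ∧ q.2.1 ∈ ZLat d L ∧ q.2.2.1 ∈ ZLat d L ∧
    ‖q.1 - k10‖ ≤ 1 ∧ ‖q.2.1 - k20‖ ≤ 1 ∧ ‖q.2.2.1 - k30‖ ≤ 1 ∧
    e₁ • q.1 + e₂ • q.2.1 + e₃ • q.2.2.1 = k ∧
    |e₁ * ‖q.1‖ ^ 2 + e₂ * ‖q.2.1‖ ^ 2 + e₃ * ‖q.2.2.1‖ ^ 2 - β| ≤ W ∧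
    q.2.2.1 - q.2.2.2 = r ∧
    |‖q.2.2.1‖ ^ 2 - ‖q.2.2.2‖ ^ 2 - β'| ≤ 2 * W}

theorem abs_inner_sub_inner_le {E : Type*} [NormedAddCommGroup E] [InnerProductSpace ℝ E]
    {x y x' y' r : E} {β W : ℝ} (h : x - y = r) (h' : x' - y' = r)
    (hβ : |‖x‖ ^ 2 - ‖y‖ ^ 2 - β| ≤ 2 * W) (hβ' : |‖x'‖ ^ 2 - ‖y'‖ ^ 2 - β| ≤ 2 * W) :
    |⟪r, x⟫ - ⟪r, x'⟫| ≤ 2 * W := by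
  have key : ∀ z w : E, z - w = r → ‖z‖ ^ 2 - ‖w‖ ^ 2 = 2 * ⟪r, z⟫ - ‖r‖ ^ 2 := by
    intro z w hzw
    have : w = z - r := by rw [← hzw]; abel
    rw [this, norm_sub_sq_real, real_inner_comm]
    ring
  rw [key _ _ h] at hβ
  rw [key _ _ h'] at hβ'
  rw [abs_le] at *
  constructor <;> linarith

theorem exists_signedQuadruples_bound (d : ℕ) (hd : 3 ≤ d) (γ : ℝ) (hγ' : γ < 1) :
    ∃ C₀ : ℝ, 0 < C₀ ∧ ∀ L δ : ℝ, 2 ≤ L → 0 < δ → δ < 1 →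
    ∀ {e₁ e₂ e₃ β β' : ℝ} {k r k10 k20 k30 : EuclideanSpace ℝ (Fin d)},
    (e₁ = 1 ∨ e₁ = -1) → (e₂ = 1 ∨ e₂ = -1) → (e₃ = 1 ∨ e₃ = -1) → ¬(e₁ = e₂ ∧ e₂ = e₃) →
    k ∈ ZLat d L → r ∈ ZLat d L →
    ∀ T ⊆ signedQuadruples d L (δ⁻¹ * L ^ (-(2 * γ))) e₁ e₂ e₃ β β' k r k10 k20 k30,
    (T.ncard : ℝ) ≤ C₀ * L ^ (2 * d - 3) * (δ⁻¹ * L ^ (2 - 2 * γ)) * L ∧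
    ∀ P : ℝ, 0 < P → P ≤ ‖r‖ → (T.ncard : ℝ) ≤
      C₀ * L ^ (2 * d - 3) * (δ⁻¹ * L ^ (2 - 2 * γ)) *
        (1 + δ⁻¹ * L ^ (2 - 2 * γ) / (L * P)) := by
  obtain ⟨C₀, hC₀, hbound⟩ := exists_ncard_bound d hd γ hγ'
  refine ⟨C₀, hC₀, ?_⟩
  intro L δ hL hδ hδ1 e₁ e₂ e₃ β β' k r k10 k20 k30 he₁ he₂ he₃ hne hk hr T hTS
  set W := δ⁻¹ * L ^ (-(2 * γ)) with hW
  set S := signedQuadruples d L W e₁ e₂ e₃ β β' k r k10 k20 k30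
  have hsplit : (e₁ = -e₃ ∧ e₂ = -e₃) ∨ (e₁ = e₃ ∧ e₂ = -e₃) ∨ (e₁ = -e₃ ∧ e₂ = e₃) := by
    rcases he₁ with rfl | rfl <;> rcases he₂ with rfl | rfl <;> rcases he₃ with rfl | rfl <;>
      first | exact absurd ⟨rfl, rfl⟩ hne | norm_num
  have hns : -e₃ = 1 ∨ -e₃ = -1 := by rcases he₃ with rfl | rfl <;> norm_num
  have he₃0 : e₃ ≠ 0 := by rcases he₃ with rfl | rfl <;> norm_num
  have hinner : ∀ {q q'}, q ∈ S → q' ∈ S → |⟪r, q.2.2.1⟫ - ⟪r, q'.2.2.1⟫| ≤ 2 * W :=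
    fun h h' => abs_inner_sub_inner_le h.2.2.2.2.2.2.2.2.1 h'.2.2.2.2.2.2.2.2.1
      h.2.2.2.2.2.2.2.2.2 h'.2.2.2.2.2.2.2.2.2
  have hlast : ∀ {q q'}, q ∈ S → q' ∈ S → q.1 = q'.1 → q.2.1 = q'.2.1 → q.2.2.1 = q'.2.2.1 →
      q = q' := by
    intro q q' h h' h1 h2 h3
    refine Prod.ext h1 (Prod.ext h2 (Prod.ext h3 ?_))
    have := h.2.2.2.2.2.2.2.2.1.trans h'.2.2.2.2.2.2.2.2.1.symm
    rw [h3] at this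
    exact sub_right_injective this
  have hlin : ∀ {q q'}, q ∈ S → q' ∈ S → e₁ • (q.1 - q'.1) + e₂ • (q.2.1 - q'.2.1) +
      e₃ • (q.2.2.1 - q'.2.2.1) = 0 := by
    intro q q' h h'
    have := sub_eq_zero.mpr (h.2.2.2.2.2.2.1.trans h'.2.2.2.2.2.2.1.symm)
    rw [← this]
    simp only [smul_sub]
    abel
  rcases hsplit with ⟨h1, h2⟩ | ⟨h1, h2⟩ | ⟨h1, h2⟩
  · have h3 : ∀ {q q'}, q ∈ S → q' ∈ S → q.1 = q'.1 → q.2.2.1 - q'.2.2.1 = q.2.1 - q'.2.1 := by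
      intro q q' h h' hq
      have := hlin h h'
      rw [hq, sub_self, smul_zero, zero_add, h2, neg_smul, neg_add_eq_zero] at this
      exact (smul_right_injective _ he₃0 this).symm
    refine hbound L δ hL hδ hδ1 (u := fun q => q.1 - (-e₃) • k) (v := fun q => q.2.1 - (-e₃) • k)
      (u₀ := k10 - (-e₃) • k) (v₀ := k20 - (-e₃) • k) (c := (‖k‖ ^ 2 - (-e₃) * β) / 2) hr
      (fun q m => have h := hTS m; ZLat_sub_mem h.1 (ZLat_sign_smul_mem hns hk))
      (fun q m => have h := hTS m; ZLat_sub_mem h.2.1 (ZLat_sign_smul_mem hns hk))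
      (fun q m => have h := hTS m; by simpa using h.2.2.2.1) (fun q m => have h := hTS m; by simpa using h.2.2.2.2.1)
      (fun q m => have h := hTS m; abs_inner_sub_le_of_resonance (o := q.2.2.1) hns ?_ ?_)
      (fun q m q' m' hq => have h := hTS m; have h' := hTS m'; ?_) (fun q m q' m' hq hq' => have h := hTS m; have h' := hTS m'; ?_)
    · rw [← h.2.2.2.2.2.2.1, h1, h2]; simp only [neg_smul]; abel
    · have := h.2.2.2.2.2.2.2.1
      rw [h1, h2] at this
      convert this using 2; ring
    · have := hinner h h'
      rw [← inner_sub_right, h3 h h' (sub_left_injective hq)] at this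
      rw [← inner_sub_right]
      simpa using this
    · have e1 := sub_left_injective hq
      have e2 := sub_left_injective hq'
      refine hlast h h' e1 e2 ?_
      have := h3 h h' e1
      rw [e2, sub_self] at this
      exact sub_eq_zero.mp this
  · have h3 : ∀ {q q'}, q ∈ S → q' ∈ S → q.1 = q'.1 → q.2.2.1 = q'.2.2.1 → q.2.1 = q'.2.1 := by
      intro q q' h h' hq hq'
      have := hlin h h'
      rw [hq, hq', sub_self, sub_self, smul_zero, smul_zero, zero_add, add_zero, h2] at this
      exact sub_eq_zero.mp ((smul_eq_zero.mp this).resolve_left (neg_ne_zero.mpr he₃0))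
    refine hbound L δ hL hδ hδ1 (u := fun q => q.1 - e₃ • k) (v := fun q => q.2.2.1 - e₃ • k)
      (u₀ := k10 - e₃ • k) (v₀ := k30 - e₃ • k) (c := (‖k‖ ^ 2 - e₃ * β) / 2) hr
      (fun q m => have h := hTS m; ZLat_sub_mem h.1 (ZLat_sign_smul_mem he₃ hk))
      (fun q m => have h := hTS m; ZLat_sub_mem h.2.2.1 (ZLat_sign_smul_mem he₃ hk))
      (fun q m => have h := hTS m; by simpa using h.2.2.2.1) (fun q m => have h := hTS m; by simpa using h.2.2.2.2.2.1)
      (fun q m => have h := hTS m; abs_inner_sub_le_of_resonance (o := q.2.1) he₃ ?_ ?_)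
      (fun q m q' m' hq => have h := hTS m; have h' := hTS m'; ?_) (fun q m q' m' hq hq' => have h := hTS m; have h' := hTS m'; ?_)
    · rw [← h.2.2.2.2.2.2.1, h1, h2]; simp only [neg_smul]; abel
    · have := h.2.2.2.2.2.2.2.1
      rw [h1, h2] at this
      convert this using 2; ring
    · have := hinner h h'
      rw [← inner_sub_right] at this ⊢
      simpa using this
    · have e1 := sub_left_injective hq
      have e2 := sub_left_injective hq'
      exact hlast h h' e1 (h3 h h' e1 e2) e2
  · have h3 : ∀ {q q'}, q ∈ S → q' ∈ S → q.2.1 = q'.2.1 → q.2.2.1 = q'.2.2.1 → q.1 = q'.1 := by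
      intro q q' h h' hq hq'
      have := hlin h h'
      rw [hq, hq', sub_self, sub_self, smul_zero, smul_zero, add_zero, add_zero, h1] at this
      exact sub_eq_zero.mp ((smul_eq_zero.mp this).resolve_left (neg_ne_zero.mpr he₃0))
    refine hbound L δ hL hδ hδ1 (u := fun q => q.2.1 - e₃ • k) (v := fun q => q.2.2.1 - e₃ • k)
      (u₀ := k20 - e₃ • k) (v₀ := k30 - e₃ • k) (c := (‖k‖ ^ 2 - e₃ * β) / 2) hr
      (fun q m => have h := hTS m; ZLat_sub_mem h.2.1 (ZLat_sign_smul_mem he₃ hk))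
      (fun q m => have h := hTS m; ZLat_sub_mem h.2.2.1 (ZLat_sign_smul_mem he₃ hk))
      (fun q m => have h := hTS m; by simpa using h.2.2.2.2.1) (fun q m => have h := hTS m; by simpa using h.2.2.2.2.2.1)
      (fun q m => have h := hTS m; abs_inner_sub_le_of_resonance (o := q.1) he₃ ?_ ?_)
      (fun q m q' m' hq => have h := hTS m; have h' := hTS m'; ?_) (fun q m q' m' hq hq' => have h := hTS m; have h' := hTS m'; ?_)
    · rw [← h.2.2.2.2.2.2.1, h1, h2]; simp only [neg_smul]; abel
    · have := h.2.2.2.2.2.2.2.1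
      rw [h1, h2] at this
      convert this using 2; ring
    · have := hinner h h'
      rw [← inner_sub_right] at this ⊢
      simpa using this
    · have e1 := sub_left_injective hq
      have e2 := sub_left_injective hq'
      exact hlast h h' (h3 h h' e1 e2) e1 e2

theorem exists_counting_bounds (d : ℕ) (hd : 3 ≤ d) (γ : ℝ) (hγ' : γ < 1) {C₀ : ℝ}
    (hC₀ : 0 < C₀) :
    ∃ η₀ : ℝ, 0 < η₀ ∧ ∀ η : ℝ, 0 < η → η ≤ η₀ →
    ∃ C : ℝ, 2 ≤ C ∧ ∀ L δ : ℝ, C ≤ L → 0 < δ → δ < 1 → δ⁻¹ ≤ L ^ (η ^ 2) →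
    ∀ P N : ℝ, P = 0 ∨ (L⁻¹ ≤ P ∧ P ≤ 1) →
    N ≤ C₀ * L ^ (2 * d - 3) * (δ⁻¹ * L ^ (2 - 2 * γ)) * L →
    (0 < P → N ≤ C₀ * L ^ (2 * d - 3) * (δ⁻¹ * L ^ (2 - 2 * γ)) *
        (1 + δ⁻¹ * L ^ (2 - 2 * γ) / (L * P))) →
    (γ ≤ 1 / 2 ∨ P = 0 →
      N ≤ C * δ⁻¹ * L ^ (2 * ((d : ℝ) - γ)) * (1 + δ * L ^ (2 * γ) * P)⁻¹) ∧
    (1 / 2 < γ ∧ P ≠ 0 →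
      N ≤ C * δ⁻¹ ^ 2 * L ^ (2 * ((d : ℝ) - γ)) *
        min ((L * P)⁻¹ + L ^ (-(2 - 2 * γ))) (L ^ (-(10 * η)))) ∧
    (4 / 5 - 10 * η < γ ∧ P ≠ 0 →
      N ≤ C * δ⁻¹ ^ 2 * L ^ (2 * ((d : ℝ) - γ) - (1 - γ) - 20 * η)) ∧
    N ≤ C * δ⁻¹ * L ^ (2 * ((d : ℝ) - γ)) *
      (min (Real.log L ^ 2) (1 + δ * L ^ (2 * γ) * P))⁻¹ := by
  refine ⟨min (1 / 125) (if 1 / 2 < γ then (2 * γ - 1) / 10 else 1), ?_, ?_⟩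
  · split_ifs with h
    · exact lt_min (by norm_num) (by linarith)
    · norm_num
  intro η hη hη₀
  have hη1 : η ≤ 1 / 125 := hη₀.trans (min_le_left _ _)
  have hη2 : 1 / 2 < γ → 10 * η ≤ 2 * γ - 1 := by
    intro h
    have := hη₀.trans (min_le_right _ _)
    rw [if_pos h] at this
    linarith
  refine ⟨2 + 3 * C₀ + C₀ / (8 * η ^ 2), by have : 0 < C₀ / (8 * η ^ 2) := by positivity
                                            linarith, ?_⟩
  set C := 2 + 3 * C₀ + C₀ / (8 * η ^ 2) with hC
  have hCη : 0 < C₀ / (8 * η ^ 2) := by positivity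
  intro L δ hL hδ hδ1 hδL P N hP h1 h2
  have hL2 : 2 ≤ L := by linarith
  have hL0 : 0 < L := by linarith
  have hL1 : 1 ≤ L := by linarith
  have hδinv : 1 ≤ δ⁻¹ := (one_le_inv₀ hδ).mpr hδ1.le
  set Λ : ℝ := L ^ (2 * ((d : ℝ) - γ)) with hΛ
  have hΛ0 : 0 < Λ := by positivity
  have hQ : L ^ (2 * d - 3) * (δ⁻¹ * L ^ (2 - 2 * γ)) = δ⁻¹ * Λ * L⁻¹ := by
    have hcast : ((2 * d - 3 : ℕ) : ℝ) = 2 * d - 3 := by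
      rw [Nat.cast_sub (by omega)]; push_cast; ring
    have : L ^ (2 * d - 3) * L ^ (2 - 2 * γ) = Λ * L⁻¹ := by
      rw [← Real.rpow_natCast, hcast, ← Real.rpow_neg_one, hΛ, ← Real.rpow_add hL0,
        ← Real.rpow_add hL0]
      congr 1; ring
    rw [mul_left_comm, this, mul_assoc]
  have hQL : δ⁻¹ * L ^ (2 - 2 * γ) / L = δ⁻¹ * L ^ (1 - 2 * γ) := by
    rw [mul_div_assoc, ← Real.rpow_sub_one hL0.ne']
    congr 2; ring
  have hN1 : N ≤ C₀ * (δ⁻¹ * Λ) := by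
    refine h1.trans_eq ?_
    rw [mul_assoc C₀, hQ]
    field_simp
  have hN2 : 0 < P → N ≤ C₀ * (δ⁻¹ * Λ) * (L⁻¹ + δ⁻¹ * L ^ (1 - 2 * γ) * (L * P)⁻¹) := by
    intro hP0
    refine (h2 hP0).trans_eq ?_
    rw [mul_assoc C₀, hQ, ← hQL]
    field_simp
  have hPpos : P ≠ 0 → L⁻¹ ≤ P ∧ P ≤ 1 ∧ 0 < P := by
    intro h
    obtain ⟨h3, h4⟩ := hP.resolve_left h
    exact ⟨h3, h4, lt_of_lt_of_le (by positivity) h3⟩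
  have hP0 : 0 ≤ P := by
    by_cases h : P = 0
    · exact h.ge
    · exact (hPpos h).2.2.le
  have hx0 : 0 ≤ δ * L ^ (2 * γ) * P := by positivity
  have hA : γ ≤ 1 / 2 ∨ P = 0 → N ≤ C * δ⁻¹ * Λ * (1 + δ * L ^ (2 * γ) * P)⁻¹ := by
    intro h
    rw [← div_eq_mul_inv, le_div_iff₀ (by linarith)]
    by_cases hPz : P = 0
    · rw [hPz, mul_zero, add_zero, mul_one]
      calc N ≤ C₀ * (δ⁻¹ * Λ) := hN1
        _ ≤ C * (δ⁻¹ * Λ) := by gcongr; linarith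
        _ = _ := by ring
    · obtain ⟨-, hP1, hPp⟩ := hPpos hPz
      have hγ2 := h.resolve_right hPz
      have hxL : δ * L ^ (2 * γ) * P ≤ L := by
        calc δ * L ^ (2 * γ) * P ≤ 1 * L ^ (1 : ℝ) * 1 := by gcongr; linarith
          _ = L := by simp
      have hpow : L ^ (1 - 2 * γ) * L ^ (2 * γ) = L := by
        rw [← Real.rpow_add hL0]; simp
      have hprod : (L⁻¹ + δ⁻¹ * L ^ (1 - 2 * γ) * (L * P)⁻¹) * (δ * L ^ (2 * γ) * P) ≤ 2 := by
        have e : (L⁻¹ + δ⁻¹ * L ^ (1 - 2 * γ) * (L * P)⁻¹) * (δ * L ^ (2 * γ) * P) =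
            L⁻¹ * (δ * L ^ (2 * γ) * P) + (L ^ (1 - 2 * γ) * L ^ (2 * γ)) * L⁻¹ := by
          field_simp
        rw [e, hpow, mul_inv_cancel₀ hL0.ne']
        have : L⁻¹ * (δ * L ^ (2 * γ) * P) ≤ L⁻¹ * L := by gcongr
        rw [inv_mul_cancel₀ hL0.ne'] at this
        linarith
      calc N * (1 + δ * L ^ (2 * γ) * P) = N + N * (δ * L ^ (2 * γ) * P) := by ring
        _ ≤ C₀ * (δ⁻¹ * Λ) + C₀ * (δ⁻¹ * Λ) * (L⁻¹ + δ⁻¹ * L ^ (1 - 2 * γ) * (L * P)⁻¹) *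
            (δ * L ^ (2 * γ) * P) := by gcongr; exact hN2 hPp
        _ = C₀ * (δ⁻¹ * Λ) + C₀ * (δ⁻¹ * Λ) * ((L⁻¹ + δ⁻¹ * L ^ (1 - 2 * γ) * (L * P)⁻¹) *
            (δ * L ^ (2 * γ) * P)) := by ring
        _ ≤ C₀ * (δ⁻¹ * Λ) + C₀ * (δ⁻¹ * Λ) * 2 := by gcongr
        _ = (3 * C₀) * (δ⁻¹ * Λ) := by ring
        _ ≤ C * (δ⁻¹ * Λ) := by gcongr; linarith
        _ = _ := by ring
  have hgain : P ≠ 0 → N ≤ 2 * C₀ * δ⁻¹ ^ 2 * Λ * L ^ (1 - 2 * γ) := by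
    intro hPz
    obtain ⟨hPL, -, hPp⟩ := hPpos hPz
    have hLP : (L * P)⁻¹ ≤ 1 := by
      apply inv_le_one_of_one_le₀
      calc 1 = L * L⁻¹ := (mul_inv_cancel₀ hL0.ne').symm
        _ ≤ L * P := by gcongr
    have hLinv : L⁻¹ ≤ δ⁻¹ * L ^ (1 - 2 * γ) := by
      rw [← Real.rpow_neg_one]
      calc L ^ (-1 : ℝ) ≤ L ^ (1 - 2 * γ) := by gcongr; linarith
        _ ≤ _ := le_mul_of_one_le_left (by positivity) hδinv
    calc N ≤ C₀ * (δ⁻¹ * Λ) * (L⁻¹ + δ⁻¹ * L ^ (1 - 2 * γ) * (L * P)⁻¹) := hN2 hPp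
      _ ≤ C₀ * (δ⁻¹ * Λ) * (δ⁻¹ * L ^ (1 - 2 * γ) + δ⁻¹ * L ^ (1 - 2 * γ) * 1) := by gcongr
      _ = _ := by ring
  have hB : 1 / 2 < γ ∧ P ≠ 0 → N ≤ 2 * C₀ * δ⁻¹ ^ 2 * Λ * L ^ (-(10 * η)) := by
    rintro ⟨hγ2, hPz⟩
    refine (hgain hPz).trans ?_
    gcongr
    linarith [hη2 hγ2]
  have hC2 : 2 * C₀ ≤ C := by linarith
  refine ⟨hA, ?_, ?_, ?_⟩
  · rintro ⟨hγ2, hPz⟩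
    obtain ⟨hPL, -, hPp⟩ := hPpos hPz
    rw [mul_min_of_nonneg _ _ (by positivity)]
    refine le_min ?_ ((hB ⟨hγ2, hPz⟩).trans (by gcongr))
    have hLinv : L⁻¹ ≤ δ⁻¹ * L ^ (-(2 - 2 * γ)) := by
      rw [← Real.rpow_neg_one]
      calc L ^ (-1 : ℝ) ≤ L ^ (-(2 - 2 * γ)) := by gcongr; linarith
        _ ≤ _ := le_mul_of_one_le_left (by positivity) hδinv
    have hL12 : L ^ (1 - 2 * γ) ≤ 1 := Real.rpow_le_one_of_one_le_of_nonpos hL1 (by linarith)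
    calc N ≤ C₀ * (δ⁻¹ * Λ) * (L⁻¹ + δ⁻¹ * L ^ (1 - 2 * γ) * (L * P)⁻¹) := hN2 hPp
      _ ≤ C₀ * (δ⁻¹ * Λ) * (δ⁻¹ * L ^ (-(2 - 2 * γ)) + δ⁻¹ * 1 * (L * P)⁻¹) := by gcongr
      _ = C₀ * δ⁻¹ ^ 2 * Λ * ((L * P)⁻¹ + L ^ (-(2 - 2 * γ))) := by ring
      _ ≤ _ := by gcongr; linarith
  · rintro ⟨hγ4, hPz⟩
    calc N ≤ 2 * C₀ * δ⁻¹ ^ 2 * Λ * L ^ (1 - 2 * γ) := hgain hPz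
      _ = 2 * C₀ * δ⁻¹ ^ 2 * L ^ (2 * ((d : ℝ) - γ) + (1 - 2 * γ)) := by
          rw [Real.rpow_add hL0, ← hΛ]; ring
      _ ≤ _ := by gcongr; linarith
  · have hlog : 0 < Real.log L := Real.log_pos (by linarith)
    have hmin : 0 < min (Real.log L ^ 2) (1 + δ * L ^ (2 * γ) * P) :=
      lt_min (by positivity) (by linarith)
    by_cases h : γ ≤ 1 / 2 ∨ P = 0
    · refine (hA h).trans ?_
      gcongr
      exact min_le_right _ _
    · push Not at h
      have hlogle : Real.log L ^ 2 ≤ L ^ (8 * η) / (16 * η ^ 2) := by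
        have h3 := Real.log_le_rpow_div hL0.le (by positivity : 0 < 4 * η)
        calc Real.log L ^ 2 ≤ (L ^ (4 * η) / (4 * η)) ^ 2 := by gcongr
          _ = (L ^ (4 * η) * L ^ (4 * η)) / (16 * η ^ 2) := by ring
          _ = _ := by rw [← Real.rpow_add hL0]; congr 2; ring
      have hδη : δ⁻¹ * L ^ (-(10 * η)) ≤ L ^ (-(8 * η)) := by
        calc δ⁻¹ * L ^ (-(10 * η)) ≤ L ^ (η ^ 2) * L ^ (-(10 * η)) := by gcongr
          _ = L ^ (η ^ 2 + -(10 * η)) := (Real.rpow_add hL0 _ _).symm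
          _ ≤ _ := by gcongr; nlinarith
      have hinv : L ^ (-(8 * η)) ≤ (Real.log L ^ 2)⁻¹ / (16 * η ^ 2) := by
        rw [Real.rpow_neg hL0.le, ← div_eq_inv_mul] at *
        rw [div_eq_mul_inv, ← mul_inv]
        gcongr
        rw [le_div_iff₀ (by positivity)] at hlogle
        exact hlogle
      calc N ≤ 2 * C₀ * δ⁻¹ ^ 2 * Λ * L ^ (-(10 * η)) := hB h
        _ = 2 * C₀ * δ⁻¹ * Λ * (δ⁻¹ * L ^ (-(10 * η))) := by ring
        _ ≤ 2 * C₀ * δ⁻¹ * Λ * ((Real.log L ^ 2)⁻¹ / (16 * η ^ 2)) := by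
            gcongr; exact hδη.trans hinv
        _ = (C₀ / (8 * η ^ 2)) * δ⁻¹ * Λ * (Real.log L ^ 2)⁻¹ := by field_simp; norm_num
        _ ≤ C * δ⁻¹ * Λ * (min (Real.log L ^ 2) (1 + δ * L ^ (2 * γ) * P))⁻¹ := by
            gcongr
            · linarith
            · exact min_le_left _ _

theorem statement9 (d : ℕ) (hd : 3 ≤ d) (γ : ℝ) (hγ : 0 < γ) (hγ' : γ < 1) :
    ∃ η₀ : ℝ, 0 < η₀ ∧ ∀ η : ℝ, 0 < η → η ≤ η₀ →
    ∃ C : ℝ, 2 ≤ C ∧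
    ∀ L δ : ℝ, C ≤ L → 0 < δ → δ < 1 → δ⁻¹ ≤ L ^ (η ^ 2) →
    ∀ ε₁ ε₂ : ℝ, (ε₁ = 1 ∨ ε₁ = -1) → (ε₂ = 1 ∨ ε₂ = -1) →
    ∀ (k10 k20 k30 k40 k k' : EuclideanSpace ℝ (Fin d)), k ∈ ZLat d L → k' ∈ ZLat d L →
    ∀ β β' P : ℝ,
      ((¬(ε₁ = ε₂ ∧ ε₂ = -1) →
        ((P = 0 ∧ k' = 0) ∨ (L⁻¹ ≤ P ∧ P < 1 ∧ P ≤ ‖k'‖ ∧ ‖k'‖ ≤ 2 * P) ∨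
          (P = 1 ∧ 1 ≤ ‖k'‖)) →
        ((γ ≤ 1 / 2 ∨ P = 0 →
            (countSysI d L δ γ ε₁ ε₂ β β' k k' k10 k20 k30 k40 : ℝ) ≤
              C * δ⁻¹ * L ^ (2 * ((d : ℝ) - γ)) * (1 + δ * L ^ (2 * γ) * P)⁻¹) ∧
          (1 / 2 < γ ∧ P ≠ 0 →
            (countSysI d L δ γ ε₁ ε₂ β β' k k' k10 k20 k30 k40 : ℝ) ≤
              C * δ⁻¹ ^ 2 * L ^ (2 * ((d : ℝ) - γ)) *
                min ((L * P)⁻¹ + L ^ (-(2 - 2 * γ))) (L ^ (-(10 * η)))) ∧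
          (4 / 5 - 10 * η < γ ∧ P ≠ 0 →
            (countSysI d L δ γ ε₁ ε₂ β β' k k' k10 k20 k30 k40 : ℝ) ≤
              C * δ⁻¹ ^ 2 * L ^ (2 * ((d : ℝ) - γ) - (1 - γ) - 20 * η)) ∧
          (countSysI d L δ γ ε₁ ε₂ β β' k k' k10 k20 k30 k40 : ℝ) ≤
            C * δ⁻¹ * L ^ (2 * ((d : ℝ) - γ)) *
              (min (Real.log L ^ 2) (1 + δ * L ^ (2 * γ) * P))⁻¹)) ∧
      (¬(ε₁ = ε₂ ∧ ε₂ = 1) →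
        ((P = 0 ∧ k + k' = 0) ∨ (L⁻¹ ≤ P ∧ P < 1 ∧ P ≤ ‖k + k'‖ ∧ ‖k + k'‖ ≤ 2 * P) ∨
          (P = 1 ∧ 1 ≤ ‖k + k'‖)) →
        ((γ ≤ 1 / 2 ∨ P = 0 →
            (countSysII d L δ γ ε₁ ε₂ β β' k k' k10 k20 k30 k40 : ℝ) ≤
              C * δ⁻¹ * L ^ (2 * ((d : ℝ) - γ)) * (1 + δ * L ^ (2 * γ) * P)⁻¹) ∧
          (1 / 2 < γ ∧ P ≠ 0 →
            (countSysII d L δ γ ε₁ ε₂ β β' k k' k10 k20 k30 k40 : ℝ) ≤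
              C * δ⁻¹ ^ 2 * L ^ (2 * ((d : ℝ) - γ)) *
                min ((L * P)⁻¹ + L ^ (-(2 - 2 * γ))) (L ^ (-(10 * η)))) ∧
          (4 / 5 - 10 * η < γ ∧ P ≠ 0 →
            (countSysII d L δ γ ε₁ ε₂ β β' k k' k10 k20 k30 k40 : ℝ) ≤
              C * δ⁻¹ ^ 2 * L ^ (2 * ((d : ℝ) - γ) - (1 - γ) - 20 * η)) ∧
          (countSysII d L δ γ ε₁ ε₂ β β' k k' k10 k20 k30 k40 : ℝ) ≤
            C * δ⁻¹ * L ^ (2 * ((d : ℝ) - γ)) *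
              (min (Real.log L ^ 2) (1 + δ * L ^ (2 * γ) * P))⁻¹))) := by
  obtain ⟨C₀, hC₀, hq⟩ := exists_signedQuadruples_bound d hd γ hγ'
  obtain ⟨η₀, hη₀, hη⟩ := exists_counting_bounds d hd γ hγ' hC₀
  refine ⟨η₀, hη₀, fun η h h' => ?_⟩
  obtain ⟨C, hC2, hC⟩ := hη η h h'
  refine ⟨C, hC2, ?_⟩
  intro L δ hCL hδ hδ1 hδL ε₁ ε₂ hε₁ hε₂ k10 k20 k30 k40 k k' hk hk' β β' P
  have hL : 2 ≤ L := hC2.trans hCL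
  have hW : 0 ≤ δ⁻¹ * L ^ (-(2 * γ)) := by positivity
  have hLinv : L⁻¹ ≤ 1 := inv_le_one_of_one_le₀ (by linarith)
  have hP {r : EuclideanSpace ℝ (Fin d)}
      (h : (P = 0 ∧ r = 0) ∨ (L⁻¹ ≤ P ∧ P < 1 ∧ P ≤ ‖r‖ ∧ ‖r‖ ≤ 2 * P) ∨
        (P = 1 ∧ 1 ≤ ‖r‖)) : (P = 0 ∨ (L⁻¹ ≤ P ∧ P ≤ 1)) ∧ (0 < P → P ≤ ‖r‖) := by
    rcases h with ⟨rfl, -⟩ | ⟨h1, h2, h3, -⟩ | ⟨rfl, h1⟩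
    · exact ⟨Or.inl rfl, fun h => absurd h (lt_irrefl _)⟩
    · exact ⟨Or.inr ⟨h1, h2.le⟩, fun _ => h3⟩
    · exact ⟨Or.inr ⟨hLinv, le_rfl⟩, fun _ => h1⟩
  constructor
  · intro hne hr
    obtain ⟨hP01, hPr⟩ := hP hr
    have key := hq L δ hL hδ hδ1 (β := β) (β' := β') (k10 := k10) (k20 := k20) (k30 := k30)
      hε₁ hε₂ (Or.inr rfl) hne hk hk'
    unfold countSysI
    refine (fun T hT => hC L δ hCL hδ hδ1 hδL P (Set.ncard T) hP01 (key T hT).1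
      fun h0 => (key T hT).2 P h0 (hPr h0)) _ ?_
    rintro q ⟨hq1, hq2, hq3, -, hb1, hb2, hb3, -, hlin, hquad, hr', hquad'⟩
    refine ⟨hq1, hq2, hq3, hb1, hb2, hb3, ?_, ?_, hr', ?_⟩
    · rw [← hlin]
      module
    · convert hquad using 2
      ring
    · linarith
  · intro hne hr
    obtain ⟨hP01, hPr⟩ := hP hr
    have key := hq L δ hL hδ hδ1 (β := β) (β' := β + β') (k10 := k10) (k20 := k20) (k30 := k30)
      hε₁ hε₂ (Or.inl rfl) hne hk (ZLat_add_mem hk hk')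
    unfold countSysII
    refine (fun T hT => hC L δ hCL hδ hδ1 hδL P (Set.ncard T) hP01 (key T hT).1
      fun h0 => (key T hT).2 P h0 (hPr h0)) _ ?_
    rintro q ⟨hq1, hq2, hq3, -, hb1, hb2, hb3, -, hlin, hquad, hlin', hquad'⟩
    refine ⟨hq1, hq2, hq3, hb1, hb2, hb3, ?_, ?_, ?_, ?_⟩
    · rw [← hlin]
      module
    · convert hquad using 2
      ring
    · rw [← hlin, ← hlin']
      module
    · rw [abs_le] at hquad hquad' ⊢
      constructor <;> linarith [hquad.1, hquad.2, hquad'.1, hquad'.2]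
end
end

section
/- Let ε₁, ε₂, ε₃ ∈ {±1}, not all equal, and ε₄, ε₅ ∈ {±1} with −ε₁, ε₄, ε₅ not all equal. For k, k' ∈ ℤ_L^d and β, β' ∈ ℝ, the number of quintuples (k₁,…,k₅) ∈ (ℤ_L^d)⁵ with |k_j − k_j⁰| ≤ 1 for each j, satisfying ε₁k₁ + ε₂k₂ + ε₃k₃ = k, −ε₁k₁ + ε₄k₄ + ε₅k₅ = k', |ε₁|k₁|² + ε₂|k₂|² + ε₃|k₃|² − β| ≤ δ^{−1}L^{−2γ}, and |−ε₁|k₁|² + ε₄|k₄|² + ε₅|k₅|² − β'| ≤ δ^{−1}L^{−2γ}, is at most C·δ^{−2}·L^{3d−4γ} if γ ≤ 1/2 and at most C·δ^{−2}·L^{3(d−γ)−γ₀−10η} if γ > 1/2; in particular it is always at most C·δ^{−2}·L^{3(d−γ)−γ₀}. The same bounds hold when the second pair of constraints is replaced by −ε₁k₁ − ε₂k₂ + ε₄k₄ + ε₅k₅ = k' and |−ε₁|k₁|² − ε₂|k₂|² + ε₄|k₄|² + ε₅|k₅|² − β'| ≤ δ^{−1}L^{−2γ}, provided no three of the signs −ε₁,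 −ε₂, ε₄, ε₅ are equal. -/
open scoped RealInnerProductSpace BigOperators

noncomputable section

/-- Quintuples for the first variant of the 5-vector counting problem. -/
def countQuintA (d : ℕ) (L δ γ ε₁ ε₂ ε₃ ε₄ ε₅ β β' : ℝ)
    (k k' k10 k20 k30 k40 k50 : EuclideanSpace ℝ (Fin d)) : ℕ :=
  Set.ncard {q : EuclideanSpace ℝ (Fin d) × EuclideanSpace ℝ (Fin d) ×
      EuclideanSpace ℝ (Fin d) × EuclideanSpace ℝ (Fin d) × EuclideanSpace ℝ (Fin d) |
    q.1 ∈ ZLat d L ∧ q.2.1 ∈ ZLat d L ∧ q.2.2.1 ∈ ZLat d L ∧ q.2.2.2.1 ∈ ZLat d L ∧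
    q.2.2.2.2 ∈ ZLat d L ∧
    ‖q.1 - k10‖ ≤ 1 ∧ ‖q.2.1 - k20‖ ≤ 1 ∧ ‖q.2.2.1 - k30‖ ≤ 1 ∧ ‖q.2.2.2.1 - k40‖ ≤ 1 ∧
    ‖q.2.2.2.2 - k50‖ ≤ 1 ∧
    ε₁ • q.1 + ε₂ • q.2.1 + ε₃ • q.2.2.1 = k ∧
    -(ε₁ • q.1) + ε₄ • q.2.2.2.1 + ε₅ • q.2.2.2.2 = k' ∧
    |ε₁ * ‖q.1‖ ^ 2 + ε₂ * ‖q.2.1‖ ^ 2 + ε₃ * ‖q.2.2.1‖ ^ 2 - β| ≤ δ⁻¹ * L ^ (-(2 * γ)) ∧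
    |-(ε₁ * ‖q.1‖ ^ 2) + ε₄ * ‖q.2.2.2.1‖ ^ 2 + ε₅ * ‖q.2.2.2.2‖ ^ 2 - β'| ≤
      δ⁻¹ * L ^ (-(2 * γ))}

/-- Quintuples for the second variant of the 5-vector counting problem. -/
def countQuintB (d : ℕ) (L δ γ ε₁ ε₂ ε₃ ε₄ ε₅ β β' : ℝ)
    (k k' k10 k20 k30 k40 k50 : EuclideanSpace ℝ (Fin d)) : ℕ :=
  Set.ncard {q : EuclideanSpace ℝ (Fin d) × EuclideanSpace ℝ (Fin d) ×
      EuclideanSpace ℝ (Fin d) × EuclideanSpace ℝ (Fin d) × EuclideanSpace ℝ (Fin d) |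
    q.1 ∈ ZLat d L ∧ q.2.1 ∈ ZLat d L ∧ q.2.2.1 ∈ ZLat d L ∧ q.2.2.2.1 ∈ ZLat d L ∧
    q.2.2.2.2 ∈ ZLat d L ∧
    ‖q.1 - k10‖ ≤ 1 ∧ ‖q.2.1 - k20‖ ≤ 1 ∧ ‖q.2.2.1 - k30‖ ≤ 1 ∧ ‖q.2.2.2.1 - k40‖ ≤ 1 ∧
    ‖q.2.2.2.2 - k50‖ ≤ 1 ∧
    ε₁ • q.1 + ε₂ • q.2.1 + ε₃ • q.2.2.1 = k ∧
    -(ε₁ • q.1) - ε₂ • q.2.1 + ε₄ • q.2.2.2.1 + ε₅ • q.2.2.2.2 = k' ∧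
    |ε₁ * ‖q.1‖ ^ 2 + ε₂ * ‖q.2.1‖ ^ 2 + ε₃ * ‖q.2.2.1‖ ^ 2 - β| ≤ δ⁻¹ * L ^ (-(2 * γ)) ∧
    |-(ε₁ * ‖q.1‖ ^ 2) - ε₂ * ‖q.2.1‖ ^ 2 + ε₄ * ‖q.2.2.2.1‖ ^ 2 + ε₅ * ‖q.2.2.2.2‖ ^ 2 - β'| ≤
      δ⁻¹ * L ^ (-(2 * γ))}

/-- The integer points of the cube `[-M, M]^d`. -/
def intBox (d M : ℕ) : Finset (Fin d → ℤ) :=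
  Fintype.piFinset fun _ => Finset.Icc (-(M : ℤ)) M

/-- The number of integer points `X` of the cube `[-M, M]^d` with `|X · B| ≤ T`. -/
def slabCount (d M T : ℕ) (B : Fin d → ℤ) : ℕ :=
  ((intBox d M).filter fun X => |X ⬝ᵥ B| ≤ (T : ℤ)).card

lemma mem_intBox {d M : ℕ} {X : Fin d → ℤ} : X ∈ intBox d M ↔ ∀ i, |X i| ≤ (M : ℤ) := by
  simp [intBox, abs_le]

lemma card_Icc_neg (M : ℕ) : (Finset.Icc (-(M : ℤ)) M).card = 2 * M + 1 := by
  rw [Int.card_Icc]; omega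

lemma card_intBox (d M : ℕ) : (intBox d M).card = (2 * M + 1) ^ d := by
  rw [intBox, Fintype.card_piFinset]
  simp only [card_Icc_neg, Finset.prod_const, Finset.card_univ, Fintype.card_fin]

/-- A set of integers of diameter at most `D` in one residue class mod `q`. -/
lemma card_le_of_dvd_sub_s10 (S : Finset ℤ) (q D : ℕ) (hq : 0 < q)
    (hdvd : ∀ x ∈ S, ∀ y ∈ S, (q : ℤ) ∣ x - y) (hD : ∀ x ∈ S, ∀ y ∈ S, |x - y| ≤ (D : ℤ)) :
    S.card ≤ D / q + 1 := by
  rcases S.eq_empty_or_nonempty with rfl | hS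
  · simp
  set x₀ := S.min' hS
  have hx₀ : x₀ ∈ S := S.min'_mem hS
  have hq' : (0 : ℤ) < q := by exact_mod_cast hq
  have : S.card ≤ (Finset.range (D / q + 1)).card := by
    refine Finset.card_le_card_of_injOn (fun x => ((x - x₀) / q).toNat) ?_ ?_
    · intro x hx
      have h0 : x₀ ≤ x := S.min'_le x hx
      have h1 := (abs_le.mp (hD x hx x₀ hx₀)).2
      have h2 : (x - x₀) / q ≤ (D : ℤ) / q := Int.ediv_le_ediv hq' h1
      simp only [Finset.coe_range, Set.mem_Iio]
      have h3 : ((D / q : ℕ) : ℤ) = (D : ℤ) / q := by simp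
      have h4 : (0 : ℤ) ≤ (D : ℤ) / q := Int.ediv_nonneg (by positivity) hq'.le
      omega
    · intro x hx y hy hxy
      have h0 : x₀ ≤ x := S.min'_le x hx
      have h0' : x₀ ≤ y := S.min'_le y hy
      obtain ⟨u, hu⟩ := hdvd x hx x₀ hx₀
      obtain ⟨v, hv⟩ := hdvd y hy x₀ hx₀
      simp only [hu, hv, Int.mul_ediv_cancel_left _ hq'.ne'] at hxy
      have hu0 : 0 ≤ u := by nlinarith
      have hv0 : 0 ≤ v := by nlinarith
      have : u = v := by omega
      subst this
      linarith
  simpa using this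

lemma card_restrict_fiber {d : ℕ} (M : ℕ) (p : Fin d → Prop) [DecidablePred p]
    (S : Finset (Fin d → ℤ))
    (hS : S ⊆ intBox d M) (K : ℕ)
    (hK : ∀ X₀ ∈ S, (S.filter fun X => ∀ j, p j → X j = X₀ j).card ≤ K) :
    S.card ≤ K * (2 * M + 1) ^ (Fintype.card {j // p j}) := by
  classical
  have h := Finset.card_le_mul_card_image (f := fun (X : Fin d → ℤ) (j : {j // p j}) => X j) S K ?_
  · refine h.trans (Nat.mul_le_mul_left _ ?_)
    have hsub : S.image (fun (X : Fin d → ℤ) (j : {j // p j}) => X j) ⊆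
        Fintype.piFinset fun _ => Finset.Icc (-(M : ℤ)) M := by
      intro Y hY
      obtain ⟨X, hX, rfl⟩ := Finset.mem_image.mp hY
      have := mem_intBox.mp (hS hX)
      simp only [Fintype.mem_piFinset, Finset.mem_Icc]
      exact fun j => abs_le.mp (this j)
    refine (Finset.card_le_card hsub).trans ?_
    rw [Fintype.card_piFinset]
    simp only [card_Icc_neg, Finset.prod_const, Finset.card_univ, le_refl]
  · intro Y hY
    obtain ⟨X₀, hX₀, rfl⟩ := Finset.mem_image.mp hY
    refine le_trans (le_of_eq ?_) (hK X₀ hX₀)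
    congr 1
    ext X
    simp [funext_iff]

/-- Slab bound gained from one nonzero coordinate. -/
lemma slabCount_le_one {d M T : ℕ} {B : Fin d → ℤ} (i : Fin d) (hi : B i ≠ 0) :
    slabCount d M T B ≤ (2 * T / (B i).natAbs + 1) * (2 * M + 1) ^ (d - 1) := by
  classical
  have hcard : Fintype.card {j : Fin d // j ≠ i} = d - 1 := by
    simp [Fintype.card_subtype_compl]
  have h := card_restrict_fiber M (fun j => j ≠ i)
    ((intBox d M).filter fun X => |X ⬝ᵥ B| ≤ (T : ℤ)) (Finset.filter_subset _ _)
    (2 * T / (B i).natAbs + 1) ?_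
  · rw [hcard] at h; exact h
  intro X₀ _
  set S := (((intBox d M).filter fun X => |X ⬝ᵥ B| ≤ (T : ℤ)).filter
    fun X => ∀ j, j ≠ i → X j = X₀ j) with hS
  have hSmem : ∀ X ∈ S, |X ⬝ᵥ B| ≤ (T : ℤ) ∧ ∀ j, j ≠ i → X j = X₀ j := by
    intro X hX
    simp only [hS, Finset.mem_filter] at hX
    exact ⟨hX.1.2, hX.2⟩
  have hinj : Set.InjOn (fun X : Fin d → ℤ => X i) S := by
    intro X hX Y hY hXY
    funext j
    by_cases hj : j = i
    · subst hj; exact hXY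
    · rw [(hSmem X hX).2 j hj, (hSmem Y hY).2 j hj]
  rw [← Finset.card_image_of_injOn hinj]
  have hdot : ∀ X ∈ S, ∀ Y ∈ S, X ⬝ᵥ B - Y ⬝ᵥ B = (X i - Y i) * B i := by
    intro X hX Y hY
    rw [← sub_dotProduct, dotProduct, Finset.sum_eq_single i]
    · simp
    · intro j _ hj
      simp [(hSmem X hX).2 j hj, (hSmem Y hY).2 j hj]
    · simp
  have := card_le_of_dvd_sub_s10 (S.image fun X => X i) 1 (2 * T / (B i).natAbs) one_pos
    (by simp) ?_
  · simpa using this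
  · intro x hx y hy
    obtain ⟨X, hX, rfl⟩ := Finset.mem_image.mp hx
    obtain ⟨Y, hY, rfl⟩ := Finset.mem_image.mp hy
    have h1 : |(X i - Y i) * B i| ≤ 2 * (T : ℤ) := by
      rw [← hdot X hX Y hY]
      have := abs_sub (X ⬝ᵥ B) (Y ⬝ᵥ B)
      have := (hSmem X hX).1
      have := (hSmem Y hY).1
      linarith
    rw [abs_mul] at h1
    have h2 : (X i - Y i).natAbs ≤ 2 * T / (B i).natAbs := by
      rw [Nat.le_div_iff_mul_le (Int.natAbs_pos.mpr hi)]
      zify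
      exact h1
    rw [← Int.natCast_natAbs]
    exact_mod_cast h2

/-- Lattice points of a square in a planar strip. -/
lemma card_strip_le (M T : ℕ) (b₁ b₂ : ℤ) (hb : b₂ ≠ 0) (S : Finset (ℤ × ℤ))
    (hS : ∀ z ∈ S, |z.1| ≤ (M : ℤ))
    (hT : ∀ z ∈ S, ∀ w ∈ S, |(z.1 - w.1) * b₁ + (z.2 - w.2) * b₂| ≤ (2 * T : ℤ)) :
    S.card ≤ (2 * M / (b₂.natAbs / Int.gcd b₁ b₂) + 1) * (2 * T / Int.gcd b₁ b₂ + 1) := by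
  classical
  set g := Int.gcd b₁ b₂ with hg
  have hgpos : 0 < g := Int.gcd_pos_of_ne_zero_right _ hb
  have hgz : (0 : ℤ) < g := by exact_mod_cast hgpos
  obtain ⟨p, q, hcop, hp, hq⟩ : ∃ p q : ℤ, IsCoprime p q ∧ b₁ = p * g ∧ b₂ = q * g := by
    obtain ⟨p, q, h1, h2, h3⟩ := Int.exists_gcd_one hgpos
    exact ⟨p, q, Int.isCoprime_iff_gcd_eq_one.mpr h1, h2, h3⟩
  have hq0 : q ≠ 0 := by rintro rfl; simp at hq; exact hb hq
  have hqabs : b₂.natAbs / g = q.natAbs := by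
    conv_lhs => rw [hq]
    rw [Int.natAbs_mul, Int.natAbs_natCast, Nat.mul_div_cancel _ hgpos]
  rw [hqabs]
  set φ : ℤ × ℤ → ℤ := fun z => z.1 * p + z.2 * q with hφ
  have h := Finset.card_le_mul_card_image (f := φ) S (2 * M / q.natAbs + 1) ?_
  · refine h.trans (Nat.mul_le_mul_left _ ?_)
    have := card_le_of_dvd_sub_s10 (S.image φ) 1 (2 * T / g) one_pos (by simp) ?_
    · simpa using this
    · intro x hx y hy
      obtain ⟨z, hz, rfl⟩ := Finset.mem_image.mp hx
      obtain ⟨w, hw, rfl⟩ := Finset.mem_image.mp hy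
      have h1 := hT z hz w hw
      have h2 : (z.1 - w.1) * b₁ + (z.2 - w.2) * b₂ = (φ z - φ w) * g := by
        simp only [hφ]
        conv_lhs => rw [hp, hq]
        ring
      rw [h2, abs_mul, Nat.abs_cast] at h1
      have h3 : (φ z - φ w).natAbs ≤ 2 * T / g := by
        rw [Nat.le_div_iff_mul_le hgpos]
        zify
        exact h1
      rw [← Int.natCast_natAbs]
      exact_mod_cast h3
  · intro v _
    set F := S.filter fun z => φ z = v with hF
    have hFm : ∀ z ∈ F, z ∈ S ∧ z.1 * p + z.2 * q = v := by
      intro z hz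
      simpa [hF, hφ] using hz
    have hinj : Set.InjOn Prod.fst (F : Set (ℤ × ℤ)) := by
      intro z hz w hw hzw
      have h1 := (hFm z hz).2
      have h2 := (hFm w hw).2
      refine Prod.ext hzw ?_
      rw [hzw] at h1
      exact mul_right_cancel₀ hq0 (by linarith)
    rw [← Finset.card_image_of_injOn hinj]
    refine card_le_of_dvd_sub_s10 _ _ _ (Int.natAbs_pos.mpr hq0) ?_ ?_
    · intro x hx y hy
      obtain ⟨z, hz, rfl⟩ := Finset.mem_image.mp hx
      obtain ⟨w, hw, rfl⟩ := Finset.mem_image.mp hy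
      rw [Int.natAbs_dvd]
      refine hcop.symm.dvd_of_dvd_mul_right ⟨w.2 - z.2, ?_⟩
      linear_combination (hFm z hz).2 - (hFm w hw).2
    · intro x hx y hy
      obtain ⟨z, hz, rfl⟩ := Finset.mem_image.mp hx
      obtain ⟨w, hw, rfl⟩ := Finset.mem_image.mp hy
      have h1 := abs_sub z.1 w.1
      have h2 := hS z (hFm z hz).1
      have h3 := hS w (hFm w hw).1
      push_cast
      linarith

/-- Slab bound gained from two coordinates. -/
lemma slabCount_le_two {d M T : ℕ} {B : Fin d → ℤ} {i j : Fin d} (hij : i ≠ j) (hj : B j ≠ 0) :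
    slabCount d M T B ≤ (2 * M / ((B j).natAbs / Int.gcd (B i) (B j)) + 1) *
      (2 * T / Int.gcd (B i) (B j) + 1) * (2 * M + 1) ^ (d - 2) := by
  classical
  have hcard : Fintype.card {l : Fin d // l ≠ i ∧ l ≠ j} = d - 2 := by
    rw [Fintype.card_subtype]
    have : (Finset.univ.filter fun l : Fin d => l ≠ i ∧ l ≠ j) = {i, j}ᶜ := by
      ext l; simp
    rw [this, Finset.card_compl, Finset.card_pair hij, Fintype.card_fin]
  have h := card_restrict_fiber M (fun l => l ≠ i ∧ l ≠ j)
    ((intBox d M).filter fun X => |X ⬝ᵥ B| ≤ (T : ℤ)) (Finset.filter_subset _ _)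
    ((2 * M / ((B j).natAbs / Int.gcd (B i) (B j)) + 1) * (2 * T / Int.gcd (B i) (B j) + 1)) ?_
  · rw [hcard] at h; exact h
  intro X₀ _
  set S := (((intBox d M).filter fun X => |X ⬝ᵥ B| ≤ (T : ℤ)).filter
    fun X => ∀ l, l ≠ i ∧ l ≠ j → X l = X₀ l) with hS
  have hSmem : ∀ X ∈ S, |X ⬝ᵥ B| ≤ (T : ℤ) ∧ (∀ l, l ≠ i ∧ l ≠ j → X l = X₀ l) ∧
      |X i| ≤ (M : ℤ) := by
    intro X hX
    simp only [hS, Finset.mem_filter, mem_intBox] at hX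
    exact ⟨hX.1.2, hX.2, hX.1.1 i⟩
  have hinj : Set.InjOn (fun X : Fin d → ℤ => (X i, X j)) S := by
    intro X hX Y hY hXY
    simp only [Prod.mk.injEq] at hXY
    funext l
    by_cases hl : l = i
    · subst hl; exact hXY.1
    by_cases hl' : l = j
    · subst hl'; exact hXY.2
    rw [(hSmem X hX).2.1 l ⟨hl, hl'⟩, (hSmem Y hY).2.1 l ⟨hl, hl'⟩]
  rw [← Finset.card_image_of_injOn hinj]
  have hdot : ∀ X ∈ S, ∀ Y ∈ S,
      X ⬝ᵥ B - Y ⬝ᵥ B = (X i - Y i) * B i + (X j - Y j) * B j := by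
    intro X hX Y hY
    rw [← sub_dotProduct, dotProduct, ← Finset.sum_subset (Finset.subset_univ {i, j}),
      Finset.sum_pair hij]
    · simp
    · intro l _ hl
      simp only [Finset.mem_insert, Finset.mem_singleton, not_or] at hl
      simp [(hSmem X hX).2.1 l hl, (hSmem Y hY).2.1 l hl]
  refine card_strip_le M T (B i) (B j) hj _ ?_ ?_
  · intro z hz
    obtain ⟨X, hX, rfl⟩ := Finset.mem_image.mp hz
    exact (hSmem X hX).2.2
  · intro z hz w hw
    obtain ⟨X, hX, rfl⟩ := Finset.mem_image.mp hz
    obtain ⟨Y, hY, rfl⟩ := Finset.mem_image.mp hw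
    rw [← hdot X hX Y hY]
    have := abs_sub (X ⬝ᵥ B) (Y ⬝ᵥ B)
    have := (hSmem X hX).1
    have := (hSmem Y hY).1
    linarith

/-- The maximum norm of an integer pair. -/
def pairNorm (z : ℤ × ℤ) : ℕ := max z.1.natAbs z.2.natAbs

lemma gcd_le_pairNorm (z : ℤ × ℤ) (hz : z ≠ 0) : Int.gcd z.1 z.2 ≤ pairNorm z := by
  by_cases h : z.1 = 0
  · have h2 : z.2 ≠ 0 := fun h2 => hz (Prod.ext h h2)
    exact (Int.gcd_le_natAbs_right _ h2).trans (le_max_right _ _)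
  · exact (Int.gcd_le_natAbs_left _ h).trans (le_max_left _ _)

lemma pairNorm_pos {z : ℤ × ℤ} (hz : z ≠ 0) : 0 < pairNorm z := by
  rw [pairNorm, lt_max_iff, Int.natAbs_pos, Int.natAbs_pos]
  by_contra! h
  exact hz (Prod.ext h.1 h.2)

lemma slabCount_le_pair_aux {d M T g H : ℕ} (hg : 0 < g) (hgH : g ∣ H) (hH : 0 < H) (hHM : H ≤ M) :
    (((2 * M / (H / g) + 1) * (2 * T / g + 1) * (2 * M + 1) ^ (d - 2) : ℕ) : ℝ) ≤
      3 * M * (g + 2 * T) / H * (2 * M + 1) ^ (d - 2) := by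
  push_cast
  gcongr
  obtain ⟨h, rfl⟩ := hgH
  rw [Nat.mul_div_cancel_left _ hg]
  have hh : 0 < h := Nat.pos_of_mul_pos_left hH
  have h1 : ((2 * M / h : ℕ) : ℝ) ≤ 2 * M / h := by
    exact_mod_cast (Nat.cast_div_le (α := ℝ) (m := 2 * M) (n := h))
  have h2 : ((2 * T / g : ℕ) : ℝ) ≤ 2 * T / g := by
    exact_mod_cast (Nat.cast_div_le (α := ℝ) (m := 2 * T) (n := g))
  have hgR : (0 : ℝ) < g := by exact_mod_cast hg
  have hhR : (0 : ℝ) < h := by exact_mod_cast hh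
  have h3 : (1 : ℝ) ≤ M / h := by
    rw [le_div_iff₀ hhR, one_mul]
    exact_mod_cast (Nat.le_mul_of_pos_left h hg).trans hHM
  calc (((2 * M / h : ℕ) : ℝ) + 1) * (((2 * T / g : ℕ) : ℝ) + 1)
      ≤ (2 * M / h + M / h) * (2 * T / g + 1) := by gcongr
    _ = 3 * M * (g + 2 * T) / ((g * h : ℕ) : ℝ) := by
      push_cast; field_simp; ring

lemma slabCount_le_pair {d M T : ℕ} {B : Fin d → ℤ} {i j : Fin d} (hij : i ≠ j)
    (hB : B ∈ intBox d M) (h0 : (B i, B j) ≠ 0) :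
    (slabCount d M T B : ℝ) ≤ 3 * M * (Int.gcd (B i) (B j) + 2 * T) / pairNorm (B i, B j) *
      (2 * M + 1) ^ (d - 2) := by
  have hBi : (B i).natAbs ≤ M := by
    have := mem_intBox.mp hB i; zify; exact this
  have hBj : (B j).natAbs ≤ M := by
    have := mem_intBox.mp hB j; zify; exact this
  rcases le_total (B i).natAbs (B j).natAbs with h | h
  · have hN : pairNorm (B i, B j) = (B j).natAbs := max_eq_right h
    have hpos := pairNorm_pos h0
    rw [hN] at hpos ⊢
    have hj : B j ≠ 0 := Int.natAbs_pos.mp hpos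
    refine le_trans (Nat.cast_le.mpr (slabCount_le_two hij hj)) ?_
    exact slabCount_le_pair_aux (Int.gcd_pos_of_ne_zero_right _ hj)
      (by simpa using Int.natAbs_dvd_natAbs.mpr (Int.gcd_dvd_right (B i) (B j))) hpos hBj
  · have hN : pairNorm (B i, B j) = (B i).natAbs := max_eq_left h
    have hpos := pairNorm_pos h0
    rw [hN] at hpos ⊢
    have hi : B i ≠ 0 := Int.natAbs_pos.mp hpos
    refine le_trans (Nat.cast_le.mpr (slabCount_le_two hij.symm hi)) ?_
    rw [Int.gcd_comm (B j) (B i)]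
    exact slabCount_le_pair_aux (Int.gcd_pos_of_ne_zero_left _ hi)
      (by simpa using Int.natAbs_dvd_natAbs.mpr (Int.gcd_dvd_left (B i) (B j))) hpos hBi

lemma one_div_sq_le_tail {n M : ℕ} (hn : 1 ≤ n) (hnM : n ≤ M) :
    (1 : ℝ) / n ^ 2 ≤ 1 / M ^ 2 + ∑ j ∈ Finset.Icc 1 M, if n ≤ j then 6 / (j : ℝ) ^ 3 else 0 := by
  induction M, hnM using Nat.le_induction with
  | base =>
    have : 0 ≤ ∑ j ∈ Finset.Icc 1 n, if n ≤ j then 6 / (j : ℝ) ^ 3 else 0 :=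
      Finset.sum_nonneg fun j _ => by split_ifs <;> positivity
    linarith
  | succ m hm ih =>
    rw [Finset.sum_Icc_succ_top (by omega), if_pos (by omega)]
    have hm0 : (1 : ℝ) ≤ m := by exact_mod_cast hn.trans hm
    have : (1 : ℝ) / m ^ 2 ≤ 1 / ((m + 1 : ℕ) : ℝ) ^ 2 + 6 / ((m + 1 : ℕ) : ℝ) ^ 3 := by
      push_cast
      rw [← sub_nonneg]
      have : (1 : ℝ) / (m + 1) ^ 2 + 6 / (m + 1) ^ 3 - 1 / m ^ 2 =
          (4 * m ^ 2 - 3 * m - 1) / (m ^ 2 * (m + 1) ^ 3) := by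
        field_simp; ring
      rw [this]
      have : 0 ≤ 4 * (m : ℝ) ^ 2 - 3 * m - 1 := by nlinarith
      positivity
    linarith

/-- Partial summation: the sum of `N(x)⁻²` when at most `K j^(e+2)` points have `N(x) ≤ j`. -/
lemma sum_one_div_sq_le {α : Type*} (s : Finset α) (N : α → ℕ) (M e : ℕ) (K : ℝ) (hM : 1 ≤ M)
    (hN : ∀ x ∈ s, 1 ≤ N x ∧ N x ≤ M)
    (hK : ∀ j, 1 ≤ j → ((s.filter fun x => N x ≤ j).card : ℝ) ≤ K * (j : ℝ) ^ (e + 2)) :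
    ∑ x ∈ s, (1 : ℝ) / (N x : ℝ) ^ 2 ≤
      K * ((M : ℝ) ^ e + 6 * ∑ j ∈ Finset.Icc 1 M, (j : ℝ) ^ e / j) := by
  have hM0 : (0 : ℝ) < M := by exact_mod_cast hM
  calc ∑ x ∈ s, (1 : ℝ) / (N x : ℝ) ^ 2
      ≤ ∑ x ∈ s, ((1 : ℝ) / M ^ 2 +
          ∑ j ∈ Finset.Icc 1 M, if N x ≤ j then 6 / (j : ℝ) ^ 3 else 0) :=
        Finset.sum_le_sum fun x hx => one_div_sq_le_tail (hN x hx).1 (hN x hx).2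
    _ = ((s.filter fun x => N x ≤ M).card : ℝ) * (1 / M ^ 2) +
          ∑ j ∈ Finset.Icc 1 M, ((s.filter fun x => N x ≤ j).card : ℝ) * (6 / (j : ℝ) ^ 3) := by
        rw [Finset.sum_add_distrib, Finset.sum_comm,
          Finset.filter_true_of_mem fun x hx => (hN x hx).2, Finset.sum_const, nsmul_eq_mul]
        congr 1
        refine Finset.sum_congr rfl fun j _ => ?_
        rw [← Finset.sum_filter, Finset.sum_const, nsmul_eq_mul]
    _ ≤ (K * (M : ℝ) ^ (e + 2)) * (1 / M ^ 2) +
          ∑ j ∈ Finset.Icc 1 M, (K * (j : ℝ) ^ (e + 2)) * (6 / (j : ℝ) ^ 3) := by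
        gcongr with j hj
        · exact hK M hM
        · exact hK j (Finset.mem_Icc.mp hj).1
    _ = _ := by
        rw [mul_add, Finset.mul_sum, Finset.mul_sum]
        congr 1
        · field_simp; ring
        · refine Finset.sum_congr rfl fun j hj => ?_
          have : (0 : ℝ) < j := by exact_mod_cast (Finset.mem_Icc.mp hj).1
          field_simp; ring

/-- The nonzero integer pairs in `[-M, M]^2`. -/
def pairBox (M : ℕ) : Finset (ℤ × ℤ) :=
  (Finset.Icc (-(M : ℤ)) M ×ˢ Finset.Icc (-(M : ℤ)) M).erase 0

lemma mem_pairBox {M : ℕ} {z : ℤ × ℤ} :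
    z ∈ pairBox M ↔ z ≠ 0 ∧ |z.1| ≤ (M : ℤ) ∧ |z.2| ≤ (M : ℤ) := by
  simp [pairBox, abs_le]

lemma pairNorm_le_iff {z : ℤ × ℤ} {M : ℕ} :
    pairNorm z ≤ M ↔ |z.1| ≤ (M : ℤ) ∧ |z.2| ≤ (M : ℤ) := by
  rw [pairNorm, max_le_iff]; zify

lemma two_mul_add_one_le {M : ℕ} (hM : 1 ≤ M) : (2 * M + 1 : ℝ) ≤ 3 * M := by
  have : (1 : ℝ) ≤ M := by exact_mod_cast hM
  linarith

lemma sum_pairBox_le {M : ℕ} (hM : 1 ≤ M) :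
    ∑ z ∈ pairBox M, (1 : ℝ) / (pairNorm z : ℝ) ^ 2 ≤ 63 * (1 + Real.log M) := by
  have h := sum_one_div_sq_le (pairBox M) pairNorm M 0 9 hM ?_ ?_
  · refine h.trans ?_
    have h1 := harmonic_le_one_add_log M
    have h2 : ∑ j ∈ Finset.Icc 1 M, (j : ℝ) ^ 0 / j = (harmonic M : ℝ) := by
      rw [harmonic_eq_sum_Icc]; push_cast; simp
    rw [h2]
    have h3 : 0 ≤ Real.log M := Real.log_natCast_nonneg M
    simp only [pow_zero]
    linarith
  · intro z hz
    rw [mem_pairBox] at hz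
    exact ⟨pairNorm_pos hz.1, pairNorm_le_iff.mpr hz.2⟩
  · intro j hj
    have hsub : ((pairBox M).filter fun z => pairNorm z ≤ j) ⊆
        Finset.Icc (-(j : ℤ)) j ×ˢ Finset.Icc (-(j : ℤ)) j := by
      intro z hz
      have := pairNorm_le_iff.mp (Finset.mem_filter.mp hz).2
      simpa [abs_le, Prod.le_def] using this
    have := Finset.card_le_card hsub
    rw [Finset.card_product, card_Icc_neg] at this
    calc (((pairBox M).filter fun z => pairNorm z ≤ j).card : ℝ)
        ≤ (2 * j + 1) * (2 * j + 1) := by exact_mod_cast this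
      _ ≤ (3 * j) * (3 * j) := by gcongr <;> exact two_mul_add_one_le hj
      _ = _ := by ring

lemma sum_gcd_sq_pairBox_le {M : ℕ} (hM : 1 ≤ M) :
    ∑ z ∈ pairBox M, (Int.gcd z.1 z.2 : ℝ) ^ 2 / (pairNorm z : ℝ) ^ 2 ≤
      63 * M * (1 + Real.log M) := by
  classical
  obtain ⟨ψ, hψ⟩ : ∃ ψ : ℤ × ℤ → ℕ × (ℤ × ℤ), ∀ z, ψ z =
    (Int.gcd z.1 z.2, (z.1 / Int.gcd z.1 z.2, z.2 / Int.gcd z.1 z.2)) := ⟨_, fun _ => rfl⟩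
  have hgpos : ∀ z ∈ pairBox M, 0 < Int.gcd z.1 z.2 := by
    intro z hz
    rw [Int.gcd_pos_iff]
    by_contra! h
    exact (mem_pairBox.mp hz).1 (Prod.ext h.1 h.2)
  have hdec : ∀ z ∈ pairBox M, ∃ (g : ℕ) (p q : ℤ), 0 < g ∧ z = (p * g, q * g) ∧
      ψ z = (g, (p, q)) := by
    intro z hz
    have hg := hgpos z hz
    have hg' : ((Int.gcd z.1 z.2 : ℕ) : ℤ) ≠ 0 := by exact_mod_cast hg.ne'
    refine ⟨Int.gcd z.1 z.2, z.1 / Int.gcd z.1 z.2, z.2 / Int.gcd z.1 z.2, hg, ?_, hψ z⟩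
    rw [Int.ediv_mul_cancel (Int.gcd_dvd_left _ _), Int.ediv_mul_cancel (Int.gcd_dvd_right _ _)]
  have hinj : Set.InjOn ψ (pairBox M) := by
    intro z hz w hw hzw
    obtain ⟨g, p, q, _, rfl, h1⟩ := hdec z hz
    obtain ⟨g', p', q', _, rfl, h2⟩ := hdec w hw
    rw [h1, h2] at hzw
    simp only [Prod.mk.injEq] at hzw
    obtain ⟨rfl, rfl, rfl⟩ := hzw
    rfl
  have hsub : (pairBox M).image ψ ⊆ Finset.Icc 1 M ×ˢ pairBox M := by
    intro y hy
    obtain ⟨z, hz, rfl⟩ := Finset.mem_image.mp hy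
    have hgM : Int.gcd z.1 z.2 ≤ M :=
      (gcd_le_pairNorm z (mem_pairBox.mp hz).1).trans (pairNorm_le_iff.mpr (mem_pairBox.mp hz).2)
    have hg1 := hgpos z hz
    have hg : (ψ z).1 = Int.gcd z.1 z.2 := by rw [hψ]
    obtain ⟨g, p, q, hgp, rfl, h1⟩ := hdec z hz
    rw [← hg, h1] at hgM
    rw [h1]
    obtain ⟨h0, ha, hb⟩ := mem_pairBox.mp hz
    have hg1 : (1 : ℤ) ≤ g := by exact_mod_cast hgp
    rw [Finset.mem_product, Finset.mem_Icc, mem_pairBox]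
    refine ⟨⟨hgp, hgM⟩, ?_, ?_, ?_⟩
    · rintro h
      simp only [Prod.mk_eq_zero] at h
      exact h0 (by simp [h.1, h.2])
    · simp only [abs_mul, Nat.abs_cast] at ha
      nlinarith [abs_nonneg p]
    · simp only [abs_mul, Nat.abs_cast] at hb
      nlinarith [abs_nonneg q]
  calc ∑ z ∈ pairBox M, (Int.gcd z.1 z.2 : ℝ) ^ 2 / (pairNorm z : ℝ) ^ 2
      = ∑ z ∈ pairBox M, (1 : ℝ) / (pairNorm (ψ z).2 : ℝ) ^ 2 := by
        refine Finset.sum_congr rfl fun z hz => ?_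
        have hg : (ψ z).1 = Int.gcd z.1 z.2 := by rw [hψ]
        rw [← hg]
        obtain ⟨g, p, q, hgp, rfl, h1⟩ := hdec z hz
        rw [h1]
        have : pairNorm (p * (g : ℤ), q * (g : ℤ)) = pairNorm (p, q) * g := by
          simp only [pairNorm, Int.natAbs_mul, Int.natAbs_natCast]
          exact (max_mul_of_nonneg _ _ (Nat.zero_le _)).symm
        have hgR : (0 : ℝ) < g := by exact_mod_cast hgp
        rw [this]
        push_cast
        rw [mul_pow, div_mul_eq_div_div_swap, div_self (by positivity)]
    _ = ∑ y ∈ (pairBox M).image ψ, (1 : ℝ) / (pairNorm y.2 : ℝ) ^ 2 := by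
        rw [Finset.sum_image hinj]
    _ ≤ ∑ y ∈ Finset.Icc 1 M ×ˢ pairBox M, (1 : ℝ) / (pairNorm y.2 : ℝ) ^ 2 :=
        Finset.sum_le_sum_of_subset_of_nonneg hsub fun _ _ _ => by positivity
    _ = M * ∑ z ∈ pairBox M, (1 : ℝ) / (pairNorm z : ℝ) ^ 2 := by
        rw [Finset.sum_product]
        simp
    _ ≤ M * (63 * (1 + Real.log M)) := by gcongr; exact sum_pairBox_le hM
    _ = 63 * M * (1 + Real.log M) := by ring

/-- The second moment of `slabCount` over the cube `[-M, M]^d`. -/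
def slabEnergy (d M T : ℕ) : ℕ := ∑ B ∈ intBox d M, slabCount d M T B ^ 2

/-- The maximum norm of an integer vector. -/
def boxNorm {d : ℕ} (B : Fin d → ℤ) : ℕ := Finset.univ.sup fun i => (B i).natAbs

lemma boxNorm_le_iff {d M : ℕ} {B : Fin d → ℤ} : boxNorm B ≤ M ↔ B ∈ intBox d M := by
  rw [mem_intBox, boxNorm, Finset.sup_le_iff]
  refine ⟨fun h i => ?_, fun h i _ => ?_⟩
  · have := h i (Finset.mem_univ i); zify at this; exact this
  · have := h i; zify; exact this

lemma exists_natAbs_eq_boxNorm {d : ℕ} {B : Fin d → ℤ} (hB : B ≠ 0) :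
    ∃ i, B i ≠ 0 ∧ (B i).natAbs = boxNorm B := by
  obtain ⟨j, hj⟩ : ∃ j, B j ≠ 0 := by
    by_contra! h
    exact hB (funext h)
  obtain ⟨i, _, hi⟩ := Finset.exists_mem_eq_sup Finset.univ ⟨j, Finset.mem_univ j⟩
    fun i => (B i).natAbs
  refine ⟨i, ?_, hi.symm⟩
  have h1 : (B j).natAbs ≤ (B i).natAbs :=
    (Finset.le_sup (f := fun i => (B i).natAbs) (Finset.mem_univ j)).trans hi.le
  have h2 := Int.natAbs_pos.mpr hj
  exact Int.natAbs_pos.mp (h2.trans_le h1)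

lemma slabCount_le_all {d M T : ℕ} (hM : 1 ≤ M) (B : Fin d → ℤ) :
    (slabCount d M T B : ℝ) ≤ (3 * M) ^ d := by
  have h : slabCount d M T B ≤ (2 * M + 1) ^ d :=
    (Finset.card_filter_le _ _).trans (card_intBox d M).le
  calc (slabCount d M T B : ℝ) ≤ (2 * M + 1) ^ d := by exact_mod_cast h
    _ ≤ (3 * M) ^ d := by gcongr; exact two_mul_add_one_le hM

lemma slabCount_le_boxNorm {e M T : ℕ} (hM : 1 ≤ M) {B : Fin (e + 2) → ℤ} (hB : B ≠ 0) :
    (slabCount (e + 2) M T B : ℝ) ≤ (2 * T / boxNorm B + 1) * (3 * M) ^ (e + 1) := by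
  obtain ⟨i, hi, hN⟩ := exists_natAbs_eq_boxNorm hB
  have h := slabCount_le_one (M := M) (T := T) i hi
  rw [hN] at h
  have h2 : ((2 * T / boxNorm B : ℕ) : ℝ) ≤ 2 * T / boxNorm B := by
    exact_mod_cast (Nat.cast_div_le (α := ℝ) (m := 2 * T) (n := boxNorm B))
  calc (slabCount (e + 2) M T B : ℝ)
      ≤ (((2 * T / boxNorm B : ℕ) : ℝ) + 1) * (2 * M + 1) ^ (e + 1) := by exact_mod_cast h
    _ ≤ _ := by gcongr; exact two_mul_add_one_le hM

lemma one_le_boxNorm {d : ℕ} {B : Fin d → ℤ} (hB : B ≠ 0) : 1 ≤ boxNorm B := by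
  obtain ⟨i, hi, hN⟩ := exists_natAbs_eq_boxNorm hB
  rw [← hN]; exact Int.natAbs_pos.mpr hi

lemma card_intBox_le {d M : ℕ} (hM : 1 ≤ M) : ((intBox d M).card : ℝ) ≤ (3 * M) ^ d := by
  rw [card_intBox]; push_cast; gcongr; exact two_mul_add_one_le hM

lemma zero_mem_intBox {d M : ℕ} : (0 : Fin d → ℤ) ∈ intBox d M := by
  simp [mem_intBox]

lemma sum_boxNorm_le {e M : ℕ} (he : 1 ≤ e) (hM : 1 ≤ M) :
    ∑ B ∈ (intBox (e + 2) M).erase 0, (1 : ℝ) / (boxNorm B : ℝ) ^ 2 ≤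
      7 * 3 ^ (e + 2) * (M : ℝ) ^ e := by
  have h := sum_one_div_sq_le ((intBox (e + 2) M).erase 0) boxNorm M e (3 ^ (e + 2)) hM ?_ ?_
  · refine h.trans ?_
    have h2 : ∑ j ∈ Finset.Icc 1 M, (j : ℝ) ^ e / j ≤ (M : ℝ) ^ e := by
      obtain ⟨n, rfl⟩ : ∃ n, e = n + 1 := ⟨e - 1, by omega⟩
      calc ∑ j ∈ Finset.Icc 1 M, (j : ℝ) ^ (n + 1) / j
          ≤ ∑ j ∈ Finset.Icc 1 M, (M : ℝ) ^ n := by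
            refine Finset.sum_le_sum fun j hj => ?_
            rw [Finset.mem_Icc] at hj
            have hj0 : (0 : ℝ) < j := by exact_mod_cast hj.1
            rw [pow_succ, mul_div_assoc, div_self hj0.ne', mul_one]
            have : (j : ℝ) ≤ M := by exact_mod_cast hj.2
            gcongr
        _ = (M : ℝ) ^ (n + 1) := by
            rw [Finset.sum_const, Nat.card_Icc, nsmul_eq_mul, Nat.add_sub_cancel]
            ring
    have h3 : (0 : ℝ) ≤ 3 ^ (e + 2) := by positivity
    nlinarith
  · intro B hB
    rw [Finset.mem_erase] at hB
    exact ⟨one_le_boxNorm hB.1, boxNorm_le_iff.mpr hB.2⟩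
  · intro j hj
    have hsub : (((intBox (e + 2) M).erase 0).filter fun B => boxNorm B ≤ j) ⊆
        intBox (e + 2) j := by
      intro B hB
      exact boxNorm_le_iff.mp (Finset.mem_filter.mp hB).2
    calc ((((intBox (e + 2) M).erase 0).filter fun B => boxNorm B ≤ j).card : ℝ)
        ≤ ((intBox (e + 2) j).card : ℝ) := by exact_mod_cast Finset.card_le_card hsub
      _ ≤ (3 * j) ^ (e + 2) := card_intBox_le hj
      _ = 3 ^ (e + 2) * (j : ℝ) ^ (e + 2) := mul_pow _ _ _

lemma add_sq_le_two (a b : ℝ) : (a + b) ^ 2 ≤ 2 * (a ^ 2 + b ^ 2) := by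
  nlinarith [sq_nonneg (a - b)]

/-- The second moment bound that is sharp for thick slabs. -/
lemma slabEnergy_le_thick {e M T : ℕ} (he : 1 ≤ e) (hM : 1 ≤ M) :
    (slabEnergy (e + 2) M T : ℝ) ≤
      100 * 27 ^ (e + 2) * ((M : ℝ) ^ (3 * e + 4) + (M : ℝ) ^ (3 * e + 2) * T ^ 2) := by
  have hM1 : (1 : ℝ) ≤ M := by exact_mod_cast hM
  have h0 : (slabCount (e + 2) M T 0 : ℝ) ^ 2 ≤ 27 ^ (e + 2) * (M : ℝ) ^ (3 * e + 4) := by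
    calc (slabCount (e + 2) M T 0 : ℝ) ^ 2 ≤ ((3 * M) ^ (e + 2)) ^ 2 := by
          gcongr; exact slabCount_le_all hM 0
      _ = 9 ^ (e + 2) * (M : ℝ) ^ (2 * e + 4) := by
          rw [← pow_mul, mul_pow, mul_comm (e + 2) 2, pow_mul 3 2]; norm_num; ring
      _ ≤ 27 ^ (e + 2) * (M : ℝ) ^ (3 * e + 4) := by
          gcongr
          · norm_num
          · omega
  have h1 : ∑ B ∈ (intBox (e + 2) M).erase 0, (slabCount (e + 2) M T B : ℝ) ^ 2 ≤
      ((3 * M) ^ (e + 1)) ^ 2 * (8 * T ^ 2 * (7 * 3 ^ (e + 2) * (M : ℝ) ^ e) +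
        2 * (3 * M) ^ (e + 2)) := by
    calc ∑ B ∈ (intBox (e + 2) M).erase 0, (slabCount (e + 2) M T B : ℝ) ^ 2
        ≤ ∑ B ∈ (intBox (e + 2) M).erase 0, ((3 * M) ^ (e + 1)) ^ 2 *
            (8 * T ^ 2 * ((1 : ℝ) / (boxNorm B : ℝ) ^ 2) + 2) := by
          refine Finset.sum_le_sum fun B hB => ?_
          calc (slabCount (e + 2) M T B : ℝ) ^ 2
              ≤ ((2 * T / boxNorm B + 1 : ℝ) * (3 * M) ^ (e + 1)) ^ 2 := by
                gcongr; exact slabCount_le_boxNorm hM (Finset.mem_erase.mp hB).1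
            _ = ((3 * M) ^ (e + 1)) ^ 2 * (2 * T / boxNorm B + 1 : ℝ) ^ 2 := by ring
            _ ≤ ((3 * M) ^ (e + 1)) ^ 2 * (2 * ((2 * T / boxNorm B : ℝ) ^ 2 + 1 ^ 2)) := by
                gcongr; exact add_sq_le_two _ _
            _ = _ := by ring
      _ = ((3 * M) ^ (e + 1)) ^ 2 * (8 * T ^ 2 *
            (∑ B ∈ (intBox (e + 2) M).erase 0, (1 : ℝ) / (boxNorm B : ℝ) ^ 2) +
            2 * (((intBox (e + 2) M).erase 0).card : ℝ)) := by
          rw [← Finset.mul_sum, Finset.sum_add_distrib, ← Finset.mul_sum, Finset.sum_const,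
            nsmul_eq_mul]
          ring
      _ ≤ _ := by
          gcongr
          · exact sum_boxNorm_le he hM
          · exact le_trans (by exact_mod_cast Finset.card_erase_le) (card_intBox_le hM)
  have h2 : (slabEnergy (e + 2) M T : ℝ) = (slabCount (e + 2) M T 0 : ℝ) ^ 2 +
      ∑ B ∈ (intBox (e + 2) M).erase 0, (slabCount (e + 2) M T B : ℝ) ^ 2 := by
    rw [Finset.add_sum_erase _ (fun B => (slabCount (e + 2) M T B : ℝ) ^ 2) zero_mem_intBox,
      slabEnergy]
    push_cast; rfl
  rw [h2]
  have h3 : ((3 * M) ^ (e + 1)) ^ 2 * (8 * T ^ 2 * (7 * 3 ^ (e + 2) * (M : ℝ) ^ e) +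
        2 * (3 * M) ^ (e + 2)) = 27 ^ (e + 2) * (56 / 9 * ((M : ℝ) ^ (3 * e + 2) * T ^ 2) +
        2 / 9 * (M : ℝ) ^ (3 * e + 4)) := by
    have : (27 : ℝ) ^ (e + 2) = (3 ^ (e + 2)) ^ 3 := by
      rw [← pow_mul, mul_comm, pow_mul]; norm_num
    rw [this]
    ring
  rw [h3] at h1
  have h4 : (0 : ℝ) ≤ 27 ^ (e + 2) * (M : ℝ) ^ (3 * e + 4) := by positivity
  have h5 : (0 : ℝ) ≤ 27 ^ (e + 2) * ((M : ℝ) ^ (3 * e + 2) * T ^ 2) := by positivity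
  nlinarith

lemma card_filter_pair_le {d M : ℕ} (hM : 1 ≤ M) {i j : Fin (d + 2)} (hij : i ≠ j) (z : ℤ × ℤ) :
    (((intBox (d + 2) M).filter fun B => (B i, B j) = z).card : ℝ) ≤ (3 * M) ^ d := by
  classical
  have hcard : Fintype.card {l : Fin (d + 2) // l ≠ i ∧ l ≠ j} = d := by
    rw [Fintype.card_subtype]
    have : (Finset.univ.filter fun l : Fin (d + 2) => l ≠ i ∧ l ≠ j) = {i, j}ᶜ := by
      ext l; simp
    rw [this, Finset.card_compl, Finset.card_pair hij, Fintype.card_fin]; omega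
  have h := card_restrict_fiber M (fun l => l ≠ i ∧ l ≠ j)
    ((intBox (d + 2) M).filter fun B => (B i, B j) = z) (Finset.filter_subset _ _) 1 ?_
  · rw [hcard, one_mul] at h
    calc _ ≤ (2 * M + 1 : ℝ) ^ d := by exact_mod_cast h
      _ ≤ _ := by gcongr; exact two_mul_add_one_le hM
  intro X₀ _
  rw [Finset.card_le_one]
  intro X hX Y hY
  simp only [Finset.mem_filter] at hX hY
  obtain ⟨⟨_, hXz⟩, hXr⟩ := hX
  obtain ⟨⟨_, hYz⟩, hYr⟩ := hY
  rw [← hYz] at hXz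
  simp only [Prod.mk.injEq] at hXz
  funext l
  by_cases hl : l = i
  · subst hl; exact hXz.1
  by_cases hl' : l = j
  · subst hl'; exact hXz.2
  rw [hXr l ⟨hl, hl'⟩, hYr l ⟨hl, hl'⟩]

lemma sum_slabCount_pair_le {e M T : ℕ} (hM : 1 ≤ M) {i j : Fin (e + 2)} (hij : i ≠ j) :
    ∑ B ∈ (intBox (e + 2) M).filter (fun B => (B i, B j) ≠ 0),
        (slabCount (e + 2) M T B : ℝ) ^ 2 ≤
      4536 * 27 ^ e * ((M : ℝ) ^ (3 * e + 2) * (M + T ^ 2) * (1 + Real.log M)) := by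
  classical
  set F : ℤ × ℤ → ℝ := fun z => 18 * M ^ 2 * ((3 * M) ^ e) ^ 2 *
    ((Int.gcd z.1 z.2 : ℝ) ^ 2 / (pairNorm z : ℝ) ^ 2 +
      4 * T ^ 2 * (1 / (pairNorm z : ℝ) ^ 2)) with hF
  have hF0 : ∀ z, 0 ≤ F z := fun z => by simp only [hF]; positivity
  calc ∑ B ∈ (intBox (e + 2) M).filter (fun B => (B i, B j) ≠ 0),
        (slabCount (e + 2) M T B : ℝ) ^ 2
      ≤ ∑ B ∈ (intBox (e + 2) M).filter (fun B => (B i, B j) ≠ 0), F (B i, B j) := by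
        refine Finset.sum_le_sum fun B hB => ?_
        obtain ⟨hB, h0⟩ := Finset.mem_filter.mp hB
        have hN : (0 : ℝ) < pairNorm (B i, B j) := by exact_mod_cast pairNorm_pos h0
        calc (slabCount (e + 2) M T B : ℝ) ^ 2
            ≤ (3 * M * (Int.gcd (B i) (B j) + 2 * T) / pairNorm (B i, B j) *
                (3 * M) ^ e) ^ 2 := by
              gcongr
              refine (slabCount_le_pair hij hB h0).trans ?_
              rw [Nat.add_sub_cancel]
              gcongr
              exact two_mul_add_one_le hM
          _ = 9 * M ^ 2 * ((3 * M) ^ e) ^ 2 / (pairNorm (B i, B j) : ℝ) ^ 2 *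
                (Int.gcd (B i) (B j) + 2 * T) ^ 2 := by ring
          _ ≤ 9 * M ^ 2 * ((3 * M) ^ e) ^ 2 / (pairNorm (B i, B j) : ℝ) ^ 2 *
                (2 * ((Int.gcd (B i) (B j) : ℝ) ^ 2 + (2 * T) ^ 2)) := by
              gcongr; exact add_sq_le_two _ _
          _ = F (B i, B j) := by simp only [hF]; ring
    _ = ∑ z ∈ pairBox M, ∑ B ∈ ((intBox (e + 2) M).filter (fun B => (B i, B j) ≠ 0)).filter
          (fun B => (B i, B j) = z), F (B i, B j) := by
        refine (Finset.sum_fiberwise_of_maps_to (fun B hB => ?_) _).symm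
        obtain ⟨hB, h0⟩ := Finset.mem_filter.mp hB
        exact mem_pairBox.mpr ⟨h0, mem_intBox.mp hB i, mem_intBox.mp hB j⟩
    _ ≤ ∑ z ∈ pairBox M, (3 * M) ^ e * F z := by
        refine Finset.sum_le_sum fun z _ => ?_
        rw [Finset.sum_congr rfl (g := fun _ => F z)
          (fun B hB => by rw [(Finset.mem_filter.mp hB).2]), Finset.sum_const, nsmul_eq_mul]
        refine mul_le_mul_of_nonneg_right ?_ (hF0 z)
        refine le_trans ?_ (card_filter_pair_le hM hij z)
        rw [Finset.filter_filter]
        refine Nat.cast_le.mpr (Finset.card_le_card fun B hB => ?_)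
        rw [Finset.mem_filter] at hB ⊢
        exact ⟨hB.1, hB.2.2⟩
    _ = (3 * M) ^ e * (18 * M ^ 2 * ((3 * M) ^ e) ^ 2 *
          ((∑ z ∈ pairBox M, (Int.gcd z.1 z.2 : ℝ) ^ 2 / (pairNorm z : ℝ) ^ 2) +
            4 * T ^ 2 * ∑ z ∈ pairBox M, 1 / (pairNorm z : ℝ) ^ 2)) := by
        simp only [hF]
        rw [← Finset.mul_sum, ← Finset.mul_sum, Finset.sum_add_distrib, ← Finset.mul_sum]
    _ ≤ (3 * M) ^ e * (18 * M ^ 2 * ((3 * M) ^ e) ^ 2 *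
          (63 * M * (1 + Real.log M) + 4 * T ^ 2 * (63 * (1 + Real.log M)))) := by
        gcongr
        · exact sum_gcd_sq_pairBox_le hM
        · exact sum_pairBox_le hM
    _ = 27 ^ e * (18 * (M : ℝ) ^ (3 * e + 2) *
          (63 * M * (1 + Real.log M) + 4 * T ^ 2 * (63 * (1 + Real.log M)))) := by
        have : (27 : ℝ) ^ e = (3 ^ e) ^ 3 := by
          rw [← pow_mul, mul_comm, pow_mul]; norm_num
        rw [this]
        ring
    _ ≤ 27 ^ e * (18 * (M : ℝ) ^ (3 * e + 2) * (252 * ((M + T ^ 2) * (1 + Real.log M)))) := by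
        have : 0 ≤ Real.log M := Real.log_natCast_nonneg M
        have : (0 : ℝ) ≤ M * (1 + Real.log M) := by positivity
        gcongr
        nlinarith
    _ = 4536 * 27 ^ e * ((M : ℝ) ^ (3 * e + 2) * (M + T ^ 2) * (1 + Real.log M)) := by ring

/-- The second moment bound for thin slabs. -/
lemma slabEnergy_le_thin {e M T : ℕ} (he : 1 ≤ e) (hM : 1 ≤ M) (hT : 1 ≤ T) :
    (slabEnergy (e + 2) M T : ℝ) ≤
      5000 * 27 ^ e * ((M : ℝ) ^ (3 * e + 2) * (M + T ^ 2) * (1 + Real.log M)) := by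
  classical
  have hM1 : (1 : ℝ) ≤ M := by exact_mod_cast hM
  have hT1 : (1 : ℝ) ≤ T := by exact_mod_cast hT
  set i : Fin (e + 2) := 0
  set j : Fin (e + 2) := 1
  have hij : i ≠ j := by simp [i, j]
  have h27 : (27 : ℝ) ^ e = (3 ^ e) ^ 3 := by
    rw [← pow_mul, mul_comm, pow_mul]; norm_num
  have h3e : (1 : ℝ) ≤ 3 ^ e := one_le_pow₀ (by norm_num)
  have hz : ∑ B ∈ (intBox (e + 2) M).filter (fun B => (B i, B j) = 0),
      (slabCount (e + 2) M T B : ℝ) ^ 2 ≤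
      162 * 27 ^ e * ((M : ℝ) ^ (3 * e + 2) * (M + T ^ 2)) := by
    have h0 : ∀ B ∈ (intBox (e + 2) M).filter (fun B => (B i, B j) = 0),
        (slabCount (e + 2) M T B : ℝ) ^ 2 ≤ (if B = 0 then ((3 * M : ℝ) ^ (e + 2)) ^ 2 else 0) +
          (3 * T * (3 * M) ^ (e + 1)) ^ 2 := by
      intro B _
      split_ifs with hB
      · have : (slabCount (e + 2) M T B : ℝ) ^ 2 ≤ ((3 * M : ℝ) ^ (e + 2)) ^ 2 := by
          gcongr; exact slabCount_le_all hM B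
        have : 0 ≤ (3 * T * (3 * M : ℝ) ^ (e + 1)) ^ 2 := by positivity
        linarith
      · rw [zero_add]
        gcongr
        refine (slabCount_le_boxNorm hM hB).trans ?_
        gcongr
        have hN : (1 : ℝ) ≤ boxNorm B := by exact_mod_cast one_le_boxNorm hB
        have : 2 * (T : ℝ) / boxNorm B ≤ 2 * T := div_le_self (by positivity) hN
        linarith
    refine (Finset.sum_le_sum h0).trans ?_
    rw [Finset.sum_add_distrib, Finset.sum_const, nsmul_eq_mul, ← Finset.sum_filter,
      Finset.sum_const, nsmul_eq_mul]
    have hc1 : ((((intBox (e + 2) M).filter (fun B => (B i, B j) = 0)).filter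
        (fun B => B = 0)).card : ℝ) ≤ 1 := by
      have : (((intBox (e + 2) M).filter (fun B => (B i, B j) = 0)).filter
        (fun B => B = 0)).card ≤ 1 := by
        rw [Finset.card_le_one]
        intro a ha b hb
        rw [(Finset.mem_filter.mp ha).2, (Finset.mem_filter.mp hb).2]
      exact_mod_cast this
    have hc2 := card_filter_pair_le hM hij 0
    calc _ ≤ 1 * ((3 * M : ℝ) ^ (e + 2)) ^ 2 +
          (3 * M) ^ e * (3 * T * (3 * M) ^ (e + 1)) ^ 2 := by gcongr
      _ = 81 * (3 ^ e) ^ 2 * (M : ℝ) ^ (2 * e + 4) +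
          81 * (3 ^ e) ^ 3 * ((M : ℝ) ^ (3 * e + 2) * T ^ 2) := by ring
      _ ≤ 81 * (3 ^ e) ^ 3 * (M : ℝ) ^ (3 * e + 3) +
          81 * (3 ^ e) ^ 3 * ((M : ℝ) ^ (3 * e + 2) * T ^ 2) := by
          have h1 : ((3 : ℝ) ^ e) ^ 2 ≤ (3 ^ e) ^ 3 := pow_le_pow_right₀ h3e (by norm_num)
          have h2 : (M : ℝ) ^ (2 * e + 4) ≤ (M : ℝ) ^ (3 * e + 3) :=
            pow_le_pow_right₀ hM1 (by omega)
          gcongr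
      _ ≤ _ := by
          rw [← h27, pow_succ (M : ℝ) (3 * e + 2)]
          have : (0 : ℝ) ≤ 27 ^ e * ((M : ℝ) ^ (3 * e + 2) * M) := by positivity
          have : (0 : ℝ) ≤ 27 ^ e * ((M : ℝ) ^ (3 * e + 2) * T ^ 2) := by positivity
          nlinarith
  have hsplit : (slabEnergy (e + 2) M T : ℝ) =
      ∑ B ∈ (intBox (e + 2) M).filter (fun B => (B i, B j) = 0),
        (slabCount (e + 2) M T B : ℝ) ^ 2 +
      ∑ B ∈ (intBox (e + 2) M).filter (fun B => (B i, B j) ≠ 0),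
        (slabCount (e + 2) M T B : ℝ) ^ 2 := by
    rw [Finset.sum_filter_add_sum_filter_not, slabEnergy]
    push_cast; rfl
  have hp := sum_slabCount_pair_le (T := T) hM hij
  have hlog : 0 ≤ Real.log M := Real.log_natCast_nonneg M
  have hX : (0 : ℝ) ≤ 27 ^ e * ((M : ℝ) ^ (3 * e + 2) * (M + T ^ 2)) := by positivity
  rw [hsplit]
  have hXl := mul_nonneg hX hlog
  nlinarith

lemma card_filter_dot_le {d M T : ℕ} (P : Finset (Fin d → ℤ)) (B : Fin d → ℤ)
    (hP : ∀ A ∈ P, ∀ A' ∈ P, ∀ i, |A i - A' i| ≤ (M : ℤ)) :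
    (P.filter fun A => |A ⬝ᵥ B| ≤ (T : ℤ)).card ≤ slabCount d M (2 * T) B := by
  rcases (P.filter fun A => |A ⬝ᵥ B| ≤ (T : ℤ)).eq_empty_or_nonempty with h | ⟨A₀, hA₀⟩
  · rw [h]; simp
  · rw [Finset.mem_filter] at hA₀
    refine Finset.card_le_card_of_injOn (fun A => A - A₀) ?_ ?_
    · intro A hA
      rw [Finset.mem_coe, Finset.mem_filter] at hA
      rw [Finset.mem_coe, Finset.mem_filter, mem_intBox]
      refine ⟨fun i => hP A hA.1 A₀ hA₀.1 i, ?_⟩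
      rw [sub_dotProduct]
      have := abs_sub (A ⬝ᵥ B) (A₀ ⬝ᵥ B)
      have := hA.2
      have := hA₀.2
      push_cast
      linarith
    · intro A _ A' _ h
      exact sub_left_injective h

/-- Triples `(A, A', C)` in translated cubes, where for fixed `(A, A')` the points `C` lie in a
translate of the intersection of the slabs of `A` and `A'`. -/
lemma card_le_slabEnergy {d M T : ℕ} (Q : Finset ((Fin d → ℤ) × (Fin d → ℤ) × (Fin d → ℤ)))
    (h₁ : ∀ q ∈ Q, ∀ q' ∈ Q, ∀ i, |q.1 i - q'.1 i| ≤ (M : ℤ))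
    (h₂ : ∀ q ∈ Q, ∀ q' ∈ Q, ∀ i, |q.2.1 i - q'.2.1 i| ≤ (M : ℤ))
    (h₃ : ∀ q ∈ Q, ∀ q' ∈ Q, ∀ i, |q.2.2 i - q'.2.2 i| ≤ (M : ℤ))
    (hA : ∀ q ∈ Q, ∀ q' ∈ Q, q.1 = q'.1 → |q.1 ⬝ᵥ (q.2.2 - q'.2.2)| ≤ (T : ℤ))
    (hA' : ∀ q ∈ Q, ∀ q' ∈ Q, q.2.1 = q'.2.1 → |q.2.1 ⬝ᵥ (q.2.2 - q'.2.2)| ≤ (T : ℤ)) :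
    Q.card ≤ slabEnergy d M (2 * T) := by
  classical
  obtain ⟨r, hr⟩ : ∃ r : (Fin d → ℤ) → (Fin d → ℤ) → (Fin d → ℤ),
      ∀ q ∈ Q, (q.1, q.2.1, r q.1 q.2.1) ∈ Q := by
    refine ⟨fun A A' => if h : ∃ c, (A, A', c) ∈ Q then h.choose else 0, fun q hq => ?_⟩
    have h : ∃ c, (q.1, q.2.1, c) ∈ Q := ⟨q.2.2, hq⟩
    simp only [dif_pos h]
    exact h.choose_spec
  have hP : ∃ P : Finset (Fin d → ℤ), ∀ A, A ∈ P ↔ ∃ q ∈ Q, q.1 = A :=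
    ⟨Q.image fun q => q.1, fun A => Finset.mem_image⟩
  have hP' : ∃ P : Finset (Fin d → ℤ), ∀ A, A ∈ P ↔ ∃ q ∈ Q, q.2.1 = A :=
    ⟨Q.image fun q => q.2.1, fun A => Finset.mem_image⟩
  obtain ⟨P, hP⟩ := hP
  obtain ⟨P', hP'⟩ := hP'
  have hmaps : ∀ q ∈ Q, q.2.2 - r q.1 q.2.1 ∈ intBox d M := fun q hq =>
    mem_intBox.mpr (h₃ q hq _ (hr q hq))
  rw [Finset.card_eq_sum_card_fiberwise hmaps, slabEnergy]
  refine Finset.sum_le_sum fun B _ => ?_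
  have hfib : (Q.filter fun q => q.2.2 - r q.1 q.2.1 = B).card ≤
      ((P.filter fun A => |A ⬝ᵥ B| ≤ (T : ℤ)) ×ˢ (P'.filter fun A => |A ⬝ᵥ B| ≤ (T : ℤ))).card := by
    refine Finset.card_le_card_of_injOn (fun q => (q.1, q.2.1)) ?_ ?_
    · intro q hq
      obtain ⟨hq, hB⟩ := Finset.mem_filter.mp (Finset.mem_coe.mp hq)
      have h1 := hA q hq _ (hr q hq) rfl
      have h2 := hA' q hq _ (hr q hq) rfl
      dsimp only at h1 h2
      rw [hB] at h1 h2
      exact Finset.mem_coe.mpr (Finset.mem_product.mpr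
        ⟨Finset.mem_filter.mpr ⟨(hP _).mpr ⟨q, hq, rfl⟩, h1⟩,
          Finset.mem_filter.mpr ⟨(hP' _).mpr ⟨q, hq, rfl⟩, h2⟩⟩)
    · rintro ⟨A, A', c⟩ hx ⟨D, D', c'⟩ hy h
      have hx := (Finset.mem_filter.mp (Finset.mem_coe.mp hx)).2
      have hy := (Finset.mem_filter.mp (Finset.mem_coe.mp hy)).2
      obtain ⟨h1, h2⟩ := Prod.mk.inj h
      dsimp only at h1 h2 hx hy
      subst h1 h2
      rw [sub_left_injective (hx.trans hy.symm)]
  refine hfib.trans ?_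
  rw [Finset.card_product, sq]
  refine Nat.mul_le_mul (card_filter_dot_le P B ?_) (card_filter_dot_le P' B ?_)
  · intro A hA A' hA' i
    obtain ⟨q, hq, rfl⟩ := (hP A).mp hA
    obtain ⟨q', hq', rfl⟩ := (hP A').mp hA'
    exact h₁ q hq q' hq' i
  · intro A hA A' hA' i
    obtain ⟨q, hq, rfl⟩ := (hP' A).mp hA
    obtain ⟨q', hq', rfl⟩ := (hP' A').mp hA'
    exact h₂ q hq q' hq' i

/-- The integer coordinates of a point of `ZLat d L`. -/
def latCoord {d : ℕ} (L : ℝ) (x : EuclideanSpace ℝ (Fin d)) : Fin d → ℤ := fun i => round (L * x i)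

lemma latCoord_cast {d : ℕ} {L : ℝ} (hL : L ≠ 0) {x : EuclideanSpace ℝ (Fin d)}
    (hx : x ∈ ZLat d L) (i : Fin d) : (latCoord L x i : ℝ) = L * x i := by
  obtain ⟨m, hm⟩ := hx i
  have : L * x i = m := by rw [hm]; field_simp
  rw [latCoord, this, round_intCast]

lemma latCoord_injOn {d : ℕ} {L : ℝ} (hL : L ≠ 0) {x y : EuclideanSpace ℝ (Fin d)}
    (hx : x ∈ ZLat d L) (hy : y ∈ ZLat d L) (h : latCoord L x = latCoord L y) : x = y := by
  ext i
  have h1 := latCoord_cast hL hx i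
  rw [h, latCoord_cast hL hy i] at h1
  exact (mul_left_cancel₀ hL h1).symm

lemma latCoord_dot {d : ℕ} {L : ℝ} (hL : L ≠ 0) {x y z : EuclideanSpace ℝ (Fin d)}
    (hx : x ∈ ZLat d L) (hy : y ∈ ZLat d L) (hz : z ∈ ZLat d L) :
    ((latCoord L x ⬝ᵥ (latCoord L y - latCoord L z) : ℤ) : ℝ) = L ^ 2 * inner ℝ x (y - z) := by
  rw [PiLp.inner_apply, Finset.mul_sum, dotProduct]
  push_cast
  refine Finset.sum_congr rfl fun i _ => ?_
  simp only [Pi.sub_apply, Int.cast_sub, latCoord_cast hL hx, latCoord_cast hL hy,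
    latCoord_cast hL hz, PiLp.sub_apply, RCLike.inner_apply, conj_trivial]
  ring

lemma abs_latCoord_sub_le {d M : ℕ} {L : ℝ} (hL : 0 < L) (hM : 2 * L ≤ M)
    {x y : EuclideanSpace ℝ (Fin d)} (hx : x ∈ ZLat d L) (hy : y ∈ ZLat d L)
    (h : ‖x - y‖ ≤ 2) (i : Fin d) : |latCoord L x i - latCoord L y i| ≤ (M : ℤ) := by
  have h1 : |x i - y i| ≤ 2 := (PiLp.norm_apply_le (x - y) i).trans h
  have : |((latCoord L x i - latCoord L y i : ℤ) : ℝ)| ≤ M := by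
    push_cast
    rw [latCoord_cast hL.ne' hx, latCoord_cast hL.ne' hy, ← mul_sub, abs_mul, abs_of_pos hL]
    nlinarith
  exact_mod_cast this

lemma signed_sub_mem_ZLat {d : ℕ} {L s t : ℝ} (hs : s = 1 ∨ s = -1) (ht : t = 1 ∨ t = -1)
    {x y : EuclideanSpace ℝ (Fin d)} (hx : x ∈ ZLat d L) (hy : y ∈ ZLat d L) :
    s • x - t • y ∈ ZLat d L := by
  intro i
  obtain ⟨m, hm⟩ := hx i
  obtain ⟨n, hn⟩ := hy i
  obtain ⟨σ, rfl⟩ : ∃ σ : ℤ, s = σ := by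
    rcases hs with rfl | rfl
    · exact ⟨1, by simp⟩
    · exact ⟨-1, by simp⟩
  obtain ⟨τ, rfl⟩ : ∃ τ : ℤ, t = τ := by
    rcases ht with rfl | rfl
    · exact ⟨1, by simp⟩
    · exact ⟨-1, by simp⟩
  refine ⟨σ * m - τ * n, ?_⟩
  simp only [PiLp.sub_apply, PiLp.smul_apply, smul_eq_mul, hm, hn]
  push_cast
  ring

lemma norm_sub_le_two {E : Type*} [NormedAddCommGroup E] {x y z : E} (hx : ‖x - z‖ ≤ 1)
    (hy : ‖y - z‖ ≤ 1) : ‖x - y‖ ≤ 2 := by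
  have := norm_sub_le (x - z) (y - z)
  rw [sub_sub_sub_cancel_right] at this
  linarith

lemma abs_inner_le_of_quadratic {E : Type*} [NormedAddCommGroup E] [InnerProductSpace ℝ E]
    {s₁ s₂ β h : ℝ} (hs₁ : s₁ = 1 ∨ s₁ = -1) {k a b b' c c' : E}
    (hk : s₁ • c + s₂ • a + (-s₁) • b = k) (hk' : s₁ • c' + s₂ • a + (-s₁) • b' = k)
    (hq : |s₁ * ‖c‖ ^ 2 + s₂ * ‖a‖ ^ 2 + -s₁ * ‖b‖ ^ 2 - β| ≤ h)
    (hq' : |s₁ * ‖c'‖ ^ 2 + s₂ * ‖a‖ ^ 2 + -s₁ * ‖b'‖ ^ 2 - β| ≤ h) :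
    |inner ℝ (s₁ • k - (s₁ * s₂) • a) (c - c')| ≤ h := by
  have hss : s₁ * s₁ = 1 := by rcases hs₁ with rfl | rfl <;> norm_num
  set v := s₁ • k - (s₁ * s₂) • a with hv
  have hb : b = c - v := by
    rw [hv, ← hk]
    simp only [smul_add, smul_smul, mul_neg, hss]
    module
  have hb' : b' = c' - v := by
    rw [hv, ← hk']
    simp only [smul_add, smul_smul, mul_neg, hss]
    module
  rw [hb, norm_sub_sq_real] at hq
  rw [hb', norm_sub_sq_real] at hq'
  rw [inner_sub_right, real_inner_comm c v, real_inner_comm c' v]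
  rw [abs_le] at *
  rcases hs₁ with rfl | rfl
  · constructor <;> linarith [hq.1, hq.2, hq'.1, hq'.2]
  · constructor <;> linarith [hq.1, hq.2, hq'.1, hq'.2]

/-- A family of lattice triples `(c, a, b)` in unit balls satisfying the linear and the
quadratic constraint with signs `(s₁, s₂, s₃)`. -/
def IsResonantFamily {α : Type*} (d : ℕ) (L s₁ s₂ s₃ β h : ℝ) (k a₀ b₀ : EuclideanSpace ℝ (Fin d))
    (Q : Set α) (c a b : α → EuclideanSpace ℝ (Fin d)) : Prop :=
  ∀ q ∈ Q, c q ∈ ZLat d L ∧ a q ∈ ZLat d L ∧ b q ∈ ZLat d L ∧ ‖a q - a₀‖ ≤ 1 ∧ ‖b q - b₀‖ ≤ 1 ∧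
    s₁ • c q + s₂ • a q + s₃ • b q = k ∧
    |s₁ * ‖c q‖ ^ 2 + s₂ * ‖a q‖ ^ 2 + s₃ * ‖b q‖ ^ 2 - β| ≤ h

section Linearize

variable {α : Type*} {d M T : ℕ} {L s₁ s₂ s₃ β h : ℝ} {k a₀ b₀ : EuclideanSpace ℝ (Fin d)}
  {Q : Set α} {c a b : α → EuclideanSpace ℝ (Fin d)}

lemma IsResonantFamily.swap (H : IsResonantFamily d L s₁ s₂ s₃ β h k a₀ b₀ Q c a b) :
    IsResonantFamily d L s₁ s₃ s₂ β h k b₀ a₀ Q c b a := by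
  intro q hq
  obtain ⟨h1, h2, h3, h4, h5, h6, h7⟩ := H q hq
  refine ⟨h1, h3, h2, h5, h4, ?_, ?_⟩
  · rw [← h6]; abel
  · rwa [add_right_comm]

lemma IsResonantFamily.linearize_aux (hL : 0 < L) (hM : 2 * L ≤ M) (hT : h * L ^ 2 ≤ T)
    (hs₁ : s₁ = 1 ∨ s₁ = -1) (hs₂ : s₂ = 1 ∨ s₂ = -1) (hs₃ : s₃ = -s₁) (hk : k ∈ ZLat d L)
    (H : IsResonantFamily d L s₁ s₂ s₃ β h k a₀ b₀ Q c a b) :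
    ∃ A : α → Fin d → ℤ,
      (∀ q ∈ Q, ∀ q' ∈ Q, ∀ i, |A q i - A q' i| ≤ (M : ℤ)) ∧
      (∀ q ∈ Q, ∀ q' ∈ Q, A q = A q' →
        |A q ⬝ᵥ (latCoord L (c q) - latCoord L (c q'))| ≤ (T : ℤ)) ∧
      (∀ q ∈ Q, ∀ q' ∈ Q, A q = A q' → c q = c q' → a q = a q' ∧ b q = b q') := by
  subst hs₃
  have hs₁₂ : s₁ * s₂ = 1 ∨ s₁ * s₂ = -1 := by
    rcases hs₁ with rfl | rfl <;> rcases hs₂ with rfl | rfl <;> norm_num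
  have hs0 : s₁ ≠ 0 := by rcases hs₁ with rfl | rfl <;> norm_num
  have hs0' : s₁ * s₂ ≠ 0 := by rcases hs₁₂ with h | h <;> rw [h] <;> norm_num
  set v : α → EuclideanSpace ℝ (Fin d) := fun q => s₁ • k - (s₁ * s₂) • a q with hv
  have hvZ : ∀ q ∈ Q, v q ∈ ZLat d L := fun q hq =>
    signed_sub_mem_ZLat hs₁ hs₁₂ hk (H q hq).2.1
  have haa : ∀ q ∈ Q, ∀ q' ∈ Q, latCoord L (v q) = latCoord L (v q') → a q = a q' := by
    intro q hq q' hq' hqq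
    have := latCoord_injOn hL.ne' (hvZ q hq) (hvZ q' hq') hqq
    simp only [hv, sub_right_inj] at this
    exact smul_right_injective _ hs0' this
  refine ⟨fun q => latCoord L (v q), ?_, ?_, ?_⟩
  · intro q hq q' hq' i
    refine abs_latCoord_sub_le hL hM (hvZ q hq) (hvZ q' hq') ?_ i
    have h1 : v q - v q' = (s₁ * s₂) • (a q' - a q) := by
      simp only [hv]; module
    have h2 : ‖s₁ * s₂‖ = 1 := by rcases hs₁₂ with h | h <;> rw [h] <;> simp
    rw [h1, norm_smul, h2, one_mul]
    exact norm_sub_le_two (H q' hq').2.2.2.1 (H q hq).2.2.2.1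
  · intro q hq q' hq' hqq
    have ha := haa q hq q' hq' hqq
    obtain ⟨h1, -, -, -, -, h6, h7⟩ := H q hq
    obtain ⟨h1', -, -, -, -, h6', h7'⟩ := H q' hq'
    rw [← ha] at h6' h7'
    have h8 := abs_inner_le_of_quadratic hs₁ h6 h6' h7 h7'
    have h9 : |((latCoord L (v q) ⬝ᵥ (latCoord L (c q) - latCoord L (c q')) : ℤ) : ℝ)| ≤ T := by
      rw [latCoord_dot hL.ne' (hvZ q hq) h1 h1', abs_mul, abs_of_nonneg (sq_nonneg L)]
      refine le_trans ?_ hT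
      rw [mul_comm]
      exact mul_le_mul_of_nonneg_right h8 (sq_nonneg L)
    exact_mod_cast h9
  · intro q hq q' hq' hqq hc
    have ha := haa q hq q' hq' hqq
    refine ⟨ha, ?_⟩
    have h6 := (H q hq).2.2.2.2.2.1
    have h6' := (H q' hq').2.2.2.2.2.1
    rw [← ha, ← hc, ← h6, add_right_inj] at h6'
    exact smul_right_injective _ (neg_ne_zero.mpr hs0) h6'.symm

lemma IsResonantFamily.linearize (hL : 0 < L) (hM : 2 * L ≤ M) (hT : h * L ^ 2 ≤ T)
    (hs₁ : s₁ = 1 ∨ s₁ = -1) (hs₂ : s₂ = 1 ∨ s₂ = -1) (hs₃ : s₃ = 1 ∨ s₃ = -1)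
    (hne : ¬(s₁ = s₂ ∧ s₂ = s₃)) (hk : k ∈ ZLat d L)
    (H : IsResonantFamily d L s₁ s₂ s₃ β h k a₀ b₀ Q c a b) :
    ∃ A : α → Fin d → ℤ,
      (∀ q ∈ Q, ∀ q' ∈ Q, ∀ i, |A q i - A q' i| ≤ (M : ℤ)) ∧
      (∀ q ∈ Q, ∀ q' ∈ Q, A q = A q' →
        |A q ⬝ᵥ (latCoord L (c q) - latCoord L (c q'))| ≤ (T : ℤ)) ∧
      (∀ q ∈ Q, ∀ q' ∈ Q, A q = A q' → c q = c q' → a q = a q' ∧ b q = b q') := by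
  by_cases h13 : s₃ = -s₁
  · exact H.linearize_aux hL hM hT hs₁ hs₂ h13 hk
  · have h12 : s₂ = -s₁ := by
      rcases hs₁ with rfl | rfl <;> rcases hs₂ with rfl | rfl <;> rcases hs₃ with rfl | rfl <;>
        norm_num at *
    obtain ⟨A, h1, h2, h3⟩ := H.swap.linearize_aux hL hM hT hs₁ hs₃ h12 hk
    exact ⟨A, h1, h2, fun q hq q' hq' hA hc => (h3 q hq q' hq' hA hc).symm⟩

end Linearize

/-- Two resonant families sharing the vector `c` have at most `slabEnergy` members. -/
lemma ncard_le_slabEnergy {α : Type*} {d M T : ℕ} {L s₁ s₂ s₃ t₁ t₂ t₃ β β' h : ℝ}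
    {k k' c₀ a₀ b₀ a₀' b₀' : EuclideanSpace ℝ (Fin d)} {Q : Set α}
    {c a b a' b' : α → EuclideanSpace ℝ (Fin d)}
    (hL : 0 < L) (hM : 2 * L ≤ M) (hT : h * L ^ 2 ≤ T)
    (hs₁ : s₁ = 1 ∨ s₁ = -1) (hs₂ : s₂ = 1 ∨ s₂ = -1) (hs₃ : s₃ = 1 ∨ s₃ = -1)
    (hs : ¬(s₁ = s₂ ∧ s₂ = s₃))
    (ht₁ : t₁ = 1 ∨ t₁ = -1) (ht₂ : t₂ = 1 ∨ t₂ = -1) (ht₃ : t₃ = 1 ∨ t₃ = -1)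
    (ht : ¬(t₁ = t₂ ∧ t₂ = t₃)) (hk : k ∈ ZLat d L) (hk' : k' ∈ ZLat d L)
    (hc : ∀ q ∈ Q, ‖c q - c₀‖ ≤ 1)
    (H : IsResonantFamily d L s₁ s₂ s₃ β h k a₀ b₀ Q c a b)
    (H' : IsResonantFamily d L t₁ t₂ t₃ β' h k' a₀' b₀' Q c a' b')
    (hinj : Set.InjOn (fun q => (c q, a q, b q, a' q, b' q)) Q) :
    Q.ncard ≤ slabEnergy d M (2 * T) := by
  classical
  obtain ⟨A, hA1, hA2, hA3⟩ := H.linearize hL hM hT hs₁ hs₂ hs₃ hs hk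
  obtain ⟨A', hA1', hA2', hA3'⟩ := H'.linearize hL hM hT ht₁ ht₂ ht₃ ht hk'
  rcases Q.finite_or_infinite with hfin | hinf
  swap
  · rw [hinf.ncard]; exact Nat.zero_le _
  have hF : Set.InjOn (fun q => (A q, A' q, latCoord L (c q))) hfin.toFinset := by
    intro q hq q' hq' hqq
    rw [Finset.mem_coe, Set.Finite.mem_toFinset] at hq hq'
    simp only [Prod.mk.injEq] at hqq
    have hcc := latCoord_injOn hL.ne' (H q hq).1 (H q' hq').1 hqq.2.2
    obtain ⟨h1, h2⟩ := hA3 q hq q' hq' hqq.1 hcc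
    obtain ⟨h3, h4⟩ := hA3' q hq q' hq' hqq.2.1 hcc
    exact hinj hq hq' (by simp only [hcc, h1, h2, h3, h4])
  rw [Set.ncard_eq_toFinset_card Q hfin, ← Finset.card_image_of_injOn hF]
  have key : ∀ (p : ((Fin d → ℤ) × (Fin d → ℤ) × (Fin d → ℤ)) →
      ((Fin d → ℤ) × (Fin d → ℤ) × (Fin d → ℤ)) → Prop),
      (∀ q ∈ Q, ∀ q' ∈ Q, p (A q, A' q, latCoord L (c q)) (A q', A' q', latCoord L (c q'))) →
      ∀ x ∈ hfin.toFinset.image (fun q => (A q, A' q, latCoord L (c q))),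
      ∀ y ∈ hfin.toFinset.image (fun q => (A q, A' q, latCoord L (c q))), p x y := by
    intro p hp x hx y hy
    obtain ⟨q, hq, rfl⟩ := Finset.mem_image.mp hx
    obtain ⟨q', hq', rfl⟩ := Finset.mem_image.mp hy
    rw [Set.Finite.mem_toFinset] at hq hq'
    exact hp q hq q' hq'
  refine card_le_slabEnergy _ (key (fun x y => ∀ i, |x.1 i - y.1 i| ≤ (M : ℤ)) hA1)
    (key (fun x y => ∀ i, |x.2.1 i - y.2.1 i| ≤ (M : ℤ)) hA1')
    (key (fun x y => ∀ i, |x.2.2 i - y.2.2 i| ≤ (M : ℤ)) ?_)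
    (key (fun x y => x.1 = y.1 → |x.1 ⬝ᵥ (x.2.2 - y.2.2)| ≤ (T : ℤ)) hA2)
    (key (fun x y => x.2.1 = y.2.1 → |x.2.1 ⬝ᵥ (x.2.2 - y.2.2)| ≤ (T : ℤ)) hA2')
  intro q hq q' hq' i
  exact abs_latCoord_sub_le hL hM (H q hq).1 (H q' hq').1
    (norm_sub_le_two (hc q hq) (hc q' hq')) i

section Exponents

variable {d M T : ℕ} {L δ γ η : ℝ}

lemma sq_inv_mul_rpow (hL : 0 < L) :
    (δ⁻¹ * L ^ (2 - 2 * γ)) ^ 2 = δ⁻¹ ^ 2 * L ^ (4 - 4 * γ) := by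
  rw [mul_pow, ← Real.rpow_natCast (L ^ (2 - 2 * γ)), ← Real.rpow_mul hL.le]
  congr 2
  push_cast
  ring

lemma slabEnergy_le_rpow_thick (hd : 3 ≤ d) (hγ : γ ≤ 1 / 2) (hL : 1 ≤ L) (hδ : 0 < δ)
    (hδ' : δ < 1) (hM : 1 ≤ M) (hML : M ≤ 3 * L) (hT : T ≤ 6 * (δ⁻¹ * L ^ (2 - 2 * γ))) :
    (slabEnergy d M T : ℝ) ≤ 3700 * 27 ^ d * 27 ^ d * δ⁻¹ ^ 2 * L ^ (3 * (d : ℝ) - 4 * γ) := by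
  obtain ⟨e, rfl⟩ : ∃ e, d = e + 2 := ⟨d - 2, by omega⟩
  have hL0 : 0 < L := by linarith
  have hδ1 : 1 ≤ δ⁻¹ ^ 2 := one_le_pow₀ (one_le_inv_iff₀.mpr ⟨hδ, hδ'.le⟩)
  have hT2 : (T : ℝ) ^ 2 ≤ 36 * (δ⁻¹ ^ 2 * L ^ (4 - 4 * γ)) := by
    rw [← sq_inv_mul_rpow hL0]
    calc (T : ℝ) ^ 2 ≤ (6 * (δ⁻¹ * L ^ (2 - 2 * γ))) ^ 2 := by gcongr
      _ = _ := by ring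
  have h1 : (M : ℝ) ^ (3 * e + 4) ≤
      27 ^ (e + 2) * (δ⁻¹ ^ 2 * L ^ (3 * ((e + 2 : ℕ) : ℝ) - 4 * γ)) := by
    calc (M : ℝ) ^ (3 * e + 4) ≤ (3 * L) ^ (3 * e + 4) := by gcongr
      _ = 3 ^ (3 * e + 4) * L ^ (3 * e + 4) := by rw [mul_pow]
      _ ≤ 27 ^ (e + 2) * (1 * L ^ (3 * ((e + 2 : ℕ) : ℝ) - 4 * γ)) := by
        rw [one_mul]
        gcongr ?_ * ?_
        · calc (3 : ℝ) ^ (3 * e + 4) ≤ 3 ^ (3 * (e + 2)) :=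
                pow_le_pow_right₀ (by norm_num) (by omega)
            _ = 27 ^ (e + 2) := by rw [pow_mul]; norm_num
        · rw [← Real.rpow_natCast]
          refine Real.rpow_le_rpow_of_exponent_le hL ?_
          push_cast
          linarith
      _ ≤ _ := by gcongr
  have h2 : (M : ℝ) ^ (3 * e + 2) * T ^ 2 ≤
      36 * 27 ^ (e + 2) * (δ⁻¹ ^ 2 * L ^ (3 * ((e + 2 : ℕ) : ℝ) - 4 * γ)) := by
    calc (M : ℝ) ^ (3 * e + 2) * T ^ 2
        ≤ (3 * L) ^ (3 * e + 2) * (36 * (δ⁻¹ ^ 2 * L ^ (4 - 4 * γ))) := by gcongr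
      _ = 3 ^ (3 * e + 2) * (36 * (δ⁻¹ ^ 2 * (L ^ (3 * e + 2) * L ^ (4 - 4 * γ)))) := by
        rw [mul_pow]; ring
      _ = 3 ^ (3 * e + 2) * (36 * (δ⁻¹ ^ 2 * L ^ (3 * ((e + 2 : ℕ) : ℝ) - 4 * γ))) := by
        rw [← Real.rpow_natCast L, ← Real.rpow_add hL0]
        congr 4
        push_cast
        ring
      _ ≤ 27 ^ (e + 2) * (36 * (δ⁻¹ ^ 2 * L ^ (3 * ((e + 2 : ℕ) : ℝ) - 4 * γ))) := by
        gcongr ?_ * _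
        calc (3 : ℝ) ^ (3 * e + 2) ≤ 3 ^ (3 * (e + 2)) :=
              pow_le_pow_right₀ (by norm_num) (by omega)
          _ = 27 ^ (e + 2) := by rw [pow_mul]; norm_num
      _ = _ := by ring
  calc (slabEnergy (e + 2) M T : ℝ)
      ≤ 100 * 27 ^ (e + 2) * ((M : ℝ) ^ (3 * e + 4) + (M : ℝ) ^ (3 * e + 2) * T ^ 2) :=
        slabEnergy_le_thick (by omega) hM
    _ ≤ 100 * 27 ^ (e + 2) * (27 ^ (e + 2) * (δ⁻¹ ^ 2 * L ^ (3 * ((e + 2 : ℕ) : ℝ) - 4 * γ)) +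
        36 * 27 ^ (e + 2) * (δ⁻¹ ^ 2 * L ^ (3 * ((e + 2 : ℕ) : ℝ) - 4 * γ))) := by gcongr
    _ = _ := by ring

lemma slabEnergy_le_rpow_thin (hd : 3 ≤ d) (hη : 0 < η) (hη₁ : 11 * η ≤ 2 - 2 * γ)
    (hη₂ : 11 * η ≤ 2 * γ - 1) (hL : 1 ≤ L) (hδ : 0 < δ) (hδ' : δ < 1) (hM : 1 ≤ M)
    (hML : M ≤ 3 * L) (hT1 : 1 ≤ T) (hT : T ≤ 6 * (δ⁻¹ * L ^ (2 - 2 * γ))) :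
    (slabEnergy d M T : ℝ) ≤ 195000 * 27 ^ d * 27 ^ d * (3 + 1 / η) * δ⁻¹ ^ 2 *
      L ^ (3 * (d : ℝ) - 2 * γ - 1 - 10 * η) := by
  obtain ⟨e, rfl⟩ : ∃ e, d = e + 2 := ⟨d - 2, by omega⟩
  have hL0 : 0 < L := by linarith
  have hM1 : (1 : ℝ) ≤ M := by exact_mod_cast hM
  have hδ1 : 1 ≤ δ⁻¹ ^ 2 := one_le_pow₀ (one_le_inv_iff₀.mpr ⟨hδ, hδ'.le⟩)
  have hT2 : (T : ℝ) ^ 2 ≤ 36 * (δ⁻¹ ^ 2 * L ^ (4 - 4 * γ)) := by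
    rw [← sq_inv_mul_rpow hL0]
    calc (T : ℝ) ^ 2 ≤ (6 * (δ⁻¹ * L ^ (2 - 2 * γ))) ^ 2 := by gcongr
      _ = _ := by ring
  have hlog0 : 0 ≤ Real.log M := Real.log_nonneg hM1
  have hlog : 1 + Real.log M ≤ (3 + 1 / η) * L ^ η := by
    have h1 : Real.log M ≤ Real.log 3 + Real.log L := by
      rw [← Real.log_mul (by norm_num) hL0.ne']
      exact Real.log_le_log (by linarith) hML
    have h2 : Real.log 3 ≤ 2 := by
      have := Real.log_le_sub_one_of_pos (show (0 : ℝ) < 3 by norm_num)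
      linarith
    have h3 := Real.log_le_rpow_div hL0.le hη
    have h4 : 1 ≤ L ^ η := Real.one_le_rpow hL hη.le
    have h5 : (3 + 1 / η) * L ^ η = 3 * L ^ η + L ^ η / η := by ring
    linarith
  have hpow : (M : ℝ) ^ (3 * e + 2) ≤ 27 ^ (e + 2) * L ^ (3 * e + 2) := by
    calc (M : ℝ) ^ (3 * e + 2) ≤ (3 * L) ^ (3 * e + 2) := by gcongr
      _ = 3 ^ (3 * e + 2) * L ^ (3 * e + 2) := by rw [mul_pow]
      _ ≤ 27 ^ (e + 2) * L ^ (3 * e + 2) := by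
        gcongr ?_ * _
        calc (3 : ℝ) ^ (3 * e + 2) ≤ 3 ^ (3 * (e + 2)) :=
              pow_le_pow_right₀ (by norm_num) (by omega)
          _ = 27 ^ (e + 2) := by rw [pow_mul]; norm_num
  have hX : L ^ (3 * e + 2) * ((3 * L + 36 * (δ⁻¹ ^ 2 * L ^ (4 - 4 * γ))) * L ^ η) ≤
      39 * (δ⁻¹ ^ 2 * L ^ (3 * ((e + 2 : ℕ) : ℝ) - 2 * γ - 1 - 10 * η)) := by
    have h1 : L ^ (3 * e + 2) * L * L ^ η ≤
        1 * L ^ (3 * ((e + 2 : ℕ) : ℝ) - 2 * γ - 1 - 10 * η) := by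
      rw [one_mul, ← pow_succ, ← Real.rpow_natCast L, ← Real.rpow_add hL0]
      refine Real.rpow_le_rpow_of_exponent_le hL ?_
      push_cast
      linarith
    have h2 : L ^ (3 * e + 2) * L ^ (4 - 4 * γ) * L ^ η ≤
        L ^ (3 * ((e + 2 : ℕ) : ℝ) - 2 * γ - 1 - 10 * η) := by
      rw [← Real.rpow_natCast L, ← Real.rpow_add hL0, ← Real.rpow_add hL0]
      refine Real.rpow_le_rpow_of_exponent_le hL ?_
      push_cast
      linarith
    calc L ^ (3 * e + 2) * ((3 * L + 36 * (δ⁻¹ ^ 2 * L ^ (4 - 4 * γ))) * L ^ η)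
        = 3 * (L ^ (3 * e + 2) * L * L ^ η) +
          36 * (δ⁻¹ ^ 2 * (L ^ (3 * e + 2) * L ^ (4 - 4 * γ) * L ^ η)) := by ring
      _ ≤ 3 * (1 * L ^ (3 * ((e + 2 : ℕ) : ℝ) - 2 * γ - 1 - 10 * η)) +
          36 * (δ⁻¹ ^ 2 * L ^ (3 * ((e + 2 : ℕ) : ℝ) - 2 * γ - 1 - 10 * η)) := by gcongr
      _ ≤ 3 * (δ⁻¹ ^ 2 * L ^ (3 * ((e + 2 : ℕ) : ℝ) - 2 * γ - 1 - 10 * η)) +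
          36 * (δ⁻¹ ^ 2 * L ^ (3 * ((e + 2 : ℕ) : ℝ) - 2 * γ - 1 - 10 * η)) := by gcongr
      _ = _ := by ring
  calc (slabEnergy (e + 2) M T : ℝ)
      ≤ 5000 * 27 ^ e * ((M : ℝ) ^ (3 * e + 2) * (M + T ^ 2) * (1 + Real.log M)) :=
        slabEnergy_le_thin (by omega) hM hT1
    _ ≤ 5000 * 27 ^ (e + 2) * (27 ^ (e + 2) * L ^ (3 * e + 2) *
        (3 * L + 36 * (δ⁻¹ ^ 2 * L ^ (4 - 4 * γ))) * ((3 + 1 / η) * L ^ η)) := by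
        gcongr
        · norm_num
        · omega
    _ = 5000 * 27 ^ (e + 2) * 27 ^ (e + 2) * (3 + 1 / η) *
        (L ^ (3 * e + 2) * ((3 * L + 36 * (δ⁻¹ ^ 2 * L ^ (4 - 4 * γ))) * L ^ η)) := by ring
    _ ≤ 5000 * 27 ^ (e + 2) * 27 ^ (e + 2) * (3 + 1 / η) *
        (39 * (δ⁻¹ ^ 2 * L ^ (3 * ((e + 2 : ℕ) : ℝ) - 2 * γ - 1 - 10 * η))) := by gcongr
    _ = _ := by ring

end Exponents

lemma countQuintA_le_slabEnergy {d M T : ℕ} {L δ γ ε₁ ε₂ ε₃ ε₄ ε₅ β β' : ℝ}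
    {k k' k10 k20 k30 k40 k50 : EuclideanSpace ℝ (Fin d)} (hL : 0 < L) (hM : 2 * L ≤ M)
    (hT : δ⁻¹ * L ^ (-(2 * γ)) * L ^ 2 ≤ T) (h₁ : ε₁ = 1 ∨ ε₁ = -1) (h₂ : ε₂ = 1 ∨ ε₂ = -1)
    (h₃ : ε₃ = 1 ∨ ε₃ = -1) (h₄ : ε₄ = 1 ∨ ε₄ = -1) (h₅ : ε₅ = 1 ∨ ε₅ = -1)
    (hne : ¬(ε₁ = ε₂ ∧ ε₂ = ε₃)) (hne' : ¬(-ε₁ = ε₄ ∧ ε₄ = ε₅)) (hk : k ∈ ZLat d L)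
    (hk' : k' ∈ ZLat d L) :
    countQuintA d L δ γ ε₁ ε₂ ε₃ ε₄ ε₅ β β' k k' k10 k20 k30 k40 k50 ≤
      slabEnergy d M (2 * T) := by
  have h₁' : -ε₁ = 1 ∨ -ε₁ = -1 := by rcases h₁ with rfl | rfl <;> norm_num
  unfold countQuintA
  refine ncard_le_slabEnergy (c := fun q => q.1) (a := fun q => q.2.1) (b := fun q => q.2.2.1)
    (a' := fun q => q.2.2.2.1) (b' := fun q => q.2.2.2.2) (c₀ := k10) (a₀ := k20) (b₀ := k30)
    (a₀' := k40) (b₀' := k50) (β := β) (β' := β')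
    hL hM hT h₁ h₂ h₃ hne h₁' h₄ h₅ hne' hk hk' ?_ ?_ ?_ ?_
  · rintro q ⟨-, -, -, -, -, hq, -⟩
    exact hq
  · rintro q ⟨z1, z2, z3, -, -, -, n2, n3, -, -, l, -, m, -⟩
    exact ⟨z1, z2, z3, n2, n3, l, m⟩
  · rintro q ⟨z1, -, -, z4, z5, -, -, -, n4, n5, -, l, -, m⟩
    refine ⟨z1, z4, z5, n4, n5, ?_, ?_⟩
    · rwa [neg_smul]
    · rwa [neg_mul]
  · intro q _ q' _ h
    exact h

lemma countQuintB_le_slabEnergy {d M T : ℕ} {L δ γ ε₁ ε₂ ε₃ ε₄ ε₅ β β' : ℝ}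
    {k k' k10 k20 k30 k40 k50 : EuclideanSpace ℝ (Fin d)} (hL : 0 < L) (hM : 2 * L ≤ M)
    (hT : 2 * (δ⁻¹ * L ^ (-(2 * γ))) * L ^ 2 ≤ T) (h₁ : ε₁ = 1 ∨ ε₁ = -1)
    (h₂ : ε₂ = 1 ∨ ε₂ = -1) (h₃ : ε₃ = 1 ∨ ε₃ = -1) (h₄ : ε₄ = 1 ∨ ε₄ = -1)
    (h₅ : ε₅ = 1 ∨ ε₅ = -1) (hne : ¬(ε₃ = ε₁ ∧ ε₁ = ε₂)) (hne' : ¬(ε₃ = ε₄ ∧ ε₄ = ε₅))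
    (hk : k ∈ ZLat d L) (hk' : k' ∈ ZLat d L) :
    countQuintB d L δ γ ε₁ ε₂ ε₃ ε₄ ε₅ β β' k k' k10 k20 k30 k40 k50 ≤
      slabEnergy d M (2 * T) := by
  have hkk : k + k' ∈ ZLat d L := by
    have := signed_sub_mem_ZLat (Or.inl rfl) (Or.inr rfl) hk hk'
    simpa using this
  unfold countQuintB
  refine ncard_le_slabEnergy (c := fun q => q.2.2.1) (a := fun q => q.1) (b := fun q => q.2.1)
    (a' := fun q => q.2.2.2.1) (b' := fun q => q.2.2.2.2) (c₀ := k30) (a₀ := k10) (b₀ := k20)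
    (a₀' := k40) (b₀' := k50) (β := β) (β' := β + β')
    hL hM hT h₃ h₁ h₂ hne h₃ h₄ h₅ hne' hk hkk ?_ ?_ ?_ ?_
  · rintro q ⟨-, -, -, -, -, -, -, hq, -⟩
    exact hq
  · rintro q ⟨z1, z2, z3, -, -, n1, n2, -, -, -, l, -, m, -⟩
    refine ⟨z3, z1, z2, n1, n2, ?_, ?_⟩
    · rw [← l]; abel
    · have := (abs_nonneg _).trans m
      rw [show ε₃ * ‖q.2.2.1‖ ^ 2 + ε₁ * ‖q.1‖ ^ 2 + ε₂ * ‖q.2.1‖ ^ 2 - β =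
        ε₁ * ‖q.1‖ ^ 2 + ε₂ * ‖q.2.1‖ ^ 2 + ε₃ * ‖q.2.2.1‖ ^ 2 - β by ring]
      linarith
  · rintro q ⟨-, -, z3, z4, z5, -, -, -, n4, n5, l, l', m, m'⟩
    refine ⟨z3, z4, z5, n4, n5, ?_, ?_⟩
    · rw [← l, ← l']; abel
    · rw [abs_le] at *
      constructor <;> linarith [m.1, m.2, m'.1, m'.2]
  · rintro ⟨x1, x2, x3, x4, x5⟩ _ ⟨y1, y2, y3, y4, y5⟩ _ h
    simp only [Prod.mk.injEq] at h ⊢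
    tauto

/-- Admissible parameters for the slab energy attached to the scale `L` and the width `δ⁻¹`. -/
lemma exists_slab_params {L δ γ : ℝ} (hγ : γ < 1) (hL : 1 ≤ L) (hδ : 0 < δ) (hδ' : δ < 1) :
    ∃ M T : ℕ, 1 ≤ M ∧ 2 * L ≤ M ∧ M ≤ 3 * L ∧ 1 ≤ 2 * T ∧
      2 * (δ⁻¹ * L ^ (-(2 * γ))) * L ^ 2 ≤ T ∧
      δ⁻¹ * L ^ (-(2 * γ)) * L ^ 2 ≤ T ∧ ((2 * T : ℕ) : ℝ) ≤ 6 * (δ⁻¹ * L ^ (2 - 2 * γ)) := by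
  have hL0 : 0 < L := by linarith
  have hτ : δ⁻¹ * L ^ (-(2 * γ)) * L ^ 2 = δ⁻¹ * L ^ (2 - 2 * γ) := by
    rw [mul_assoc, ← Real.rpow_natCast L, ← Real.rpow_add hL0]
    congr 2
    push_cast
    ring
  rw [mul_assoc 2, hτ]
  have hτ1 : 1 ≤ δ⁻¹ * L ^ (2 - 2 * γ) :=
    one_le_mul_of_one_le_of_one_le (one_le_inv_iff₀.mpr ⟨hδ, hδ'.le⟩)
      (Real.one_le_rpow hL (by linarith))
  set τ := δ⁻¹ * L ^ (2 - 2 * γ)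
  have hM := Nat.le_ceil (2 * L)
  have hM' := Nat.ceil_lt_add_one (show 0 ≤ 2 * L by linarith)
  have hT := Nat.le_ceil (2 * τ)
  have hT' := Nat.ceil_lt_add_one (show 0 ≤ 2 * τ by linarith)
  refine ⟨⌈2 * L⌉₊, ⌈2 * τ⌉₊, ?_, hM, by linarith, ?_, hT, by linarith, ?_⟩
  · exact Nat.ceil_pos.mpr (by linarith)
  · have : 0 < ⌈2 * τ⌉₊ := Nat.ceil_pos.mpr (by linarith)
    omega
  · push_cast
    linarith

theorem statement10 (d : ℕ) (hd : 3 ≤ d) (γ : ℝ) (hγ : 0 < γ) (hγ' : γ < 1) :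
    ∃ η₀ : ℝ, 0 < η₀ ∧ ∀ η : ℝ, 0 < η → η ≤ η₀ →
    ∃ C : ℝ, 2 ≤ C ∧
    ∀ L δ : ℝ, C ≤ L → 0 < δ → δ < 1 → δ⁻¹ ≤ L ^ (η ^ 2) →
    ∀ ε₁ ε₂ ε₃ ε₄ ε₅ : ℝ,
      (ε₁ = 1 ∨ ε₁ = -1) → (ε₂ = 1 ∨ ε₂ = -1) → (ε₃ = 1 ∨ ε₃ = -1) →
      (ε₄ = 1 ∨ ε₄ = -1) → (ε₅ = 1 ∨ ε₅ = -1) →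
      ¬(ε₁ = ε₂ ∧ ε₂ = ε₃) →
    ∀ (k10 k20 k30 k40 k50 k k' : EuclideanSpace ℝ (Fin d)), k ∈ ZLat d L → k' ∈ ZLat d L →
    ∀ β β' : ℝ,
      ((¬(-ε₁ = ε₄ ∧ ε₄ = ε₅) →
          ((γ ≤ 1 / 2 →
              (countQuintA d L δ γ ε₁ ε₂ ε₃ ε₄ ε₅ β β' k k' k10 k20 k30 k40 k50 : ℝ) ≤ C * δ⁻¹ ^ 2 * L ^ (3 * (d : ℝ) - 4 * γ)) ∧
            (1 / 2 < γ →
              (countQuintA d L δ γ ε₁ ε₂ ε₃ ε₄ ε₅ β β' k k' k10 k20 k30 k40 k50 : ℝ) ≤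
                C * δ⁻¹ ^ 2 * L ^ (3 * ((d : ℝ) - γ) - min γ (1 - γ) - 10 * η)) ∧
            (countQuintA d L δ γ ε₁ ε₂ ε₃ ε₄ ε₅ β β' k k' k10 k20 k30 k40 k50 : ℝ) ≤ C * δ⁻¹ ^ 2 * L ^ (3 * ((d : ℝ) - γ) - min γ (1 - γ)))) ∧
        (¬(-ε₁ = -ε₂ ∧ -ε₂ = ε₄) → ¬(-ε₁ = -ε₂ ∧ -ε₂ = ε₅) → ¬(-ε₁ = ε₄ ∧ ε₄ = ε₅) →
            ¬(-ε₂ = ε₄ ∧ ε₄ = ε₅) →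
          ((γ ≤ 1 / 2 →
              (countQuintB d L δ γ ε₁ ε₂ ε₃ ε₄ ε₅ β β' k k' k10 k20 k30 k40 k50 : ℝ) ≤ C * δ⁻¹ ^ 2 * L ^ (3 * (d : ℝ) - 4 * γ)) ∧
            (1 / 2 < γ →
              (countQuintB d L δ γ ε₁ ε₂ ε₃ ε₄ ε₅ β β' k k' k10 k20 k30 k40 k50 : ℝ) ≤
                C * δ⁻¹ ^ 2 * L ^ (3 * ((d : ℝ) - γ) - min γ (1 - γ) - 10 * η)) ∧
            (countQuintB d L δ γ ε₁ ε₂ ε₃ ε₄ ε₅ β β' k k' k10 k20 k30 k40 k50 : ℝ) ≤ C * δ⁻¹ ^ 2 * L ^ (3 * ((d : ℝ) - γ) - min γ (1 - γ))))) := by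
  have hcount : ∃ η₀ : ℝ, 0 < η₀ ∧ ∀ η : ℝ, 0 < η → η ≤ η₀ → ∃ C : ℝ, 2 ≤ C ∧
      ∀ L δ : ℝ, C ≤ L → 0 < δ → δ < 1 → ∀ M T : ℕ, 1 ≤ M → M ≤ 3 * L → 1 ≤ T →
      T ≤ 6 * (δ⁻¹ * L ^ (2 - 2 * γ)) →
      ((γ ≤ 1 / 2 → (slabEnergy d M T : ℝ) ≤ C * δ⁻¹ ^ 2 * L ^ (3 * (d : ℝ) - 4 * γ)) ∧
        (1 / 2 < γ → (slabEnergy d M T : ℝ) ≤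
          C * δ⁻¹ ^ 2 * L ^ (3 * ((d : ℝ) - γ) - min γ (1 - γ) - 10 * η)) ∧
        (slabEnergy d M T : ℝ) ≤ C * δ⁻¹ ^ 2 * L ^ (3 * ((d : ℝ) - γ) - min γ (1 - γ))) := by
    rcases le_or_gt γ (1 / 2) with h | h
    · refine ⟨1, one_pos, fun η _ _ => ⟨3700 * 27 ^ d * 27 ^ d, ?_, ?_⟩⟩
      · have : (1 : ℝ) ≤ 27 ^ d := one_le_pow₀ (by norm_num)
        nlinarith
      · intro L δ hL hδ hδ' M T hM hML hT1 hT
        have hL1 : 1 ≤ L := by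
          have : (1 : ℝ) ≤ 27 ^ d := one_le_pow₀ (by norm_num)
          nlinarith
        have key := slabEnergy_le_rpow_thick hd h hL1 hδ hδ' hM hML hT
        refine ⟨fun _ => key, fun h' => absurd h (not_le.mpr h'), ?_⟩
        rwa [min_eq_left (by linarith),
          show 3 * ((d : ℝ) - γ) - γ = 3 * (d : ℝ) - 4 * γ by ring]
    · refine ⟨min ((2 - 2 * γ) / 11) ((2 * γ - 1) / 11),
        lt_min (by linarith) (by linarith), fun η hη hη₀ => ?_⟩
      have hη₁ := hη₀.trans (min_le_left _ _)
      have hη₂ := hη₀.trans (min_le_right _ _)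
      have hC : (2 : ℝ) ≤ 195000 * 27 ^ d * 27 ^ d * (3 + 1 / η) := by
        have h1 : (1 : ℝ) ≤ 27 ^ d := one_le_pow₀ (by norm_num)
        have h2 : (1 : ℝ) ≤ 3 + 1 / η := by
          have : 0 < 1 / η := by positivity
          linarith
        have h3 : (1 : ℝ) ≤ 27 ^ d * 27 ^ d := one_le_mul_of_one_le_of_one_le h1 h1
        have h4 := one_le_mul_of_one_le_of_one_le h3 h2
        linarith
      refine ⟨195000 * 27 ^ d * 27 ^ d * (3 + 1 / η), hC, ?_⟩
      intro L δ hL hδ hδ' M T hM hML hT1 hT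
      have hL1 : 1 ≤ L := by linarith
      have key := slabEnergy_le_rpow_thin hd hη (by linarith) (by linarith) hL1 hδ hδ' hM hML
        hT1 hT
      rw [min_eq_right (by linarith : 1 - γ ≤ γ),
        show 3 * ((d : ℝ) - γ) - (1 - γ) = 3 * (d : ℝ) - 2 * γ - 1 by ring]
      refine ⟨fun h' => absurd h (not_lt.mpr h'), fun _ => key, key.trans ?_⟩
      have hC0 : 0 ≤ 195000 * 27 ^ d * 27 ^ d * (3 + 1 / η) := by linarith
      refine mul_le_mul_of_nonneg_left ?_ (by positivity)
      exact Real.rpow_le_rpow_of_exponent_le hL1 (by linarith)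
  obtain ⟨η₀, hη₀, hcount⟩ := hcount
  refine ⟨η₀, hη₀, fun η hη hηη₀ => ?_⟩
  obtain ⟨C, hC, hcount⟩ := hcount η hη hηη₀
  refine ⟨C, hC, ?_⟩
  intro L δ hL hδ hδ' _ ε₁ ε₂ ε₃ ε₄ ε₅ h₁ h₂ h₃ h₄ h₅ hne k10 k20 k30 k40 k50 k k' hk hk' β β'
  obtain ⟨M, T, hM, hML, hML', hT1, hT, hT', hT6⟩ :=
    exists_slab_params hγ' (by linarith : 1 ≤ L) hδ hδ'
  obtain ⟨b1, b2, b3⟩ := hcount L δ hL hδ hδ' M (2 * T) hM hML' hT1 hT6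
  have hL0 : 0 < L := by linarith
  constructor
  · intro hne'
    have h := countQuintA_le_slabEnergy (k10 := k10) (k20 := k20) (k30 := k30) (k40 := k40)
      (k50 := k50) (β := β) (β' := β') hL0 hML hT' h₁ h₂ h₃ h₄ h₅ hne hne' hk hk'
    have h : (countQuintA d L δ γ ε₁ ε₂ ε₃ ε₄ ε₅ β β' k k' k10 k20 k30 k40 k50 : ℝ) ≤
      slabEnergy d M (2 * T) := by exact_mod_cast h
    exact ⟨fun hγ => h.trans (b1 hγ), fun hγ => h.trans (b2 hγ), h.trans b3⟩
  · intro n1 n2 n3 n4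
    have m1 : ¬(ε₃ = ε₁ ∧ ε₁ = ε₂) := fun hh => hne ⟨hh.2, hh.2.symm.trans hh.1.symm⟩
    have m2 : ¬(ε₃ = ε₄ ∧ ε₄ = ε₅) := by
      rintro ⟨rfl, rfl⟩
      rcases eq_or_ne (-ε₁) ε₃ with e1 | e1
      · exact n3 ⟨e1, rfl⟩
      rcases eq_or_ne (-ε₂) ε₃ with e2 | e2
      · exact n4 ⟨e2, rfl⟩
      have e : ∀ x : ℝ, x = 1 ∨ x = -1 → -x ≠ ε₃ → x = ε₃ := by
        intro x hx hne
        rcases hx with rfl | rfl <;> rcases h₃ with h | h <;> rw [h] at hne ⊢ <;> norm_num at hne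
      exact hne ⟨(e _ h₁ e1).trans (e _ h₂ e2).symm, e _ h₂ e2⟩
    have h := countQuintB_le_slabEnergy (k10 := k10) (k20 := k20) (k30 := k30) (k40 := k40)
      (k50 := k50) (β := β) (β' := β') hL0 hML hT h₁ h₂ h₃ h₄ h₅ m1 m2 hk hk'
    have h : (countQuintB d L δ γ ε₁ ε₂ ε₃ ε₄ ε₅ β β' k k' k10 k20 k30 k40 k50 : ℝ) ≤
      slabEnergy d M (2 * T) := by exact_mod_cast h
    exact ⟨fun hγ => h.trans (b1 hγ), fun hγ => h.trans (b2 hγ), h.trans b3⟩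
end
end
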